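/- (Fundamental Lemma) Let g be a Riemannian metric on T² and let α: ℝ → ℝ² be a minimal axis of a translation element τ. Let c₁: [0,a] → ℝ² and c₂: [0,b] → ℝ² be geodesic segments whose endpoints lie on α(ℝ) and with c₁((0,a)) ∩ α(ℝ) = ∅ and c₂((0,b)) ∩ α(ℝ) = ∅. Suppose there exists a translation element η with η α(ℝ) ∩ α(ℝ) = ∅ such that η α(ℝ) intersects c₁([0,a]) transversally and η⁻¹ α(ℝ) intersects c₂([0,b]) transversally. Then the geodesic flow of g has positive topological entropy. -/

import Mathlib

open Filter Topology Set
open scoped ENNReal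

noncomputable section

/-- The Euclidean norm of a point of `ℝ × ℝ` (the universal covering of `T²`). -/
def norm2 (p : ℝ × ℝ) : ℝ := Real.sqrt (p.1 ^ 2 + p.2 ^ 2)

/-- The translation vector of the covering transformation `τ_{(m,n)}` of `T² = ℝ²/ℤ²`. -/
def lat (k : ℤ × ℤ) : ℝ × ℝ := ((k.1 : ℝ), (k.2 : ℝ))

/-- The transl of a curve in `ℝ²` by the covering transformation `τ_k`. -/
def transl (k : ℤ × ℤ) (c : ℝ → ℝ × ℝ) : ℝ → ℝ × ℝ := fun t => c t + lat k

/-- The asymptotic direction `δ(τ_k)` of the axes of the translation element `τ_k`. -/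
def latDir (k : ℤ × ℤ) : ℝ × ℝ := (norm2 (lat k))⁻¹ • lat k

/-- A smooth Riemannian metric on the torus `T² = ℝ²/ℤ²`, described through its lift to the
universal covering `ℝ²`: a smooth family of positive definite symmetric bilinear forms on the
tangent spaces of `ℝ²`, invariant under the deck transformation group `ℤ²`. -/
structure TorusMetric where
  g : (ℝ × ℝ) → (ℝ × ℝ) → (ℝ × ℝ) → ℝ
  smooth : ContDiff ℝ (⊤ : ℕ∞) fun p : (ℝ × ℝ) × (ℝ × ℝ) × (ℝ × ℝ) => g p.1 p.2.1 p.2.2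
  symm : ∀ x v w, g x v w = g x w v
  linear : ∀ x w, IsLinearMap ℝ fun v => g x v w
  posdef : ∀ x v, v ≠ 0 → 0 < g x v v
  periodic : ∀ (k : ℤ × ℤ) (x v w : ℝ × ℝ), g (x + lat k) v w = g x v w

namespace TorusMetric

/-- The Riemannian length of the curve `c` between the parameters `a` and `b`. -/
def length (M : TorusMetric) (c : ℝ → ℝ × ℝ) (a b : ℝ) : ℝ :=
  ∫ t in a..b, Real.sqrt (M.g (c t) (deriv c t) (deriv c t))

/-- The Riemannian distance on the universal covering `ℝ²` (hence also on `T²`). -/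
def dist (M : TorusMetric) (x y : ℝ × ℝ) : ℝ :=
  sInf {L | ∃ c : ℝ → ℝ × ℝ, ContDiff ℝ 1 c ∧ c 0 = x ∧ c 1 = y ∧ L = M.length c 0 1}

/-- A (complete, unit speed) geodesic of the lifted metric on the universal covering `ℝ²`:
a smooth curve with constant unit speed which is locally length minimizing. -/
def IsGeodesic (M : TorusMetric) (c : ℝ → ℝ × ℝ) : Prop :=
  ContDiff ℝ (⊤ : ℕ∞) c ∧ (∀ t, M.g (c t) (deriv c t) (deriv c t) = 1) ∧
    ∀ t : ℝ, ∃ ε > 0, ∀ s₁ s₂, t - ε ≤ s₁ → s₁ ≤ s₂ → s₂ ≤ t + ε →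
      M.dist (c s₁) (c s₂) = M.length c s₁ s₂

end TorusMetric

/-- The distance between two points of the unit tangent bundle `ST²` of the torus; points of
`ST²` are represented by points of the tangent bundle `ℝ² × ℝ²` of the universal covering
(the deck transformations act trivially on the vector component). -/
def phaseDist (p q : (ℝ × ℝ) × (ℝ × ℝ)) : ℝ :=
  sInf {r : ℝ | ∃ k : ℤ × ℤ, r = norm2 (p.1 - (q.1 + lat k)) + norm2 (p.2 - q.2)}

/-- A `(φ,ε)`-separated set with respect to time `T` for the geodesic flow `φ` of `M` on
`ST²`: a finite family of geodesics (each geodesic `c` representing the phase point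
`(c 0, ċ 0) ∈ ST²`, of which `t ↦ (c t, ċ t)` is the flow orbit) such that any two distinct
members satisfy `max_{0 ≤ t ≤ T} d(φᵗ v, φᵗ w) > ε`. -/
def IsSeparated (M : TorusMetric) (ε T : ℝ) (F : Finset (ℝ → ℝ × ℝ)) : Prop :=
  (∀ c ∈ F, M.IsGeodesic c) ∧
    ∀ c₁ ∈ F, ∀ c₂ ∈ F, c₁ ≠ c₂ →
      ∃ t ∈ Set.Icc (0 : ℝ) T, ε < phaseDist (c₁ t, deriv c₁ t) (c₂ t, deriv c₂ t)

/-- `r_T(φ, ε)`: the maximal cardinality of `(φ,ε)`-separated sets with respect to `T`. -/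
def sepCount (M : TorusMetric) (ε T : ℝ) : ℝ≥0∞ :=
  ⨆ (F : Finset (ℝ → ℝ × ℝ)) (_ : IsSeparated M ε T F), (F.card : ℝ≥0∞)

/-- Extended real logarithm of an extended nonnegative real. -/
def elog (x : ℝ≥0∞) : EReal :=
  if x = 0 then ⊥ else if x = ⊤ then ⊤ else ((Real.log x.toReal : ℝ) : EReal)

/-- Bowen's topological entropy `h_top(g)` of the geodesic flow of `g` on `ST²`:
`lim_{ε → 0} limsup_{T → ∞} (1/T) log r_T(φ,ε)`; since `r_T(φ,ε)` is monotone in `ε`,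
the limit `ε → 0` is realized as the supremum over `ε > 0`. -/
def topEnt (M : TorusMetric) : EReal :=
  ⨆ (ε : ℝ) (_ : 0 < ε),
    Filter.limsup (fun T : ℝ => ((T⁻¹ : ℝ) : EReal) * elog (sepCount M ε T)) Filter.atTop

/-- The forward ray `c⁺` of `c` is escaping: `‖c(t)‖ → ∞` as `t → ∞`. -/
def EscapesForward (c : ℝ → ℝ × ℝ) : Prop :=
  Filter.Tendsto (fun t => norm2 (c t)) Filter.atTop Filter.atTop

/-- The backward ray `c⁻` of `c` is escaping: `‖c(-t)‖ → ∞` as `t → ∞`. -/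
def EscapesBackward (c : ℝ → ℝ × ℝ) : Prop :=
  Filter.Tendsto (fun t => norm2 (c (-t))) Filter.atTop Filter.atTop

/-- `z ∈ S¹` is the asymptotic direction `δ(c⁺) = lim_{t → ∞} c(t)/‖c(t)‖` of the forward
ray of `c`. -/
def HasDirection (c : ℝ → ℝ × ℝ) (z : ℝ × ℝ) : Prop :=
  norm2 z = 1 ∧ Filter.Tendsto (fun t => (norm2 (c t))⁻¹ • c t) Filter.atTop (nhds z)

/-- The canonical projection `π : S¹ → P¹(ℝ) ≅ ℝ ∪ {∞}`, sending `(x, y)` to `y/x` if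
`x ≠ 0` and to `∞` otherwise; `ℝ ∪ {∞}` is the one-point compactification of `ℝ`. -/
def projPt (z : ℝ × ℝ) : OnePoint ℝ :=
  if z.1 = 0 then OnePoint.infty else ((z.2 / z.1 : ℝ) : OnePoint ℝ)

/-- `crossDet v w ≠ 0` expresses transversality of two directions in `ℝ²`. -/
def crossDet (v w : ℝ × ℝ) : ℝ := v.1 * w.2 - v.2 * w.1

/-- The set of points at which the curve `c₁` (restricted to parameters in `D₁`) and the
curve `c₂` (restricted to parameters in `D₂`) intersect transversally. -/
def transInter (c₁ c₂ : ℝ → ℝ × ℝ) (D₁ D₂ : Set ℝ) : Set (ℝ × ℝ) :=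
  {x | ∃ s ∈ D₁, ∃ t ∈ D₂, c₁ s = x ∧ c₂ t = x ∧ crossDet (deriv c₁ s) (deriv c₂ t) ≠ 0}

/-- The geodesic `c` is an axis of the (nontrivial) translation element `τ_k`:
`τ_k c(t) = c(t + ℓ)` for some `ℓ` and all `t`. -/
def IsAxisOf (M : TorusMetric) (c : ℝ → ℝ × ℝ) (k : ℤ × ℤ) : Prop :=
  M.IsGeodesic c ∧ k ≠ 0 ∧ ∃ ℓ : ℝ, ∀ t, c (t + ℓ) = c t + lat k

/-- The geodesic `c` is an axis of some nontrivial translation element. -/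
def IsAxis (M : TorusMetric) (c : ℝ → ℝ × ℝ) : Prop := ∃ k : ℤ × ℤ, IsAxisOf M c k

/-- The curve `c` is minimal: each of its segments minimizes the Riemannian length between
its endpoints. -/
def IsMinimal (M : TorusMetric) (c : ℝ → ℝ × ℝ) : Prop :=
  ∀ s t : ℝ, s ≤ t → M.dist (c s) (c t) = M.length c s t

/-- Equivalence of translation elements: `τ₁^a = τ₂^b` for some nonzero integers `a, b`. -/
def TransEquiv (k₁ k₂ : ℤ × ℤ) : Prop := ∃ a b : ℤ, a ≠ 0 ∧ b ≠ 0 ∧ a • k₁ = b • k₂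

/-- A translation element is primitive if it is not a nontrivial power of another
translation element. -/
def IsPrimitive (k : ℤ × ℤ) : Prop := k ≠ 0 ∧ ∀ (j : ℤ × ℤ) (n : ℤ), k = n • j → IsUnit n

/-- The metric `g` on `T²` is flat, i.e. its Gaussian curvature vanishes identically;
equivalently (by the theorems of Myers–Steenrod and Cartan–Hadamard), the universal covering
`ℝ²` with the induced Riemannian distance is isometric to the Euclidean plane. -/
def IsFlat (M : TorusMetric) : Prop :=
  ∃ F : (ℝ × ℝ) ≃ (ℝ × ℝ), ∀ x y, M.dist x y = norm2 (F x - F y)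

/-! ### Periodic functions and bounds for the metric tensor -/

/-- The lattice vector of the fundamental cell containing a point. -/
def cell (x : ℝ × ℝ) : ℤ × ℤ := (⌊x.1⌋, ⌊x.2⌋)

lemma lat_add (k l : ℤ × ℤ) : lat (k + l) = lat k + lat l := by
  ext <;> simp [lat]

lemma lat_neg (k : ℤ × ℤ) : lat (-k) = -lat k := by
  ext <;> simp [lat]

lemma lat_zero : lat 0 = 0 := by
  ext <;> simp [lat]

lemma lat_smul (n : ℤ) (k : ℤ × ℤ) : lat (n • k) = (n : ℝ) • lat k := by
  ext <;> simp [lat]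

lemma sub_cell_mem (x : ℝ × ℝ) : x - lat (cell x) ∈ Icc (0 : ℝ × ℝ) 1 := by
  refine ⟨⟨?_, ?_⟩, ⟨?_, ?_⟩⟩ <;> simp [cell, lat, (Int.fract_lt_one _).le]

lemma exists_bound_of_periodic {F : Type*} [NormedAddCommGroup F] {f : ℝ × ℝ → F}
    (hf : Continuous f) (hp : ∀ k x, f (x + lat k) = f x) : ∃ C, 0 ≤ C ∧ ∀ x, ‖f x‖ ≤ C := by
  obtain ⟨C, hC⟩ := (isCompact_Icc (a := (0 : ℝ × ℝ)) (b := 1)).exists_bound_of_continuousOn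
    hf.continuousOn
  refine ⟨max C 0, le_max_right _ _, fun x => ?_⟩
  have h := hC _ (sub_cell_mem x)
  have h2 := hp (-cell x) x
  rw [lat_neg, ← sub_eq_add_neg] at h2
  rw [h2] at h
  exact h.trans (le_max_left _ _)

lemma exists_lipschitz_of_periodic {f : ℝ × ℝ → ℝ} (hf : ContDiff ℝ 1 f)
    (hp : ∀ k x, f (x + lat k) = f x) : ∃ K, 0 ≤ K ∧ ∀ x y, |f x - f y| ≤ K * ‖x - y‖ := by
  obtain ⟨K, hK, h⟩ := exists_bound_of_periodic (f := fderiv ℝ f)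
    (hf.continuous_fderiv (by norm_num)) (fun k x => by
      have : f = fun y => f (y + lat k) := funext fun y => (hp k y).symm
      conv_rhs => rw [this]
      rw [fderiv_comp_add_right])
  refine ⟨K, hK, fun x y => ?_⟩
  have := convex_univ.norm_image_sub_le_of_norm_fderiv_le (f := f) (C := K) (x := y) (y := x)
    (fun z _ => (hf.differentiable (by norm_num)).differentiableAt) (fun z _ => h z)
    (mem_univ _) (mem_univ _)
  simpa using this

namespace TorusMetric
variable (M : TorusMetric)

lemma g_add_left (x u v w : ℝ × ℝ) : M.g x (u + v) w = M.g x u w + M.g x v w :=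
  (M.linear x w).map_add u v

lemma g_smul_left (x : ℝ × ℝ) (a : ℝ) (v w : ℝ × ℝ) : M.g x (a • v) w = a * M.g x v w :=
  (M.linear x w).map_smul a v

lemma g_add_right (x u v w : ℝ × ℝ) : M.g x w (u + v) = M.g x w u + M.g x w v := by
  rw [M.symm, g_add_left, M.symm x u, M.symm x v]

lemma g_smul_right (x : ℝ × ℝ) (a : ℝ) (v w : ℝ × ℝ) : M.g x w (a • v) = a * M.g x w v := by
  rw [M.symm, g_smul_left, M.symm]

/-- The coefficients of the metric tensor. -/
def coef (i j : ℝ × ℝ) (x : ℝ × ℝ) : ℝ := M.g x i j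

lemma coef_contDiff (i j : ℝ × ℝ) : ContDiff ℝ (⊤ : ℕ∞) (M.coef i j) :=
  M.smooth.comp (contDiff_id.prodMk (contDiff_const.prodMk contDiff_const))

lemma coef_periodic (i j : ℝ × ℝ) (k : ℤ × ℤ) (x : ℝ × ℝ) :
    M.coef i j (x + lat k) = M.coef i j x := M.periodic k x i j

lemma g_eq (x v w : ℝ × ℝ) : M.g x v w = v.1 * w.1 * M.coef (1, 0) (1, 0) x +
    (v.1 * w.2 + v.2 * w.1) * M.coef (1, 0) (0, 1) x + v.2 * w.2 * M.coef (0, 1) (0, 1) x := by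
  have hv : v = v.1 • ((1, 0) : ℝ × ℝ) + v.2 • ((0, 1) : ℝ × ℝ) := by ext <;> simp
  have hw : w = w.1 • ((1, 0) : ℝ × ℝ) + w.2 • ((0, 1) : ℝ × ℝ) := by ext <;> simp
  conv_lhs => rw [hv, hw]
  simp only [g_add_left, g_add_right, g_smul_left, g_smul_right, coef]
  rw [M.symm x (0, 1) (1, 0)]
  ring

lemma continuous_g : Continuous fun p : (ℝ × ℝ) × (ℝ × ℝ) × (ℝ × ℝ) => M.g p.1 p.2.1 p.2.2 :=
  M.smooth.continuous

lemma g_zero_left (x w : ℝ × ℝ) : M.g x 0 w = 0 := (M.linear x w).map_zero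

lemma g_self_nonneg (x v : ℝ × ℝ) : 0 ≤ M.g x v v := by
  rcases eq_or_ne v 0 with rfl | h
  · rw [g_zero_left]
  · exact (M.posdef x v h).le

/-- The Riemannian norm of a tangent vector. -/
def nrm (x v : ℝ × ℝ) : ℝ := Real.sqrt (M.g x v v)

lemma nrm_nonneg (x v : ℝ × ℝ) : 0 ≤ M.nrm x v := Real.sqrt_nonneg _

lemma nrm_sq (x v : ℝ × ℝ) : M.nrm x v ^ 2 = M.g x v v := Real.sq_sqrt (M.g_self_nonneg x v)

lemma nrm_smul (x : ℝ × ℝ) (a : ℝ) (v : ℝ × ℝ) : M.nrm x (a • v) = |a| * M.nrm x v := by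
  unfold nrm
  rw [g_smul_left, g_smul_right, ← mul_assoc, Real.sqrt_mul (mul_self_nonneg a),
    Real.sqrt_mul_self_eq_abs]

lemma nrm_periodic (k : ℤ × ℤ) (x v : ℝ × ℝ) : M.nrm (x + lat k) v = M.nrm x v := by
  unfold nrm; rw [M.periodic]

lemma continuous_nrm : Continuous fun p : (ℝ × ℝ) × (ℝ × ℝ) => M.nrm p.1 p.2 :=
  Real.continuous_sqrt.comp
    (M.continuous_g.comp (continuous_fst.prodMk (continuous_snd.prodMk continuous_snd)))

lemma exists_nrm_bounds : ∃ l L : ℝ, 0 < l ∧ 0 < L ∧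
    ∀ x v, l * ‖v‖ ≤ M.nrm x v ∧ M.nrm x v ≤ L * ‖v‖ := by
  have hK : IsCompact (Icc (0 : ℝ × ℝ) 1 ×ˢ Metric.sphere (0 : ℝ × ℝ) 1) :=
    isCompact_Icc.prod (isCompact_sphere _ _)
  have hne : (Icc (0 : ℝ × ℝ) 1 ×ˢ Metric.sphere (0 : ℝ × ℝ) 1).Nonempty :=
    ⟨(0, (1, 0)), ⟨le_refl _, zero_le_one⟩, by simp⟩
  obtain ⟨p, hp, hpm⟩ := hK.exists_isMinOn hne M.continuous_nrm.continuousOn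
  obtain ⟨q, hq, hqm⟩ := hK.exists_isMaxOn hne M.continuous_nrm.continuousOn
  have hpos : ∀ r ∈ Icc (0 : ℝ × ℝ) 1 ×ˢ Metric.sphere (0 : ℝ × ℝ) 1, 0 < M.nrm r.1 r.2 := by
    rintro r ⟨-, hr⟩
    refine Real.sqrt_pos.2 (M.posdef _ _ ?_)
    rintro h
    simp [h] at hr
  refine ⟨M.nrm p.1 p.2, M.nrm q.1 q.2, hpos p hp, hpos q hq, fun x v => ?_⟩
  rcases eq_or_ne v 0 with rfl | hv
  · simp [nrm, g_zero_left]
  have hv' : 0 < ‖v‖ := norm_pos_iff.2 hv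
  have hmem : (x - lat (cell x), ‖v‖⁻¹ • v) ∈ Icc (0 : ℝ × ℝ) 1 ×ˢ Metric.sphere (0 : ℝ × ℝ) 1 := by
    refine ⟨sub_cell_mem x, ?_⟩
    simp [norm_smul, hv'.ne']
  have h1 : M.nrm p.1 p.2 ≤ M.nrm (x - lat (cell x)) (‖v‖⁻¹ • v) := hpm hmem
  have h2 : M.nrm (x - lat (cell x)) (‖v‖⁻¹ • v) ≤ M.nrm q.1 q.2 := hqm hmem
  rw [sub_eq_add_neg, ← lat_neg, nrm_periodic, nrm_smul, abs_of_pos (inv_pos.2 hv')] at h1 h2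
  constructor
  · rw [inv_mul_eq_div, le_div_iff₀ hv'] at h1; exact h1
  · rw [inv_mul_eq_div, div_le_iff₀ hv'] at h2; exact h2

/-- A lower comparison constant between the Riemannian and the coordinate norm. -/
def lo : ℝ := M.exists_nrm_bounds.choose
/-- An upper comparison constant between the Riemannian and the coordinate norm. -/
def up : ℝ := M.exists_nrm_bounds.choose_spec.choose

lemma lo_pos : 0 < M.lo := M.exists_nrm_bounds.choose_spec.choose_spec.1
lemma up_pos : 0 < M.up := M.exists_nrm_bounds.choose_spec.choose_spec.2.1
lemma lo_le_nrm (x v : ℝ × ℝ) : M.lo * ‖v‖ ≤ M.nrm x v :=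
  (M.exists_nrm_bounds.choose_spec.choose_spec.2.2 x v).1
lemma nrm_le_up (x v : ℝ × ℝ) : M.nrm x v ≤ M.up * ‖v‖ :=
  (M.exists_nrm_bounds.choose_spec.choose_spec.2.2 x v).2

lemma exists_g_lipschitz : ∃ K, 0 ≤ K ∧
    ∀ x y v, |M.g x v v - M.g y v v| ≤ K * ‖x - y‖ * ‖v‖ ^ 2 := by
  obtain ⟨K1, h1, H1⟩ := exists_lipschitz_of_periodic
    ((M.coef_contDiff (1, 0) (1, 0)).of_le (by exact_mod_cast le_top)) (M.coef_periodic _ _)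
  obtain ⟨K2, h2, H2⟩ := exists_lipschitz_of_periodic
    ((M.coef_contDiff (1, 0) (0, 1)).of_le (by exact_mod_cast le_top)) (M.coef_periodic _ _)
  obtain ⟨K3, h3, H3⟩ := exists_lipschitz_of_periodic
    ((M.coef_contDiff (0, 1) (0, 1)).of_le (by exact_mod_cast le_top)) (M.coef_periodic _ _)
  refine ⟨K1 + 2 * K2 + K3, by positivity, fun x y v => ?_⟩
  have hv1 : |v.1| ≤ ‖v‖ := norm_fst_le v
  have hv2 : |v.2| ≤ ‖v‖ := norm_snd_le v
  have e : M.g x v v - M.g y v v =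
      v.1 * v.1 * (M.coef (1, 0) (1, 0) x - M.coef (1, 0) (1, 0) y) +
      2 * (v.1 * v.2) * (M.coef (1, 0) (0, 1) x - M.coef (1, 0) (0, 1) y) +
      v.2 * v.2 * (M.coef (0, 1) (0, 1) x - M.coef (0, 1) (0, 1) y) := by
    rw [g_eq, g_eq]; ring
  rw [e]
  refine (abs_add_three _ _ _).trans ?_
  simp only [abs_mul, abs_two]
  have a1 : |v.1| * |v.1| * |M.coef (1, 0) (1, 0) x - M.coef (1, 0) (1, 0) y| ≤
      ‖v‖ * ‖v‖ * (K1 * ‖x - y‖) := by gcongr; exact H1 x y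
  have a2 : 2 * (|v.1| * |v.2|) * |M.coef (1, 0) (0, 1) x - M.coef (1, 0) (0, 1) y| ≤
      2 * (‖v‖ * ‖v‖) * (K2 * ‖x - y‖) := by gcongr; exact H2 x y
  have a3 : |v.2| * |v.2| * |M.coef (0, 1) (0, 1) x - M.coef (0, 1) (0, 1) y| ≤
      ‖v‖ * ‖v‖ * (K3 * ‖x - y‖) := by gcongr; exact H3 x y
  calc _ ≤ _ := add_le_add (add_le_add a1 a2) a3
    _ = _ := by ring

lemma exists_nrm_lipschitz : ∃ K, 0 ≤ K ∧
    ∀ x y v, |M.nrm x v - M.nrm y v| ≤ K * ‖x - y‖ * ‖v‖ := by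
  obtain ⟨K, hK, H⟩ := M.exists_g_lipschitz
  refine ⟨K / M.lo, div_nonneg hK M.lo_pos.le, fun x y v => ?_⟩
  rcases eq_or_ne v 0 with rfl | hv
  · simp [nrm, g_zero_left]
  have hv' : 0 < ‖v‖ := norm_pos_iff.2 hv
  have h := H x y v
  rw [← nrm_sq, ← nrm_sq, sq_sub_sq, abs_mul] at h
  have h1 := M.lo_le_nrm x v
  have h2 := M.nrm_nonneg y v
  rw [abs_of_nonneg (add_nonneg (M.nrm_nonneg x v) h2)] at h
  have h3 : M.lo * ‖v‖ * |M.nrm x v - M.nrm y v| ≤ K * ‖x - y‖ * ‖v‖ ^ 2 := by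
    refine le_trans ?_ h
    gcongr
    linarith
  rw [div_mul_eq_mul_div, div_mul_eq_mul_div, le_div_iff₀ M.lo_pos]
  have : ‖v‖ * (|M.nrm x v - M.nrm y v| * M.lo) ≤ ‖v‖ * (K * ‖x - y‖ * ‖v‖) := by
    nlinarith
  exact le_of_mul_le_mul_left this hv'

lemma g_cauchy_schwarz (x v w : ℝ × ℝ) : M.g x v w ≤ M.nrm x v * M.nrm x w := by
  have h : ∀ t : ℝ, 0 ≤ M.g x v v + 2 * t * M.g x v w + t ^ 2 * M.g x w w := fun t => by
    have := M.g_self_nonneg x (v + t • w)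
    simp only [g_add_left, g_add_right, g_smul_left, g_smul_right] at this
    rw [M.symm x w v] at this
    linarith
  rcases eq_or_ne w 0 with rfl | hw
  · rw [M.symm, g_zero_left]; exact mul_nonneg (M.nrm_nonneg _ _) (M.nrm_nonneg _ _)
  have hw' : 0 < M.g x w w := M.posdef x w hw
  have h1 := h (-(M.g x v w) / M.g x w w)
  have h2 : M.g x v w ^ 2 ≤ M.g x v v * M.g x w w := by
    have e : M.g x v v + 2 * (-(M.g x v w) / M.g x w w) * M.g x v w +
      (-(M.g x v w) / M.g x w w) ^ 2 * M.g x w w = M.g x v v - M.g x v w ^ 2 / M.g x w w := by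
      field_simp; ring
    rw [e, sub_nonneg, div_le_iff₀ hw'] at h1
    exact h1
  rw [← nrm_sq, ← nrm_sq, ← mul_pow] at h2
  exact le_of_abs_le (abs_le_of_sq_le_sq h2 (mul_nonneg (M.nrm_nonneg _ _) (M.nrm_nonneg _ _)))

end TorusMetric

/-! ### The Riemannian distance -/

namespace TorusMetric
variable (M : TorusMetric)

lemma length_eq (c : ℝ → ℝ × ℝ) (a b : ℝ) :
    M.length c a b = ∫ t in a..b, M.nrm (c t) (deriv c t) := rfl

lemma continuous_speed {c : ℝ → ℝ × ℝ} (hc : ContDiff ℝ 1 c) :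
    Continuous fun t => M.nrm (c t) (deriv c t) :=
  M.continuous_nrm.comp (hc.continuous.prodMk (hc.continuous_deriv le_rfl))

lemma length_nonneg (c : ℝ → ℝ × ℝ) {a b : ℝ} (h : a ≤ b) : 0 ≤ M.length c a b :=
  intervalIntegral.integral_nonneg h fun _ _ => M.nrm_nonneg _ _

lemma dist_le_length {c : ℝ → ℝ × ℝ} (hc : ContDiff ℝ 1 c) :
    M.dist (c 0) (c 1) ≤ M.length c 0 1 :=
  csInf_le ⟨0, by rintro _ ⟨c, -, -, -, rfl⟩; exact M.length_nonneg c zero_le_one⟩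
    ⟨c, hc, rfl, rfl, rfl⟩

lemma contDiff_line (x y : ℝ × ℝ) : ContDiff ℝ 1 fun t : ℝ => x + t • (y - x) := by fun_prop

lemma deriv_line (x y : ℝ × ℝ) (t : ℝ) : deriv (fun t : ℝ => x + t • (y - x)) t = y - x := by
  have : HasDerivAt (fun t : ℝ => x + t • (y - x)) ((1 : ℝ) • (y - x)) t :=
    ((hasDerivAt_id t).smul_const (y - x)).const_add x
  simpa using this.deriv

lemma exists_curve (x y : ℝ × ℝ) {ε : ℝ} (hε : 0 < ε) : ∃ c : ℝ → ℝ × ℝ, ContDiff ℝ 1 c ∧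
    c 0 = x ∧ c 1 = y ∧ M.length c 0 1 < M.dist x y + ε := by
  have hne : {L | ∃ c : ℝ → ℝ × ℝ, ContDiff ℝ 1 c ∧ c 0 = x ∧ c 1 = y ∧
      L = M.length c 0 1}.Nonempty := ⟨_, _, contDiff_line x y, by simp, by simp, rfl⟩
  obtain ⟨_, ⟨c, hc, h0, h1, rfl⟩, h⟩ := Real.lt_sInf_add_pos hne hε
  exact ⟨c, hc, h0, h1, h⟩

lemma le_dist {x y : ℝ × ℝ} {r : ℝ} (h : ∀ c : ℝ → ℝ × ℝ, ContDiff ℝ 1 c → c 0 = x → c 1 = y →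
    r ≤ M.length c 0 1) : r ≤ M.dist x y := by
  refine le_of_forall_pos_le_add fun ε hε => ?_
  obtain ⟨c, hc, h0, h1, h2⟩ := M.exists_curve x y hε
  exact (h c hc h0 h1).trans h2.le

lemma dist_nonneg (x y : ℝ × ℝ) : 0 ≤ M.dist x y :=
  M.le_dist fun c _ _ _ => M.length_nonneg c zero_le_one

lemma dist_add_lat (k : ℤ × ℤ) (x y : ℝ × ℝ) : M.dist (x + lat k) (y + lat k) = M.dist x y := by
  have key : ∀ (k : ℤ × ℤ) (x y : ℝ × ℝ), M.dist (x + lat k) (y + lat k) ≤ M.dist x y := by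
    intro k x y
    refine M.le_dist fun c hc h0 h1 => ?_
    have hc' : ContDiff ℝ 1 fun t => c t + lat k := hc.add contDiff_const
    have := M.dist_le_length hc'
    simp only [h0, h1] at this
    refine this.trans (le_of_eq ?_)
    rw [length_eq, length_eq]
    simp [nrm_periodic]
  refine le_antisymm (key k x y) ?_
  have := key (-k) (x + lat k) (y + lat k)
  simpa [lat_neg] using this

lemma dist_comm (x y : ℝ × ℝ) : M.dist x y = M.dist y x := by
  have key : ∀ x y : ℝ × ℝ, M.dist x y ≤ M.dist y x := by
    intro x y
    refine M.le_dist fun c hc h0 h1 => ?_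
    have hc' : ContDiff ℝ 1 fun t => c (1 - t) := hc.comp (by fun_prop)
    have := M.dist_le_length hc'
    simp only [sub_zero, h1, sub_self, h0] at this
    refine this.trans (le_of_eq ?_)
    rw [length_eq, length_eq]
    have h : ∀ t, M.nrm (c (1 - t)) (deriv (fun t => c (1 - t)) t) =
        M.nrm (c (1 - t)) (deriv c (1 - t)) := fun t => by
      rw [deriv_comp_const_sub, ← neg_one_smul ℝ, nrm_smul]; simp
    simp_rw [h]
    simp [intervalIntegral.integral_comp_sub_left fun t => M.nrm (c t) (deriv c t)]
  exact le_antisymm (key x y) (key y x)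

lemma length_comp {c : ℝ → ℝ × ℝ} (hc : ContDiff ℝ 1 c) {u : ℝ → ℝ} (hu : ContDiff ℝ 1 u)
    {a b : ℝ} (hd : ∀ t, 0 ≤ deriv u t) :
    ∫ t in a..b, M.nrm (c (u t)) (deriv u t • deriv c (u t)) = M.length c (u a) (u b) := by
  rw [length_eq, ← intervalIntegral.integral_comp_mul_deriv (f := u) (f' := deriv u)
    (g := fun t => M.nrm (c t) (deriv c t))
    (fun t _ => (hu.differentiable (by norm_num) t).hasDerivAt)
    (hu.continuous_deriv le_rfl).continuousOn (M.continuous_speed hc)]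
  refine intervalIntegral.integral_congr fun t _ => ?_
  simp only [nrm_smul, abs_of_nonneg (hd t), Function.comp]
  ring

lemma dist_triangle (x y z : ℝ × ℝ) : M.dist x z ≤ M.dist x y + M.dist y z := by
  refine le_of_forall_pos_le_add fun ε hε => ?_
  obtain ⟨c₁, hc₁, h10, h11, h1⟩ := M.exists_curve x y (half_pos hε)
  obtain ⟨c₂, hc₂, h20, h21, h2⟩ := M.exists_curve y z (half_pos hε)
  set u : ℝ → ℝ := fun t => Real.smoothTransition (2 * t) with hu
  set v : ℝ → ℝ := fun t => Real.smoothTransition (2 * t - 1) with hv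
  have hu1 : ContDiff ℝ 1 u := Real.smoothTransition.contDiff.comp (by fun_prop)
  have hv1 : ContDiff ℝ 1 v := Real.smoothTransition.contDiff.comp (by fun_prop)
  have hum : Monotone u := Real.smoothTransition.monotone.comp fun a b h => by simpa using h
  have hvm : Monotone v := Real.smoothTransition.monotone.comp fun a b h => by simpa using h
  have hv0 : ∀ t ≤ (1 / 2 : ℝ), v t = 0 := fun t ht =>
    Real.smoothTransition.zero_of_nonpos (by linarith)
  have hu0 : ∀ t, (1 / 2 : ℝ) ≤ t → u t = 1 := fun t ht =>
    Real.smoothTransition.one_of_one_le (by linarith)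
  have hdv : ∀ t ≤ (1 / 2 : ℝ), deriv v t = 0 := fun t ht =>
    IsLocalMin.deriv_eq_zero (Eventually.of_forall fun s => by
      rw [hv0 t ht]; exact Real.smoothTransition.nonneg _)
  have hdu : ∀ t, (1 / 2 : ℝ) ≤ t → deriv u t = 0 := fun t ht =>
    IsLocalMax.deriv_eq_zero (Eventually.of_forall fun s => by
      rw [hu0 t ht]; exact Real.smoothTransition.le_one _)
  set c : ℝ → ℝ × ℝ := fun t => c₁ (u t) + c₂ (v t) - y with hcdef
  have hc : ContDiff ℝ 1 c := ((hc₁.comp hu1).add (hc₂.comp hv1)).sub contDiff_const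
  have hdc : ∀ t, deriv c t = deriv u t • deriv c₁ (u t) + deriv v t • deriv c₂ (v t) := fun t => by
    have a1 : HasDerivAt (fun t => c₁ (u t)) (deriv u t • deriv c₁ (u t)) t :=
      ((hc₁.differentiable (by norm_num) _).hasDerivAt).scomp t
        (hu1.differentiable (by norm_num) t).hasDerivAt
    have a2 : HasDerivAt (fun t => c₂ (v t)) (deriv v t • deriv c₂ (v t)) t :=
      ((hc₂.differentiable (by norm_num) _).hasDerivAt).scomp t
        (hv1.differentiable (by norm_num) t).hasDerivAt
    exact ((a1.add a2).sub_const y).deriv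
  have hu00 : u 0 = 0 := Real.smoothTransition.zero_of_nonpos (by norm_num)
  have hv11 : v 1 = 1 := Real.smoothTransition.one_of_one_le (by norm_num)
  have e0 : c 0 = x := by simp [hcdef, hu00, hv0 0 (by norm_num), h10, h20]
  have e1 : c 1 = z := by simp [hcdef, hv11, hu0 1 (by norm_num), h11, h21]
  have key := M.dist_le_length hc
  rw [e0, e1] at key
  have hI : ∀ a b, IntervalIntegrable (fun t => M.nrm (c t) (deriv c t)) MeasureTheory.volume a b :=
    fun a b => (M.continuous_speed hc).intervalIntegrable a b
  have s1 : ∫ t in (0 : ℝ)..(1 / 2), M.nrm (c t) (deriv c t) = M.length c₁ 0 1 := by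
    have h3 : M.length c₁ 0 1 = M.length c₁ (u 0) (u (1 / 2)) := by rw [hu00, hu0 _ le_rfl]
    rw [h3, ← M.length_comp hc₁ hu1 fun t => hum.deriv_nonneg]
    refine intervalIntegral.integral_congr fun t ht => ?_
    rw [uIcc_of_le (by norm_num)] at ht
    simp only [hdc, hdv t ht.2, zero_smul, add_zero]
    congr 1
    simp [hcdef, hv0 t ht.2, h20]
  have s2 : ∫ t in (1 / 2 : ℝ)..1, M.nrm (c t) (deriv c t) = M.length c₂ 0 1 := by
    have h3 : M.length c₂ 0 1 = M.length c₂ (v (1 / 2)) (v 1) := by rw [hv11, hv0 _ le_rfl]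
    rw [h3, ← M.length_comp hc₂ hv1 fun t => hvm.deriv_nonneg]
    refine intervalIntegral.integral_congr fun t ht => ?_
    rw [uIcc_of_le (by norm_num)] at ht
    simp only [hdc, hdu t ht.1, zero_smul, zero_add]
    congr 1
    simp [hcdef, hu0 t ht.1, h11]
  rw [length_eq, ← intervalIntegral.integral_add_adjacent_intervals (hI 0 (1 / 2)) (hI (1 / 2) 1),
    s1, s2] at key
  linarith

lemma dist_le_up (x y : ℝ × ℝ) : M.dist x y ≤ M.up * ‖y - x‖ := by
  have h := M.dist_le_length (contDiff_line x y)
  simp only [zero_smul, add_zero, one_smul, add_sub_cancel] at h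
  refine h.trans ?_
  rw [length_eq]
  refine (intervalIntegral.integral_mono (b := 1) zero_le_one
    ((M.continuous_speed (contDiff_line x y)).intervalIntegrable _ _)
    (g := fun _ => M.up * ‖y - x‖) (by simp) fun t => ?_).trans (by simp)
  simp only [deriv_line]
  exact M.nrm_le_up _ _

lemma norm_sub_le_length {c : ℝ → ℝ × ℝ} (hc : ContDiff ℝ 1 c) {a b : ℝ} (h : a ≤ b) :
    M.lo * ‖c b - c a‖ ≤ M.length c a b := by
  have hd : Continuous (deriv c) := hc.continuous_deriv le_rfl
  have e : ∫ t in a..b, deriv c t = c b - c a := by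
    rw [intervalIntegral.integral_deriv_eq_sub (fun t _ => hc.differentiable (by norm_num) t)
      (hd.intervalIntegrable _ _)]
  rw [← e]
  calc M.lo * ‖∫ t in a..b, deriv c t‖ ≤ M.lo * ∫ t in a..b, ‖deriv c t‖ := by
        gcongr
        · exact M.lo_pos.le
        · exact intervalIntegral.norm_integral_le_integral_norm h
    _ = ∫ t in a..b, M.lo * ‖deriv c t‖ := by rw [intervalIntegral.integral_const_mul]
    _ ≤ _ := by
        refine intervalIntegral.integral_mono h ?_ ((M.continuous_speed hc).intervalIntegrable _ _)
          fun t => M.lo_le_nrm _ _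
        exact (continuous_const.mul hd.norm).intervalIntegrable _ _

lemma lo_le_dist (x y : ℝ × ℝ) : M.lo * ‖y - x‖ ≤ M.dist x y :=
  M.le_dist fun c hc h0 h1 => by
    have := M.norm_sub_le_length hc zero_le_one
    rwa [h0, h1] at this

lemma dist_self (x : ℝ × ℝ) : M.dist x x = 0 :=
  le_antisymm (by simpa using M.dist_le_up x x) (M.dist_nonneg _ _)

lemma eq_of_dist_eq_zero {x y : ℝ × ℝ} (h : M.dist x y = 0) : x = y := by
  have h1 := M.lo_le_dist x y
  rw [h] at h1
  have : ‖y - x‖ ≤ 0 := by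
    by_contra hc
    push Not at hc
    nlinarith [mul_pos M.lo_pos hc]
  exact (sub_eq_zero.1 (norm_le_zero_iff.1 this)).symm

lemma norm_sub_le_dist (x y : ℝ × ℝ) : ‖y - x‖ ≤ M.dist x y / M.lo := by
  rw [le_div_iff₀ M.lo_pos, mul_comm]; exact M.lo_le_dist x y

lemma abs_dist_sub_le (x y z : ℝ × ℝ) : |M.dist x y - M.dist x z| ≤ M.dist y z := by
  rw [abs_le]
  have h1 := M.dist_triangle x y z
  have h2 := M.dist_triangle x z y
  rw [M.dist_comm z y] at h2
  constructor <;> linarith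

lemma continuous_dist : Continuous fun p : (ℝ × ℝ) × (ℝ × ℝ) => M.dist p.1 p.2 := by
  have : LipschitzWith (2 * M.up).toNNReal fun p : (ℝ × ℝ) × (ℝ × ℝ) => M.dist p.1 p.2 := by
    refine LipschitzWith.of_dist_le_mul fun p q => ?_
    rw [Real.coe_toNNReal _ (by linarith [M.up_pos]), Real.dist_eq, dist_eq_norm]
    have h1 := M.abs_dist_sub_le p.1 p.2 q.2
    have h2 := M.abs_dist_sub_le q.2 p.1 q.1
    rw [M.dist_comm q.2, M.dist_comm q.2] at h2
    have h3 := M.dist_le_up q.2 p.2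
    have h4 := M.dist_le_up q.1 p.1
    rw [M.dist_comm] at h3 h4
    have h5 : ‖p.1 - q.1‖ ≤ ‖p - q‖ := norm_fst_le (p - q)
    have h6 : ‖p.2 - q.2‖ ≤ ‖p - q‖ := norm_snd_le (p - q)
    have h7 := mul_le_mul_of_nonneg_left h5 M.up_pos.le
    have h8 := mul_le_mul_of_nonneg_left h6 M.up_pos.le
    have h9 := abs_sub_le (M.dist p.1 p.2) (M.dist p.1 q.2) (M.dist q.1 q.2)
    linarith
  exact this.continuous

/-- Infinitesimally, the distance is given by the metric tensor, with a uniform quadratic error. -/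
lemma exists_dist_approx : ∃ K, 0 ≤ K ∧
    ∀ x y, |M.dist x y - M.nrm x (y - x)| ≤ K * ‖y - x‖ ^ 2 := by
  obtain ⟨K, hK, H⟩ := M.exists_nrm_lipschitz
  have hl := M.lo_pos
  have hu := M.up_pos
  set r := 2 * M.up / M.lo with hr
  have hr0 : 0 ≤ r := by positivity
  have ha : ∀ x y, M.dist x y ≤ M.nrm x (y - x) + K * ‖y - x‖ ^ 2 := by
    intro x y
    have h := M.dist_le_length (contDiff_line x y)
    simp only [zero_smul, add_zero, one_smul, add_sub_cancel] at h
    refine h.trans ?_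
    rw [length_eq]
    have : ∫ t in (0 : ℝ)..1, (M.nrm x (y - x) + K * ‖y - x‖ ^ 2) =
      M.nrm x (y - x) + K * ‖y - x‖ ^ 2 := by simp
    rw [← this]
    refine intervalIntegral.integral_mono_on zero_le_one
      ((M.continuous_speed (contDiff_line x y)).intervalIntegrable _ _) (by simp) fun t ht => ?_
    simp only [deriv_line]
    have h2 := (abs_le.1 (H (x + t • (y - x)) x (y - x))).2
    have h3 : ‖x + t • (y - x) - x‖ ≤ ‖y - x‖ := by
      rw [add_sub_cancel_left, norm_smul, Real.norm_eq_abs, abs_of_nonneg ht.1]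
      exact mul_le_of_le_one_left (norm_nonneg _) ht.2
    have h4 : K * ‖x + t • (y - x) - x‖ * ‖y - x‖ ≤ K * ‖y - x‖ * ‖y - x‖ := by gcongr
    nlinarith
  have hb : ∀ x y, M.nrm x (y - x) - K * r ^ 2 * ‖y - x‖ ^ 2 ≤ M.dist x y := by
    intro x y
    rcases eq_or_ne x y with rfl | hxy
    · simpa [nrm, g_zero_left] using M.dist_nonneg x x
    have hw : 0 < ‖y - x‖ := norm_pos_iff.2 (sub_ne_zero.2 hxy.symm)
    refine M.le_dist fun c hc h0 h1 => ?_
    rcases le_or_gt (2 * M.up * ‖y - x‖) (M.length c 0 1) with hbig | hsmall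
    · have := M.nrm_le_up x (y - x)
      have h5 : 0 ≤ K * r ^ 2 * ‖y - x‖ ^ 2 := by positivity
      nlinarith
    have hd : Continuous (deriv c) := hc.continuous_deriv le_rfl
    have hclose : ∀ t ∈ Icc (0 : ℝ) 1, ‖c t - x‖ ≤ r * ‖y - x‖ := by
      intro t ht
      have h2 := M.norm_sub_le_length hc ht.1
      have h3 : M.length c 0 t ≤ M.length c 0 1 := by
        have := intervalIntegral.integral_add_adjacent_intervals
          ((M.continuous_speed hc).intervalIntegrable (μ := MeasureTheory.volume) 0 t)
          ((M.continuous_speed hc).intervalIntegrable t 1)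
        have h4 := M.length_nonneg c ht.2
        rw [length_eq] at h4 ⊢
        rw [length_eq]
        linarith
      rw [h0] at h2
      rw [hr, div_mul_eq_mul_div, le_div_iff₀ hl]
      linarith
    have hlen : ∫ t in (0 : ℝ)..1, ‖deriv c t‖ ≤ r * ‖y - x‖ := by
      have : M.lo * ∫ t in (0 : ℝ)..1, ‖deriv c t‖ ≤ M.length c 0 1 := by
        rw [← intervalIntegral.integral_const_mul]
        exact intervalIntegral.integral_mono zero_le_one
          ((continuous_const.mul hd.norm).intervalIntegrable _ _)
          ((M.continuous_speed hc).intervalIntegrable _ _) fun t => M.lo_le_nrm _ _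
      rw [hr, div_mul_eq_mul_div, le_div_iff₀ hl]
      linarith
    set w := y - x with hwdef
    have hnw : 0 < M.nrm x w := lt_of_lt_of_le (mul_pos hl hw) (M.lo_le_nrm x w)
    have hcg : Continuous fun t => M.g x (deriv c t) w :=
      M.continuous_g.comp (continuous_const.prodMk (hd.prodMk continuous_const))
    have hg : ∫ t in (0 : ℝ)..1, M.g x (deriv c t) w = M.g x w w := by
      have h5 : ∀ t ∈ uIcc (0 : ℝ) 1, HasDerivAt (fun t => M.g x (c t) w) (M.g x (deriv c t) w) t := by
        intro t _
        exact ((M.linear x w).mk' _).toContinuousLinearMap.hasFDerivAt.comp_hasDerivAt t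
          (hc.differentiable (by norm_num) t).hasDerivAt
      rw [intervalIntegral.integral_eq_sub_of_hasDerivAt h5 (hcg.intervalIntegrable _ _), h0, h1]
      have : y = x + w := by rw [hwdef]; abel
      rw [this, g_add_left]; ring
    have hmain : ∫ t in (0 : ℝ)..1, M.g x (deriv c t) w ≤
        ∫ t in (0 : ℝ)..1, (M.nrm x w * M.nrm (c t) (deriv c t) +
          M.nrm x w * (K * (r * ‖w‖)) * ‖deriv c t‖) := by
      refine intervalIntegral.integral_mono_on zero_le_one (hcg.intervalIntegrable _ _)
        (((continuous_const.mul (M.continuous_speed hc)).add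
          (continuous_const.mul hd.norm)).intervalIntegrable _ _) fun t ht => ?_
      refine (M.g_cauchy_schwarz _ _ _).trans ?_
      have h6 := (abs_le.1 (H (c t) x (deriv c t))).1
      have h7 : K * ‖c t - x‖ * ‖deriv c t‖ ≤ K * (r * ‖w‖) * ‖deriv c t‖ := by
        gcongr; exact hclose t ht
      nlinarith
    have i1 : IntervalIntegrable (fun t => M.nrm x w * M.nrm (c t) (deriv c t))
        MeasureTheory.volume 0 1 :=
      (continuous_const.mul (M.continuous_speed hc)).intervalIntegrable _ _
    have i2 : IntervalIntegrable (fun t => M.nrm x w * (K * (r * ‖w‖)) * ‖deriv c t‖)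
        MeasureTheory.volume 0 1 := (continuous_const.mul hd.norm).intervalIntegrable _ _
    rw [hg, intervalIntegral.integral_add i1 i2,
      intervalIntegral.integral_const_mul, intervalIntegral.integral_const_mul, ← nrm_sq,
      ← length_eq] at hmain
    have h8 : M.nrm x w * (K * (r * ‖w‖)) * ∫ t in (0 : ℝ)..1, ‖deriv c t‖ ≤
        M.nrm x w * (K * (r * ‖w‖)) * (r * ‖w‖) := by gcongr
    have h9 : M.nrm x w * M.nrm x w ≤
        M.nrm x w * (M.length c 0 1 + K * (r * ‖w‖) * (r * ‖w‖)) := by nlinarith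
    have h10 := le_of_mul_le_mul_left h9 hnw
    nlinarith
  refine ⟨max K (K * r ^ 2), le_max_of_le_left hK, fun x y => abs_le.2 ⟨?_, ?_⟩⟩
  · have := hb x y
    have h2 : K * r ^ 2 * ‖y - x‖ ^ 2 ≤ max K (K * r ^ 2) * ‖y - x‖ ^ 2 := by
      gcongr; exact le_max_right _ _
    linarith
  · have := ha x y
    have h2 : K * ‖y - x‖ ^ 2 ≤ max K (K * r ^ 2) * ‖y - x‖ ^ 2 := by
      gcongr; exact le_max_left _ _
    linarith

end TorusMetric

/-! ### Limits along a nonprincipal ultrafilter, and minimal segments -/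

/-- A fixed nonprincipal ultrafilter on the natural numbers, as a filter. -/
def ulim : Filter ℕ := (hyperfilter ℕ : Ultrafilter ℕ)

instance : NeBot ulim := inferInstanceAs (NeBot ((hyperfilter ℕ : Ultrafilter ℕ) : Filter ℕ))

lemma ulim_le : ulim ≤ atTop := Nat.hyperfilter_le_atTop

lemma exists_tendsto_of_isCompact {X : Type*} [TopologicalSpace X] {K : Set X} (hK : IsCompact K)
    {u : ℕ → X} (h : ∀ᶠ n in ulim, u n ∈ K) : ∃ x ∈ K, Tendsto u ulim (𝓝 x) := by
  obtain ⟨x, hx, hle⟩ := hK.ultrafilter_le_nhds (Ultrafilter.map u (hyperfilter ℕ))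
    (le_principal_iff.2 h)
  exact ⟨x, hx, hle⟩

lemma exists_tendsto_of_norm_le {u : ℕ → ℝ × ℝ} {C : ℝ} (h : ∀ᶠ n in ulim, ‖u n‖ ≤ C) :
    ∃ x, Tendsto u ulim (𝓝 x) := by
  obtain ⟨x, -, hx⟩ := exists_tendsto_of_isCompact (isCompact_closedBall (0 : ℝ × ℝ) C) (u := u)
    (h.mono fun n hn => by simpa using hn)
  exact ⟨x, hx⟩

lemma tendsto_one_div_ulim : Tendsto (fun n : ℕ => 1 / ((n : ℝ) + 1)) ulim (𝓝 0) :=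
  tendsto_one_div_add_atTop_nhds_zero_nat.mono_left ulim_le

namespace TorusMetric
variable (M : TorusMetric)

/-- Curves which are `1`-Lipschitz for the Riemannian distance. -/
def ULip (γ : ℝ → ℝ × ℝ) : Prop := ∀ s t, s ≤ t → M.dist (γ s) (γ t) ≤ t - s

/-- Curves which are minimal and parametrized by arc length on `[a, b]`. -/
def IsoOn (γ : ℝ → ℝ × ℝ) (a b : ℝ) : Prop :=
  ∀ s t, a ≤ s → s ≤ t → t ≤ b → M.dist (γ s) (γ t) = t - s

/-- Minimal lines parametrized by arc length. -/
def IsLine (γ : ℝ → ℝ × ℝ) : Prop := ∀ s t, s ≤ t → M.dist (γ s) (γ t) = t - s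

/-- Curves which are locally minimal and parametrized by arc length. -/
def LocIso (γ : ℝ → ℝ × ℝ) : Prop := ∀ t, ∃ ε > 0, M.IsoOn γ (t - ε) (t + ε)

variable {M}

lemma IsLine.uLip {γ : ℝ → ℝ × ℝ} (h : M.IsLine γ) : M.ULip γ := fun s t hst => (h s t hst).le

lemma IsLine.isoOn {γ : ℝ → ℝ × ℝ} (h : M.IsLine γ) (a b : ℝ) : M.IsoOn γ a b :=
  fun s t _ hst' _ => h s t hst'

lemma IsLine.locIso {γ : ℝ → ℝ × ℝ} (h : M.IsLine γ) : M.LocIso γ :=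
  fun _ => ⟨1, one_pos, h.isoOn _ _⟩

lemma IsoOn.mono {γ : ℝ → ℝ × ℝ} {a b a' b' : ℝ} (h : M.IsoOn γ a b) (ha : a ≤ a') (hb : b' ≤ b) :
    M.IsoOn γ a' b' := fun s t hs hst ht => h s t (ha.trans hs) hst (ht.trans hb)

lemma ULip.dist_le {γ : ℝ → ℝ × ℝ} (h : M.ULip γ) (s t : ℝ) : M.dist (γ s) (γ t) ≤ |t - s| := by
  rcases le_total s t with hst | hst
  · rw [abs_of_nonneg (sub_nonneg.2 hst)]; exact h s t hst
  · rw [abs_of_nonpos (sub_nonpos.2 hst), M.dist_comm]; linarith [h t s hst]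

lemma ULip.norm_le {γ : ℝ → ℝ × ℝ} (h : M.ULip γ) (s t : ℝ) :
    ‖γ t - γ s‖ ≤ |t - s| / M.lo :=
  (M.norm_sub_le_dist _ _).trans (div_le_div_of_nonneg_right (h.dist_le s t) M.lo_pos.le)

lemma ULip.continuous {γ : ℝ → ℝ × ℝ} (h : M.ULip γ) : Continuous γ := by
  have : LipschitzWith (1 / M.lo).toNNReal γ := LipschitzWith.of_dist_le_mul fun s t => by
    rw [Real.coe_toNNReal _ (by have := M.lo_pos; positivity), dist_eq_norm, Real.dist_eq]
    refine (h.norm_le t s).trans (le_of_eq (by ring))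
  exact this.continuous

/-- A nearly minimal `1`-Lipschitz curve inherits near minimality on subintervals. -/
lemma ULip.sub_le {γ : ℝ → ℝ × ℝ} (h : M.ULip γ) {a b s t κ : ℝ}
    (hd : b - a ≤ M.dist (γ a) (γ b) + κ) (hs : a ≤ s) (ht : t ≤ b) :
    t - s ≤ M.dist (γ s) (γ t) + κ := by
  have h1 := M.dist_triangle (γ a) (γ s) (γ b)
  have h2 := M.dist_triangle (γ s) (γ t) (γ b)
  have h3 := h a s hs
  have h4 := h t b ht
  linarith

lemma ULip.isoOn {γ : ℝ → ℝ × ℝ} (h : M.ULip γ) {a b : ℝ}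
    (hd : b - a ≤ M.dist (γ a) (γ b)) : M.IsoOn γ a b := fun s t hs hst ht =>
  le_antisymm (h s t hst)
    (by simpa using h.sub_le (κ := 0) (by linarith) hs ht)

lemma ULip.comp_add {γ : ℝ → ℝ × ℝ} (h : M.ULip γ) (r : ℝ) (k : ℤ × ℤ) :
    M.ULip fun t => γ (t + r) + lat k := fun s t hst => by
  rw [M.dist_add_lat]; have := h (s + r) (t + r) (by linarith); linarith

lemma IsLine.comp_add {γ : ℝ → ℝ × ℝ} (h : M.IsLine γ) (r : ℝ) (k : ℤ × ℤ) :
    M.IsLine fun t => γ (t + r) + lat k := fun s t hst => by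
  rw [M.dist_add_lat, h (s + r) (t + r) (by linarith)]; ring

lemma IsLine.comp_add' {γ : ℝ → ℝ × ℝ} (h : M.IsLine γ) (r : ℝ) :
    M.IsLine fun t => γ (t + r) := by simpa [lat_zero] using h.comp_add r 0

lemma LocIso.reverse {γ : ℝ → ℝ × ℝ} (h : M.LocIso γ) (r : ℝ) : M.LocIso fun t => γ (r - t) := by
  intro t
  obtain ⟨ε, hε, H⟩ := h (r - t)
  refine ⟨ε, hε, fun u v hu huv hv => ?_⟩
  rw [M.dist_comm, H (r - v) (r - u) (by linarith) (by linarith) (by linarith)]; ring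

lemma LocIso.comp_add {γ : ℝ → ℝ × ℝ} (h : M.LocIso γ) (r : ℝ) : M.LocIso fun t => γ (t + r) := by
  intro t
  obtain ⟨ε, hε, H⟩ := h (t + r)
  refine ⟨ε, hε, fun u v hu huv hv => ?_⟩
  rw [H (u + r) (v + r) (by linarith) (by linarith) (by linarith)]; ring

/-- Two `1`-Lipschitz curves which agree at a parameter can be glued there. -/
lemma ULip.glue {γ γ' : ℝ → ℝ × ℝ} (h : M.ULip γ) (h' : M.ULip γ') {r : ℝ} (e : γ r = γ' r) :
    M.ULip fun t => if t ≤ r then γ t else γ' t := by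
  intro s t hst
  by_cases hs : s ≤ r <;> by_cases ht : t ≤ r <;> simp only [hs, ht, if_true, if_false]
  · exact h s t hst
  · have h1 := h s r hs
    have h2 := h' r t (by linarith)
    have h3 := M.dist_triangle (γ s) (γ r) (γ' t)
    rw [← e] at h2
    linarith
  · exact absurd (hst.trans ht) hs
  · exact h' s t hst

variable (M)

lemma tendsto_dist {u v : ℕ → ℝ × ℝ} {x y : ℝ × ℝ} (hu : Tendsto u ulim (𝓝 x))
    (hv : Tendsto v ulim (𝓝 y)) :
    Tendsto (fun n => M.dist (u n) (v n)) ulim (𝓝 (M.dist x y)) := by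
  have h := hu.prodMk_nhds hv
  have c := M.continuous_dist.tendsto (x, y)
  generalize M.dist = d at *
  exact c.comp h

lemma exists_limit {u : ℕ → ℝ → ℝ × ℝ} (hu : ∀ n, M.ULip (u n)) {C : ℝ}
    (h0 : ∀ n, ‖u n 0‖ ≤ C) :
    ∃ γ, M.ULip γ ∧ ∀ t, Tendsto (fun n => u n t) ulim (𝓝 (γ t)) := by
  have : ∀ t, ∃ x, Tendsto (fun n => u n t) ulim (𝓝 x) := fun t =>
    exists_tendsto_of_norm_le (C := C + |t| / M.lo) (Eventually.of_forall fun n => by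
      have h1 := (hu n).norm_le 0 t
      have h2 := norm_le_norm_add_norm_sub' (u n t) (u n 0)
      rw [sub_zero] at h1
      linarith [h0 n])
  choose γ hγ using this
  refine ⟨γ, fun s t hst => ?_, hγ⟩
  exact le_of_tendsto (M.tendsto_dist (hγ s) (hγ t))
    (Eventually.of_forall fun n => hu n s t hst)

lemma tendsto_of_dist {u v : ℕ → ℝ × ℝ} {x : ℝ × ℝ} (hu : Tendsto u ulim (𝓝 x)) {δ : ℕ → ℝ}
    (hδ : Tendsto δ ulim (𝓝 0)) (h : ∀ᶠ n in ulim, M.dist (u n) (v n) ≤ δ n) :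
    Tendsto v ulim (𝓝 x) := by
  have h1 : Tendsto (fun n => v n - u n) ulim (𝓝 0) := by
    refine squeeze_zero_norm' (h.mono fun n hn => (M.norm_sub_le_dist _ _).trans
      (div_le_div_of_nonneg_right hn M.lo_pos.le)) ?_
    simpa using hδ.div_const M.lo
  simpa using hu.add h1

lemma tendsto_moving {u : ℕ → ℝ → ℝ × ℝ} (hu : ∀ n, M.ULip (u n)) {γ : ℝ → ℝ × ℝ}
    (hγ : ∀ t, Tendsto (fun n => u n t) ulim (𝓝 (γ t))) {s : ℕ → ℝ} {r : ℝ}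
    (hs : Tendsto s ulim (𝓝 r)) : Tendsto (fun n => u n (s n)) ulim (𝓝 (γ r)) := by
  refine M.tendsto_of_dist (hγ r) (δ := fun n => |s n - r|) ?_
    (Eventually.of_forall fun n => (hu n).dist_le r (s n))
  have := (hs.sub_const r).abs
  simpa using this

lemma isLine_of_limit {u : ℕ → ℝ → ℝ × ℝ} {γ : ℝ → ℝ × ℝ} (hγ' : M.ULip γ)
    (hγ : ∀ t, Tendsto (fun n => u n t) ulim (𝓝 (γ t))) {κ : ℕ → ℝ} (hκ : Tendsto κ ulim (𝓝 0))
    (h : ∀ s t, s ≤ t → ∀ᶠ n in ulim, t - s ≤ M.dist (u n s) (u n t) + κ n) : M.IsLine γ := by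
  intro s t hst
  refine le_antisymm (hγ' s t hst) ?_
  have := (M.tendsto_dist (hγ s) (hγ t)).add hκ
  rw [add_zero] at this
  exact ge_of_tendsto this (h s t hst)

lemma dist_le_length_sub {c : ℝ → ℝ × ℝ} (hc : ContDiff ℝ 1 c) {s t : ℝ} (h : s ≤ t) :
    M.dist (c s) (c t) ≤ M.length c s t := by
  have hu : ContDiff ℝ 1 fun r : ℝ => s + r * (t - s) := by fun_prop
  have hd : ∀ r, deriv (fun r : ℝ => s + r * (t - s)) r = t - s := fun r => by
    simp
  have h1 := M.dist_le_length (hc.comp hu)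
  simp only [Function.comp, zero_mul, add_zero, one_mul, add_sub_cancel] at h1
  refine h1.trans (le_of_eq ?_)
  have h2 := M.length_comp hc hu (a := 0) (b := 1) (fun r => by rw [hd]; linarith)
  simp only [zero_mul, add_zero, one_mul, add_sub_cancel] at h2
  rw [← h2, length_eq]
  refine intervalIntegral.integral_congr fun r _ => ?_
  have a1 : HasDerivAt (fun r => c (s + r * (t - s)))
      (deriv (fun r : ℝ => s + r * (t - s)) r • deriv c (s + r * (t - s))) r :=
    ((hc.differentiable (by norm_num) _).hasDerivAt).scomp r
      (hu.differentiable (by norm_num) r).hasDerivAt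
  simp only [Function.comp_def, a1.deriv]

/-- A nearly minimal `1`-Lipschitz curve between two points. -/
lemma exists_almost_segment (x y : ℝ × ℝ) {ε : ℝ} (hε : 0 < ε) :
    ∃ γ, M.ULip γ ∧ γ 0 = x ∧ M.dist (γ (M.dist x y)) y ≤ ε := by
  obtain ⟨c, hc, h0, h1, hL⟩ := M.exists_curve x y hε
  set L := M.length c 0 1 with hLdef
  have hxy : M.dist x y ≤ L := by
    have := M.dist_le_length hc
    rwa [h0, h1] at this
  have hL0 : 0 ≤ L := M.length_nonneg c zero_le_one
  have hint : ∀ a b, IntervalIntegrable (fun t => M.nrm (c t) (deriv c t))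
      MeasureTheory.volume a b := fun a b => (M.continuous_speed hc).intervalIntegrable a b
  have hcont : ContinuousOn (fun s => M.length c 0 s) (Icc 0 1) :=
    (intervalIntegral.continuous_primitive (fun a b => hint a b) 0).continuousOn
  have hex : ∀ t : ℝ, ∃ s ∈ Icc (0 : ℝ) 1, M.length c 0 s = max 0 (min t L) := by
    intro t
    have h00 : M.length c 0 0 = 0 := intervalIntegral.integral_same
    have := intermediate_value_Icc zero_le_one hcont
    rw [h00] at this
    exact this ⟨le_max_left _ _, max_le hL0 (min_le_right _ _)⟩
  choose s hs hsl using hex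
  have hadd : ∀ a b, M.length c a b = M.length c 0 b - M.length c 0 a := fun a b => by
    have := intervalIntegral.integral_add_adjacent_intervals (hint 0 a) (hint a b)
    simp only [length_eq]
    linarith
  have hle : ∀ a b, M.dist (c a) (c b) ≤ |M.length c 0 b - M.length c 0 a| := fun a b => by
    rcases le_total a b with hab | hab
    · rw [← hadd]; exact (M.dist_le_length_sub hc hab).trans (le_abs_self _)
    · rw [abs_sub_comm, ← hadd, M.dist_comm]
      exact (M.dist_le_length_sub hc hab).trans (le_abs_self _)
  refine ⟨fun t => c (s t), fun a b hab => (hle _ _).trans ?_, ?_, ?_⟩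
  · rw [hsl, hsl]
    refine (abs_max_sub_max_le_max _ _ _ _).trans ?_
    rw [sub_self, abs_zero]
    refine max_le (by linarith) ((abs_min_sub_min_le_max _ _ _ _).trans ?_)
    rw [sub_self, abs_zero, abs_of_nonneg (by linarith)]
    exact max_le le_rfl (by linarith)
  · rw [← h0]
    refine (M.eq_of_dist_eq_zero (le_antisymm ((hle _ _).trans ?_) (M.dist_nonneg _ _))).symm
    rw [hsl, min_eq_left hL0]
    simp [length]
  · have := hle (s (M.dist x y)) 1
    rw [h1, hsl, min_eq_left hxy, max_eq_right (M.dist_nonneg _ _), abs_of_nonneg (by linarith)]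
      at this
    linarith

/-- Existence of minimal segments. -/
lemma exists_segment (x y : ℝ × ℝ) :
    ∃ γ, M.ULip γ ∧ γ 0 = x ∧ γ (M.dist x y) = y := by
  have h : ∀ n : ℕ, ∃ γ, M.ULip γ ∧ γ 0 = x ∧ M.dist (γ (M.dist x y)) y ≤ 1 / ((n : ℝ) + 1) :=
    fun n => M.exists_almost_segment x y (by positivity)
  choose u hu hu0 hu1 using h
  obtain ⟨γ, hγ, hl⟩ := M.exists_limit hu (C := ‖x‖) fun n => by rw [hu0]
  refine ⟨γ, hγ, ?_, ?_⟩
  · exact tendsto_nhds_unique (hl 0) (by simp [hu0])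
  · refine tendsto_nhds_unique (hl _) ?_
    refine M.tendsto_of_dist (tendsto_const_nhds (x := y)) tendsto_one_div_ulim
      (Eventually.of_forall fun n => ?_)
    rw [M.dist_comm]; exact hu1 n

end TorusMetric

section regularity
open MeasureTheory

/-! ### Regularity of locally minimal curves -/


lemma LipschitzWith.integral_deriv {f : ℝ → ℝ} {K : NNReal} (hf : LipschitzWith K f) (a b : ℝ) :
    ∫ t in a..b, deriv f t = f b - f a :=
  (hf.lipschitzOnWith (s := uIcc a b)).absolutelyContinuousOnInterval.integral_deriv_eq_sub

lemma intervalIntegrable_of_bound {f : ℝ → ℝ} (hf : Measurable f) {C : ℝ} (h : ∀ t, |f t| ≤ C)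
    (a b : ℝ) : IntervalIntegrable f volume a b :=
  (intervalIntegrable_const (c := C)).mono_fun hf.aestronglyMeasurable
    (Eventually.of_forall fun t => by
      have : |f t| ≤ |C| := (h t).trans (le_abs_self C)
      simpa using this)

namespace TorusMetric
variable {M : TorusMetric}

lemma tendsto_dist_div {c : ℝ → ℝ × ℝ} {t : ℝ} {v : ℝ × ℝ} (h : HasDerivAt c v t) :
    Tendsto (fun s => M.dist (c t) (c s) / (s - t)) (𝓝[>] t) (𝓝 (M.nrm (c t) v)) := by
  obtain ⟨K, hK, H⟩ := M.exists_dist_approx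
  have h1 : Tendsto (slope c t) (𝓝[>] t) (𝓝 v) :=
    (hasDerivAt_iff_tendsto_slope.1 h).mono_left (nhdsWithin_mono _ fun s hs => ne_of_gt hs)
  have h2 : Tendsto (fun s => M.nrm (c t) (slope c t s)) (𝓝[>] t) (𝓝 (M.nrm (c t) v)) :=
    ((M.continuous_nrm.comp (Continuous.prodMk_right (c t))).tendsto v).comp h1
  have h3 : Tendsto (fun s => K * (‖slope c t s‖ ^ 2 * (s - t))) (𝓝[>] t) (𝓝 0) := by
    have : Tendsto (fun s : ℝ => s - t) (𝓝[>] t) (𝓝 0) := by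
      have : Tendsto (fun s : ℝ => s - t) (𝓝 t) (𝓝 (t - t)) := tendsto_id.sub_const t
      rw [sub_self] at this
      exact this.mono_left nhdsWithin_le_nhds
    simpa using ((h1.norm.pow 2).mul this).const_mul K
  have h4 : Tendsto (fun s => M.dist (c t) (c s) / (s - t) - M.nrm (c t) (slope c t s))
      (𝓝[>] t) (𝓝 0) := by
    refine squeeze_zero_norm' ?_ h3
    filter_upwards [self_mem_nhdsWithin] with s hs
    have hs' : 0 < s - t := sub_pos.2 hs
    have e1 : c s - c t = (s - t) • slope c t s := by
      rw [slope_def_module, smul_smul, mul_inv_cancel₀ hs'.ne', one_smul]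
    have := H (c t) (c s)
    rw [e1, nrm_smul, norm_smul, abs_of_pos hs', Real.norm_eq_abs, abs_of_pos hs'] at this
    rw [Real.norm_eq_abs, show M.dist (c t) (c s) / (s - t) - M.nrm (c t) (slope c t s)
      = (M.dist (c t) (c s) - (s - t) * M.nrm (c t) (slope c t s)) / (s - t) by
        field_simp, abs_div, abs_of_pos hs', div_le_iff₀ hs']
    linarith
  simpa using h4.add h2

lemma lipschitz_of_uLip {γ : ℝ → ℝ × ℝ} (h : M.ULip γ) :
    LipschitzWith (Real.toNNReal (1 / M.lo)) γ :=
  LipschitzWith.of_dist_le' fun s t => by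
    have := h.norm_le t s
    rw [dist_eq_norm, Real.dist_eq]
    simpa [div_eq_inv_mul] using this

lemma dist_le_integral_nrm {c : ℝ → ℝ × ℝ} {K : NNReal} (hc : LipschitzWith K c) {a b : ℝ}
    (hab : a ≤ b) : M.dist (c a) (c b) ≤ ∫ t in a..b, M.nrm (c t) (deriv c t) := by
  have hF : LipschitzWith (Real.toNNReal (M.up * K)) fun u => M.dist (c a) (c u) :=
    LipschitzWith.of_dist_le' fun s t => by
      rw [Real.dist_eq]
      have h1 := M.abs_dist_sub_le (c a) (c s) (c t)
      have h2 := M.dist_le_up (c s) (c t)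
      have h3 := hc.dist_le_mul s t
      rw [_root_.dist_comm, dist_eq_norm] at h3
      have := M.up_pos
      calc _ ≤ M.up * ‖c t - c s‖ := h1.trans h2
        _ ≤ M.up * (K * Dist.dist s t) := by gcongr
        _ = _ := by rw [mul_assoc]
  have h1 := hF.integral_deriv a b
  simp only [dist_self, sub_zero] at h1
  rw [← h1]
  have hm : Measurable fun t => M.nrm (c t) (deriv c t) :=
    M.continuous_nrm.measurable.comp (hc.continuous.measurable.prodMk (measurable_deriv c))
  refine intervalIntegral.integral_mono_ae hab
    (intervalIntegrable_of_bound (measurable_deriv _) (C := (Real.toNNReal (M.up * K) : NNReal))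
      (fun t => norm_deriv_le_of_lipschitz hF) a b)
    (intervalIntegrable_of_bound hm (C := M.up * K) (fun t => ?_) a b) ?_
  · rw [abs_of_nonneg (M.nrm_nonneg _ _)]
    have := norm_deriv_le_of_lipschitz hc (x₀ := t)
    have h := M.up_pos
    exact (M.nrm_le_up _ _).trans (by gcongr)
  · filter_upwards [hF.ae_differentiableAt (μ := volume), hc.ae_differentiableAt (μ := volume)]
      with t h1 h2
    have h3 : Tendsto (slope (fun u => M.dist (c a) (c u)) t) (𝓝[>] t)
      (𝓝 (deriv (fun u => M.dist (c a) (c u)) t)) :=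
      (hasDerivAt_iff_tendsto_slope.1 h1.hasDerivAt).mono_left
        (nhdsWithin_mono _ fun s hs => ne_of_gt hs)
    refine le_of_tendsto_of_tendsto h3 (tendsto_dist_div h2.hasDerivAt) ?_
    filter_upwards [self_mem_nhdsWithin] with s hs
    have hs' : 0 < s - t := sub_pos.2 hs
    rw [slope_def_field]
    gcongr
    rw [M.dist_comm (c t)]
    have := (abs_le.1 (M.abs_dist_sub_le (c a) (c s) (c t))).2
    linarith

lemma nrm_deriv_le_one {γ : ℝ → ℝ × ℝ} (h : M.ULip γ) {t : ℝ} (ht : DifferentiableAt ℝ γ t) :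
    M.nrm (γ t) (deriv γ t) ≤ 1 := by
  refine le_of_tendsto (tendsto_dist_div ht.hasDerivAt) ?_
  filter_upwards [self_mem_nhdsWithin] with s hs
  have hs' : 0 < s - t := sub_pos.2 hs
  exact (div_le_one hs').2 (h t s (le_of_lt hs))

end TorusMetric

lemma exists_bound_of_periodic_fst {F : Type*} [NormedAddCommGroup F]
    {f : (ℝ × ℝ) × (ℝ × ℝ) → F} (hf : Continuous f)
    (hp : ∀ k z, f (z + (lat k, 0)) = f z) (C : ℝ) :
    ∃ B, 0 ≤ B ∧ ∀ z, ‖z.2‖ ≤ C → ‖f z‖ ≤ B := by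
  obtain ⟨B, hB⟩ := (((isCompact_Icc (a := (0 : ℝ × ℝ)) (b := 1)).prod
    (isCompact_closedBall (0 : ℝ × ℝ) C))).exists_bound_of_continuousOn hf.continuousOn
  refine ⟨max B 0, le_max_right _ _, fun z hz => ?_⟩
  have h1 := hp (-cell z.1) z
  have h2 := hB (z + (lat (-cell z.1), 0)) ⟨by
    have := sub_cell_mem z.1
    simpa [lat_neg, sub_eq_add_neg] using this, by simpa using hz⟩
  rw [h1] at h2
  exact h2.trans (le_max_left _ _)

lemma fderiv_periodic {E F : Type*} [NormedAddCommGroup E] [NormedSpace ℝ E]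
    [NormedAddCommGroup F] [NormedSpace ℝ F] {f : E → F} {k : E}
    (hp : ∀ z, f (z + k) = f z) (z : E) : fderiv ℝ f (z + k) = fderiv ℝ f z := by
  have : f = fun y => f (y + k) := funext fun y => (hp y).symm
  conv_rhs => rw [this]
  rw [fderiv_comp_add_right]

namespace TorusMetric
variable (M : TorusMetric)

/-- The quadratic form of the metric, as a function on the tangent bundle. -/
def en (z : (ℝ × ℝ) × (ℝ × ℝ)) : ℝ := M.g z.1 z.2 z.2

lemma en_contDiff : ContDiff ℝ (⊤ : ℕ∞) M.en :=
  M.smooth.comp (contDiff_fst.prodMk (contDiff_snd.prodMk contDiff_snd))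

lemma en_periodic (k : ℤ × ℤ) (z : (ℝ × ℝ) × (ℝ × ℝ)) : M.en (z + (lat k, 0)) = M.en z := by
  simp [en, M.periodic]

lemma continuous_fderiv_en : Continuous (fderiv ℝ M.en) :=
  M.en_contDiff.continuous_fderiv (by simp)

lemma en_eq (z : (ℝ × ℝ) × (ℝ × ℝ)) : M.en z = M.nrm z.1 z.2 ^ 2 := (M.nrm_sq _ _).symm

variable {M}

lemma weak_euler_lagrange {γ : ℝ → ℝ × ℝ} (h : M.ULip γ) {a b : ℝ} (hab : a ≤ b)
    (hd : b - a ≤ M.dist (γ a) (γ b)) {φ : ℝ → ℝ × ℝ} {K : NNReal} (hφ : LipschitzWith K φ)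
    (ha : φ a = 0) (hb : φ b = 0) :
    ∫ t in a..b, fderiv ℝ M.en (γ t, deriv γ t) (φ t, deriv φ t) = 0 := by
  have hγ := lipschitz_of_uLip h
  set L := Real.toNNReal (1 / M.lo)
  have hγ' : ∀ t, ‖deriv γ t‖ ≤ L := fun t => norm_deriv_le_of_lipschitz hγ
  have hφ' : ∀ t, ‖deriv φ t‖ ≤ K := fun t => norm_deriv_le_of_lipschitz hφ
  set F : ℝ → ℝ → ℝ := fun ε t => M.en (γ t + ε • φ t, deriv γ t + ε • deriv φ t) with hF
  set F' : ℝ → ℝ → ℝ := fun ε t =>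
    fderiv ℝ M.en (γ t + ε • φ t, deriv γ t + ε • deriv φ t) (φ t, deriv φ t) with hF'
  have hz : ∀ ε : ℝ, Measurable fun t =>
      ((γ t + ε • φ t, deriv γ t + ε • deriv φ t) : (ℝ × ℝ) × (ℝ × ℝ)) := fun ε =>
    (hγ.continuous.add (hφ.continuous.const_smul ε)).measurable.prodMk
      ((measurable_deriv γ).add ((measurable_deriv φ).const_smul ε))
  have hv : ∀ ε ∈ Ioo (-1 : ℝ) 1, ∀ t, ‖deriv γ t + ε • deriv φ t‖ ≤ L + K := fun ε hε t => by
    refine (norm_add_le _ _).trans (add_le_add (hγ' t) ?_)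
    rw [norm_smul, Real.norm_eq_abs]
    have := abs_lt.2 hε
    have h2 := hφ' t
    nlinarith [abs_nonneg ε, norm_nonneg (deriv φ t)]
  have hFm : ∀ ε, Measurable (F ε) := fun ε => M.en_contDiff.continuous.measurable.comp (hz ε)
  have hFi : ∀ ε ∈ Ioo (-1 : ℝ) 1, IntervalIntegrable (F ε) volume a b := fun ε hε => by
    refine intervalIntegrable_of_bound (hFm ε) (C := (M.up * (L + K)) ^ 2) (fun t => ?_) a b
    simp only [hF, en_eq]
    rw [abs_of_nonneg (by positivity)]
    have := M.up_pos
    have h3 := hv ε hε t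
    exact pow_le_pow_left₀ (M.nrm_nonneg _ _) ((M.nrm_le_up _ _).trans (by gcongr)) 2
  obtain ⟨B, hB0, hB⟩ := exists_bound_of_periodic_fst M.continuous_fderiv_en
    (fun k => fderiv_periodic (M.en_periodic k)) (L + K)
  have hmem : Ioo (-1 : ℝ) 1 ∈ 𝓝 (0 : ℝ) := Ioo_mem_nhds (by norm_num) (by norm_num)
  have hφb : ∀ t ∈ uIoc a b, ‖φ t‖ ≤ K * (b - a) := fun t ht => by
    rw [uIoc_of_le hab] at ht
    have := hφ.dist_le_mul t a
    rw [ha, dist_zero_right, Real.dist_eq, abs_of_pos (sub_pos.2 ht.1)] at this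
    exact this.trans (by gcongr; exact ht.2)
  have hF'm : Measurable (F' 0) := by
    have h1 : Continuous fun p : ((ℝ × ℝ) × (ℝ × ℝ)) × ((ℝ × ℝ) × (ℝ × ℝ)) =>
        fderiv ℝ M.en p.1 p.2 :=
      (M.continuous_fderiv_en.comp continuous_fst).clm_apply continuous_snd
    exact h1.measurable.comp
      ((hz 0).prodMk (hφ.continuous.measurable.prodMk (measurable_deriv φ)))
  have hder := (intervalIntegral.hasDerivAt_integral_of_dominated_loc_of_deriv_le (μ := volume)
    (F := F) (F' := F') (a := a) (b := b) (bound := fun _ => B * (K * (b - a) + K)) hmem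
    (Eventually.of_forall fun ε => (hFm ε).aestronglyMeasurable)
    (hFi 0 (by simp)) hF'm.aestronglyMeasurable
    (Eventually.of_forall fun t ht ε hε => by
      refine (ContinuousLinearMap.le_opNorm _ _).trans ?_
      gcongr
      · exact hB _ (hv ε hε t)
      · rw [Prod.norm_def]
        have h0 : 0 ≤ (K : ℝ) * (b - a) := mul_nonneg K.2 (sub_nonneg.2 hab)
        exact max_le ((hφb t ht).trans (by linarith [K.2])) ((hφ' t).trans (by linarith)))
    intervalIntegrable_const
    (Eventually.of_forall fun t ht ε hε => by
      have h1 : HasFDerivAt M.en (fderiv ℝ M.en (γ t + ε • φ t, deriv γ t + ε • deriv φ t))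
          (γ t + ε • φ t, deriv γ t + ε • deriv φ t) :=
        (M.en_contDiff.differentiable (by simp) _).hasFDerivAt
      have h2 : HasDerivAt (fun ε : ℝ =>
          ((γ t + ε • φ t, deriv γ t + ε • deriv φ t) : (ℝ × ℝ) × (ℝ × ℝ)))
          (φ t, deriv φ t) ε := by
        have h3 := ((hasDerivAt_id ε).smul_const (φ t)).const_add (γ t)
        have h4 := ((hasDerivAt_id ε).smul_const (deriv φ t)).const_add (deriv γ t)
        simpa using h3.prodMk h4
      exact h1.comp_hasDerivAt ε h2)).2
  have hmin : IsLocalMin (fun ε => ∫ t in a..b, F ε t) 0 := by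
    filter_upwards [hmem] with ε hε
    have h0 : ∫ t in a..b, F 0 t ≤ b - a := by
      have : ∫ t in a..b, F 0 t ≤ ∫ t in a..b, (1 : ℝ) := by
        refine intervalIntegral.integral_mono_ae hab (hFi 0 (by simp)) intervalIntegrable_const ?_
        filter_upwards [hγ.ae_differentiableAt (μ := volume)] with t ht
        simp only [hF, en_eq, zero_smul, add_zero]
        exact pow_le_one₀ (M.nrm_nonneg _ _) (nrm_deriv_le_one h ht)
      simpa using this
    have hc : LipschitzWith (L + ‖ε‖₊ * K) fun t => γ t + ε • φ t :=
      hγ.add ((lipschitzWith_smul ε).comp hφ)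
    have h1 := dist_le_integral_nrm (M := M) hc hab
    rw [ha, hb, smul_zero, add_zero, add_zero] at h1
    have h2 : ∫ t in a..b, M.nrm (γ t + ε • φ t) (deriv (fun t => γ t + ε • φ t) t) ≤
        ∫ t in a..b, (1 + F ε t) / 2 := by
      refine intervalIntegral.integral_mono_ae hab ?_
        ((intervalIntegrable_const.add (hFi ε hε)).div_const 2) ?_
      · refine intervalIntegrable_of_bound (M.continuous_nrm.measurable.comp
          (hc.continuous.measurable.prodMk (measurable_deriv _)))
          (C := M.up * (L + ‖ε‖₊ * K : NNReal)) (fun t => ?_) a b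
        change |M.nrm _ _| ≤ _
        rw [abs_of_nonneg (M.nrm_nonneg _ _)]
        have h3 := norm_deriv_le_of_lipschitz hc (x₀ := t)
        have h := M.up_pos
        exact (M.nrm_le_up _ _).trans (by gcongr)
      · filter_upwards [hγ.ae_differentiableAt (μ := volume),
          hφ.ae_differentiableAt (μ := volume)] with t h3 h4
        have : deriv (fun t => γ t + ε • φ t) t = deriv γ t + ε • deriv φ t :=
          (h3.hasDerivAt.add (h4.hasDerivAt.const_smul ε)).deriv
        simp only [this, hF, en_eq]
        nlinarith [sq_nonneg (M.nrm (γ t + ε • φ t) (deriv γ t + ε • deriv φ t) - 1)]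
    have h3 : ∫ t in a..b, (1 + F ε t) / 2 = ((b - a) + ∫ t in a..b, F ε t) / 2 := by
      rw [intervalIntegral.integral_div, intervalIntegral.integral_add intervalIntegrable_const
        (hFi ε hε)]
      simp
    have : b - a ≤ ((b - a) + ∫ t in a..b, F ε t) / 2 := by
      rw [← h3]; exact hd.trans (h1.trans h2)
    show _ ≤ ∫ t in a..b, F ε t
    linarith
  have := hmin.hasDerivAt_eq_zero hder
  simpa [hF'] using this

end TorusMetric

lemma lipschitzWith_integral {w : ℝ → ℝ} (hw : Measurable w) {C : ℝ} (h : ∀ t, |w t| ≤ C) (a : ℝ) :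
    LipschitzWith (Real.toNNReal C) fun t => ∫ s in a..t, w s :=
  LipschitzWith.of_dist_le' fun s t => by
    rw [Real.dist_eq, intervalIntegral.integral_interval_sub_left
      (intervalIntegrable_of_bound hw h _ _) (intervalIntegrable_of_bound hw h _ _), Real.dist_eq,
      ← Real.norm_eq_abs]
    exact intervalIntegral.norm_integral_le_of_norm_le_const fun x _ => h x

lemma ae_deriv_integral {w : ℝ → ℝ} (hw : Measurable w) {C : ℝ} (h : ∀ t, |w t| ≤ C) {a b : ℝ}
    (hab : a ≤ b) : ∀ᵐ t, t ∈ Icc a b → HasDerivAt (fun t => ∫ s in a..t, w s) (w t) t := by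
  filter_upwards [(intervalIntegrable_of_bound hw h a b).ae_hasDerivAt_integral] with t ht h'
  rw [uIcc_of_le hab] at ht
  exact ht h' a (left_mem_Icc.2 hab)

/-- The lemma of du Bois-Reymond. -/
lemma du_bois_reymond {a b : ℝ} (hab : a < b) {p q : ℝ → ℝ} (hp : Measurable p)
    (hq : Measurable q) {C : ℝ} (hpC : ∀ t, |p t| ≤ C) (hqC : ∀ t, |q t| ≤ C)
    (h : ∀ (ψ : ℝ → ℝ) (K : NNReal), LipschitzWith K ψ → ψ a = 0 → ψ b = 0 →
      ∫ t in a..b, (q t * ψ t + p t * deriv ψ t) = 0) :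
    ∃ D, ∀ᵐ t, t ∈ Ioc a b → p t = D + ∫ s in a..t, q s := by
  have hC0 : 0 ≤ C := (abs_nonneg _).trans (hpC 0)
  set R : ℝ → ℝ := fun t => ∫ s in a..t, q s with hR
  have hRl : LipschitzWith (Real.toNNReal C) R := lipschitzWith_integral hq hqC a
  have hRb : ∀ t ∈ Ioc a b, |R t| ≤ C * (b - a) := fun t ht => by
    have : ‖R t‖ ≤ C * |t - a| := intervalIntegral.norm_integral_le_of_norm_le_const fun x _ => hqC x
    rw [Real.norm_eq_abs] at this
    rw [abs_of_pos (sub_pos.2 ht.1)] at this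
    exact this.trans (by gcongr; exact ht.2)
  set D : ℝ := (∫ t in a..b, (p t - R t)) / (b - a) with hD
  set w : ℝ → ℝ := (Ioc a b).indicator fun t => p t - R t - D with hw
  have hwm : Measurable w :=
    ((hp.sub hRl.continuous.measurable).sub measurable_const).indicator measurableSet_Ioc
  have hwb : ∀ t, |w t| ≤ C + C * (b - a) + |D| := fun t => by
    by_cases ht : t ∈ Ioc a b
    · rw [hw, indicator_of_mem ht]
      have h1 := hRb t ht
      have h2 := hpC t
      calc |p t - R t - D| ≤ |p t - R t| + |D| := abs_sub _ _
        _ ≤ |p t| + |R t| + |D| := by gcongr; exact abs_sub _ _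
        _ ≤ _ := by linarith
    · rw [hw, indicator_of_notMem ht, abs_zero]
      have : 0 ≤ b - a := by linarith
      positivity
  set ψ : ℝ → ℝ := fun t => ∫ s in a..t, w s with hψ
  have hψl := lipschitzWith_integral hwm hwb a
  have hψa : ψ a = 0 := by simp [hψ]
  have hwi := intervalIntegrable_of_bound hwm hwb a b
  have hpi := intervalIntegrable_of_bound hp hpC a b
  have hRi : IntervalIntegrable R volume a b := hRl.continuous.intervalIntegrable _ _
  have hψb : ψ b = 0 := by
    have : ∫ s in a..b, w s = ∫ s in a..b, (p s - R s - D) :=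
      intervalIntegral.integral_congr_ae (Eventually.of_forall fun t ht => by
        rw [uIoc_of_le hab.le] at ht
        rw [hw, indicator_of_mem ht])
    simp only [hψ]
    rw [this, intervalIntegral.integral_sub (hpi.sub hRi) intervalIntegrable_const,
      intervalIntegral.integral_const, smul_eq_mul, hD]
    have : b - a ≠ 0 := (sub_pos.2 hab).ne'
    field_simp
    ring
  have h0 := h ψ _ hψl hψa hψb
  have hψd := ae_deriv_integral hwm hwb hab.le
  have hRd := ae_deriv_integral hq hqC hab.le
  have hψi : IntervalIntegrable (deriv ψ) volume a b :=
    intervalIntegrable_of_bound (measurable_deriv ψ) (fun t => norm_deriv_le_of_lipschitz hψl) a b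
  have hqi := intervalIntegrable_of_bound hq hqC a b
  have hψc : Continuous ψ := hψl.continuous
  have hparts : ∫ t in a..b, R t * deriv ψ t = - ∫ t in a..b, q t * ψ t := by
    have h1 := ((hRl.lipschitzOnWith (s := uIcc a b)).absolutelyContinuousOnInterval).integral_mul_deriv_eq_deriv_mul
      ((hψl.lipschitzOnWith (s := uIcc a b)).absolutelyContinuousOnInterval)
    change ∫ t in a..b, R t * deriv ψ t = R b * ψ b - R a * ψ a - ∫ t in a..b, deriv R t * ψ t at h1
    rw [h1, hψa, hψb]
    have : ∫ t in a..b, deriv R t * ψ t = ∫ t in a..b, q t * ψ t :=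
      intervalIntegral.integral_congr_ae (by
        filter_upwards [hRd] with t h2 ht
        rw [uIoc_of_le hab.le] at ht
        rw [(h2 (Ioc_subset_Icc_self ht)).deriv])
    rw [this]; ring
  have hmul : ∀ {f : ℝ → ℝ}, IntervalIntegrable f volume a b →
      IntervalIntegrable (fun t => f t * ψ t) volume a b := fun hf => hf.mul_continuousOn hψc.continuousOn
  have hpd : IntervalIntegrable (fun t => p t * deriv ψ t) volume a b :=
    intervalIntegrable_of_bound (hp.mul (measurable_deriv ψ))
      (C := C * Real.toNNReal (C + C * (b - a) + |D|)) (fun t => by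
        rw [Pi.mul_apply, abs_mul]
        exact mul_le_mul (hpC t) (norm_deriv_le_of_lipschitz hψl) (abs_nonneg _) hC0) a b
  rw [intervalIntegral.integral_add (hmul hqi) hpd] at h0
  have hRd' : IntervalIntegrable (fun t => R t * deriv ψ t) volume a b :=
    hψi.continuousOn_mul hRl.continuous.continuousOn
  have h1 : ∫ t in a..b, (p t * deriv ψ t - R t * deriv ψ t - D * deriv ψ t) = 0 := by
    rw [intervalIntegral.integral_sub (hpd.sub hRd') (hψi.const_mul D),
      intervalIntegral.integral_sub hpd hRd', intervalIntegral.integral_const_mul, hparts,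
      hψl.integral_deriv]
    change _ - D * (ψ b - ψ a) = 0
    rw [hψa, hψb]; linarith
  have h2 : ∫ t in a..b, w t ^ 2 = 0 := by
    rw [← h1]
    refine intervalIntegral.integral_congr_ae ?_
    filter_upwards [hψd] with t h3 ht
    rw [uIoc_of_le hab.le] at ht
    rw [(h3 (Ioc_subset_Icc_self ht)).deriv, hw, indicator_of_mem ht]
    ring
  have hw2 : IntervalIntegrable (fun t => w t ^ 2) volume a b :=
    intervalIntegrable_of_bound (hwm.pow_const 2) (C := (C + C * (b - a) + |D|) ^ 2) (fun t => by
      rw [abs_pow]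
      exact pow_le_pow_left₀ (abs_nonneg _) (hwb t) 2) a b
  have h3 := (intervalIntegral.integral_eq_zero_iff_of_le_of_nonneg_ae hab.le
    (Eventually.of_forall fun t => sq_nonneg (w t)) hw2).1 h2
  refine ⟨D, ?_⟩
  rw [EventuallyEq, ae_restrict_iff' measurableSet_Ioc] at h3
  filter_upwards [h3] with t ht h'
  have h4 := ht h'
  simp only [Pi.zero_apply, ne_eq, OfNat.ofNat_ne_zero, not_false_eq_true, pow_eq_zero_iff] at h4
  rw [hw, indicator_of_mem h'] at h4
  change p t = D + R t
  linarith

namespace TorusMetric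
variable (M : TorusMetric)

/-- The determinant of the metric tensor. -/
def gdet (x : ℝ × ℝ) : ℝ :=
  M.coef (1, 0) (1, 0) x * M.coef (0, 1) (0, 1) x - M.coef (1, 0) (0, 1) x ^ 2

lemma gdet_pos (x : ℝ × ℝ) : 0 < M.gdet x := by
  have h1 : 0 < M.coef (1, 0) (1, 0) x := M.posdef x _ (by simp)
  have h2 := M.posdef x (-M.coef (1, 0) (0, 1) x, M.coef (1, 0) (1, 0) x) (by
    intro h; simp only [Prod.mk_eq_zero] at h; exact h1.ne' h.2)
  rw [g_eq] at h2
  unfold gdet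
  have h3 : 0 < M.coef (1, 0) (1, 0) x * (M.coef (1, 0) (1, 0) x * M.coef (0, 1) (0, 1) x
    - M.coef (1, 0) (0, 1) x ^ 2) := by nlinarith
  exact pos_of_mul_pos_right h3 h1.le

/-- The Legendre transform. -/
def mom (z : (ℝ × ℝ) × (ℝ × ℝ)) : ℝ × ℝ := (M.g z.1 z.2 (1, 0), M.g z.1 z.2 (0, 1))

/-- The inverse Legendre transform. -/
def leg (z : (ℝ × ℝ) × (ℝ × ℝ)) : ℝ × ℝ :=
  ((M.coef (0, 1) (0, 1) z.1 * z.2.1 - M.coef (1, 0) (0, 1) z.1 * z.2.2) / M.gdet z.1,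
    (M.coef (1, 0) (1, 0) z.1 * z.2.2 - M.coef (1, 0) (0, 1) z.1 * z.2.1) / M.gdet z.1)

lemma leg_mom (x v : ℝ × ℝ) : M.leg (x, M.mom (x, v)) = v := by
  have := (M.gdet_pos x).ne'
  ext
  · simp only [leg, mom, g_eq M x v]
    rw [div_eq_iff this]; unfold gdet; ring
  · simp only [leg, mom, g_eq M x v]
    rw [div_eq_iff this]; unfold gdet; ring

lemma mom_leg (x p : ℝ × ℝ) : M.mom (x, M.leg (x, p)) = p := by
  have := (M.gdet_pos x).ne'
  ext
  · simp only [mom, g_eq M x, leg]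
    field_simp; unfold gdet; ring
  · simp only [mom, g_eq M x, leg]
    field_simp; unfold gdet; ring

lemma leg_contDiff : ContDiff ℝ (⊤ : ℕ∞) M.leg := by
  have h : ∀ i j, ContDiff ℝ (⊤ : ℕ∞) fun z : (ℝ × ℝ) × (ℝ × ℝ) => M.coef i j z.1 :=
    fun i j => (M.coef_contDiff i j).comp contDiff_fst
  have hd : ContDiff ℝ (⊤ : ℕ∞) fun z : (ℝ × ℝ) × (ℝ × ℝ) => M.gdet z.1 :=
    ((h _ _).mul (h _ _)).sub ((h _ _).pow 2)
  have h1 : ContDiff ℝ (⊤ : ℕ∞) fun z : (ℝ × ℝ) × (ℝ × ℝ) => z.2.1 := contDiff_fst.comp contDiff_snd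
  have h2 : ContDiff ℝ (⊤ : ℕ∞) fun z : (ℝ × ℝ) × (ℝ × ℝ) => z.2.2 := contDiff_snd.comp contDiff_snd
  exact ((((h _ _).mul h1).sub ((h _ _).mul h2)).div hd fun z => (M.gdet_pos _).ne').prodMk
    ((((h _ _).mul h2).sub ((h _ _).mul h1)).div hd fun z => (M.gdet_pos _).ne')

lemma leg_periodic (k : ℤ × ℤ) (z : (ℝ × ℝ) × (ℝ × ℝ)) : M.leg (z + (lat k, 0)) = M.leg z := by
  simp [leg, gdet, coef_periodic]

/-- The force term of the Hamiltonian system of the geodesic flow, as a function on the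
tangent bundle. -/
def force (z : (ℝ × ℝ) × (ℝ × ℝ)) : ℝ × ℝ :=
  (1 / 2 * fderiv ℝ M.en z ((1, 0), 0), 1 / 2 * fderiv ℝ M.en z ((0, 1), 0))

lemma force_contDiff : ContDiff ℝ (⊤ : ℕ∞) M.force := by
  have h : ContDiff ℝ (⊤ : ℕ∞) (fderiv ℝ M.en) := M.en_contDiff.fderiv_right (by simp)
  exact (contDiff_const.mul (h.clm_apply contDiff_const)).prodMk
    (contDiff_const.mul (h.clm_apply contDiff_const))

lemma force_periodic (k : ℤ × ℤ) (z : (ℝ × ℝ) × (ℝ × ℝ)) :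
    M.force (z + (lat k, 0)) = M.force z := by
  simp only [force, fderiv_periodic (M.en_periodic k)]

/-- The Hamiltonian vector field of the geodesic flow on the cotangent bundle. -/
def ham (z : (ℝ × ℝ) × (ℝ × ℝ)) : (ℝ × ℝ) × (ℝ × ℝ) := (M.leg z, M.force (z.1, M.leg z))

lemma ham_contDiff : ContDiff ℝ (⊤ : ℕ∞) M.ham :=
  M.leg_contDiff.prodMk (M.force_contDiff.comp (contDiff_fst.prodMk M.leg_contDiff))

lemma ham_periodic (k : ℤ × ℤ) (z : (ℝ × ℝ) × (ℝ × ℝ)) : M.ham (z + (lat k, 0)) = M.ham z := by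
  have := M.force_periodic k (z.1, M.leg z)
  simp only [Prod.mk_add_mk, add_zero] at this
  simp only [ham, leg_periodic, Prod.fst_add, this]

lemma fderiv_en_vert (x v w : ℝ × ℝ) : fderiv ℝ M.en (x, v) (0, w) = 2 * M.g x v w := by
  have h1 : HasFDerivAt M.en (fderiv ℝ M.en (x, v)) (x, v) :=
    (M.en_contDiff.differentiable (by simp) _).hasFDerivAt
  have h2 : HasDerivAt (fun ε : ℝ => ((x, v + ε • w) : (ℝ × ℝ) × (ℝ × ℝ))) (0, w) 0 := by
    have h4 := ((hasDerivAt_id (0 : ℝ)).smul_const w).const_add v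
    simpa using (hasDerivAt_const (0 : ℝ) x).prodMk h4
  have h3 : HasDerivAt (fun ε : ℝ => M.en (x, v + ε • w)) (fderiv ℝ M.en (x, v) (0, w)) 0 := by
    have : HasFDerivAt M.en (fderiv ℝ M.en (x, v)) ((x, v + (0 : ℝ) • w)) := by simpa using h1
    exact this.comp_hasDerivAt 0 h2
  have h5 : HasDerivAt (fun ε : ℝ => M.en (x, v + ε • w)) (2 * M.g x v w) 0 := by
    have : (fun ε : ℝ => M.en (x, v + ε • w)) =
        fun ε => M.g x v v + ε * (2 * M.g x v w) + ε ^ 2 * M.g x w w := by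
      ext ε
      simp only [en, g_add_left, g_add_right, g_smul_left, g_smul_right, M.symm x w v]
      ring
    rw [this]
    have h6 := (((hasDerivAt_id (0 : ℝ)).mul_const (2 * M.g x v w)).const_add (M.g x v v)).add
      (((hasDerivAt_id (0 : ℝ)).pow 2).mul_const (M.g x w w))
    exact h6.congr_deriv (by simp)
  exact h3.unique h5

variable {M}

lemma du_bois_reymond_curve {γ : ℝ → ℝ × ℝ} (h : M.ULip γ) {a b : ℝ} (hab : a < b)
    (hd : b - a ≤ M.dist (γ a) (γ b)) (w : ℝ × ℝ) :
    (Measurable fun s => fderiv ℝ M.en (γ s, deriv γ s) (w, 0)) ∧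
    (∃ C, ∀ s, |fderiv ℝ M.en (γ s, deriv γ s) (w, 0)| ≤ C) ∧
    ∃ D, ∀ᵐ t, t ∈ Ioc a b → 2 * M.g (γ t) (deriv γ t) w =
      D + ∫ s in a..t, fderiv ℝ M.en (γ s, deriv γ s) (w, 0) := by
  have hγ := lipschitz_of_uLip h
  set L := Real.toNNReal (1 / M.lo)
  have hγ' : ∀ t, ‖deriv γ t‖ ≤ L := fun t => norm_deriv_le_of_lipschitz hγ
  obtain ⟨B, hB0, hB⟩ := exists_bound_of_periodic_fst M.continuous_fderiv_en
    (fun k => fderiv_periodic (M.en_periodic k)) L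
  have hm : ∀ u, Measurable fun s => fderiv ℝ M.en (γ s, deriv γ s) u := fun u =>
    (M.continuous_fderiv_en.clm_apply continuous_const).measurable.comp
      (hγ.continuous.measurable.prodMk (measurable_deriv γ))
  have hb : ∀ u : (ℝ × ℝ) × (ℝ × ℝ), ‖u‖ ≤ ‖w‖ → ∀ s,
      |fderiv ℝ M.en (γ s, deriv γ s) u| ≤ B * ‖w‖ := fun u hu s =>
    (ContinuousLinearMap.le_opNorm _ _).trans (mul_le_mul (hB _ (hγ' s)) hu (norm_nonneg _) hB0)
  have hw1 : ‖((w, 0) : (ℝ × ℝ) × (ℝ × ℝ))‖ ≤ ‖w‖ := by simp [Prod.norm_def]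
  have hw2 : ‖((0, w) : (ℝ × ℝ) × (ℝ × ℝ))‖ ≤ ‖w‖ := by simp [Prod.norm_def]
  refine ⟨hm _, ⟨_, hb _ hw1⟩, ?_⟩
  obtain ⟨D, hD⟩ := du_bois_reymond hab (hm (0, w)) (hm (w, 0)) (hb _ hw2) (hb _ hw1)
    (fun ψ K hψ ha hb => by
      have hl : LipschitzWith (K * ‖w‖₊) fun t => ψ t • w := LipschitzWith.of_dist_le_mul fun s t => by
        rw [dist_eq_norm, ← sub_smul, norm_smul]
        have := hψ.dist_le_mul s t
        rw [dist_eq_norm] at this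
        calc _ ≤ K * Dist.dist s t * ‖w‖ := by gcongr
          _ = _ := by simp; ring
      rw [← weak_euler_lagrange h hab.le hd hl (by simp [ha]) (by simp [hb])]
      refine intervalIntegral.integral_congr_ae ?_
      filter_upwards [hψ.ae_differentiableAt (μ := volume)] with t ht _
      have e1 : deriv (fun t => ψ t • w) t = deriv ψ t • w := (ht.hasDerivAt.smul_const w).deriv
      have e2 : ((ψ t • w, deriv ψ t • w) : (ℝ × ℝ) × (ℝ × ℝ)) =
        ψ t • ((w, 0) : (ℝ × ℝ) × (ℝ × ℝ)) + deriv ψ t • ((0, w) : (ℝ × ℝ) × (ℝ × ℝ)) := by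
        ext <;> simp
      rw [e1, e2, map_add, map_smul, map_smul, smul_eq_mul, smul_eq_mul]
      ring)
  exact ⟨D, hD.mono fun t ht h' => by rw [← ht h', fderiv_en_vert]⟩

lemma hasDerivAt_of_minimal {γ : ℝ → ℝ × ℝ} (h : M.ULip γ) {a b : ℝ} (hab : a < b)
    (hd : b - a ≤ M.dist (γ a) (γ b)) {t : ℝ} (ht : t ∈ Ioo a b) :
    HasDerivAt γ (deriv γ t) t ∧
      HasDerivAt (fun s => M.mom (γ s, deriv γ s)) (M.force (γ t, deriv γ t)) t := by
  have hγ := lipschitz_of_uLip h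
  obtain ⟨m0, ⟨C0, b0⟩, D0, h0⟩ := du_bois_reymond_curve h hab hd (1, 0)
  obtain ⟨m1, ⟨C1, b1⟩, D1, h1⟩ := du_bois_reymond_curve h hab hd (0, 1)
  set q0 := fun s => fderiv ℝ M.en (γ s, deriv γ s) ((1, 0), 0) with hq0
  set q1 := fun s => fderiv ℝ M.en (γ s, deriv γ s) ((0, 1), 0) with hq1
  set P : ℝ → ℝ × ℝ := fun t => (1 / 2 * (D0 + ∫ s in a..t, q0 s), 1 / 2 * (D1 + ∫ s in a..t, q1 s))
    with hP
  have hPc : Continuous P :=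
    (continuous_const.mul (continuous_const.add (lipschitzWith_integral m0 b0 a).continuous)).prodMk
    (continuous_const.mul (continuous_const.add (lipschitzWith_integral m1 b1 a).continuous))
  have hV : Continuous fun t => M.leg (γ t, P t) :=
    M.leg_contDiff.continuous.comp (hγ.continuous.prodMk hPc)
  have hae : ∀ᵐ t, t ∈ Ioc a b → deriv γ t = M.leg (γ t, P t) := by
    filter_upwards [h0, h1] with s h0 h1 hs
    have : P s = M.mom (γ s, deriv γ s) := by
      simp only [hP, mom, ← h0 hs, ← h1 hs]
      ext <;> simp
    rw [this, leg_mom]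
  have key : ∀ t ∈ Ioo a b, HasDerivAt γ (M.leg (γ t, P t)) t := fun t ht => by
    have comp : ∀ (π : ℝ × ℝ →L[ℝ] ℝ), (∀ x, ‖π x‖ ≤ ‖x‖) →
        HasDerivAt (fun s => π (γ s)) (π (M.leg (γ t, P t))) t := fun π hπ => by
      have hl : LipschitzWith (Real.toNNReal (1 / M.lo)) fun s => π (γ s) :=
        LipschitzWith.of_dist_le_mul fun s t => by
          rw [dist_eq_norm, ← map_sub]
          have := hγ.dist_le_mul s t
          rw [dist_eq_norm] at this
          exact (hπ _).trans this
      have hc : Continuous fun s => π (M.leg (γ s, P s)) := π.continuous.comp hV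
      have e : ∀ᶠ s in 𝓝 t, π (γ s) = π (γ a) + ∫ r in a..s, π (M.leg (γ r, P r)) := by
        filter_upwards [Ioo_mem_nhds ht.1 ht.2] with s hs
        have h2 := hl.integral_deriv a s
        rw [← sub_eq_iff_eq_add', ← h2]
        refine intervalIntegral.integral_congr_ae ?_
        filter_upwards [hae, hγ.ae_differentiableAt (μ := volume)] with r h3 h4 h5
        rw [uIoc_of_le hs.1.le] at h5
        rw [← h3 ⟨h5.1, h5.2.trans hs.2.le⟩]
        exact (π.hasFDerivAt.comp_hasDerivAt r h4.hasDerivAt).deriv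
      refine HasDerivAt.congr_of_eventuallyEq ?_ e
      exact (intervalIntegral.integral_hasDerivAt_right (hc.intervalIntegrable _ _)
        hc.stronglyMeasurable.stronglyMeasurableAtFilter hc.continuousAt).const_add _
    exact (comp (ContinuousLinearMap.fst ℝ ℝ ℝ) norm_fst_le).prodMk
      (comp (ContinuousLinearMap.snd ℝ ℝ ℝ) norm_snd_le)
  have hmom : ∀ᶠ s in 𝓝 t, M.mom (γ s, deriv γ s) = P s := by
    filter_upwards [Ioo_mem_nhds ht.1 ht.2] with s hs
    rw [(key s hs).deriv, mom_leg]
  have hcont : ∀ u, ContinuousAt (fun s => fderiv ℝ M.en (γ s, deriv γ s) u) t := fun u => by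
    have hc : Continuous fun s => fderiv ℝ M.en (γ s, M.leg (γ s, P s)) u :=
      (M.continuous_fderiv_en.comp (hγ.continuous.prodMk hV)).clm_apply continuous_const
    refine hc.continuousAt.congr ?_
    filter_upwards [Ioo_mem_nhds ht.1 ht.2] with s hs
    rw [(key s hs).deriv]
  refine ⟨(key t ht).differentiableAt.hasDerivAt, ?_⟩
  refine HasDerivAt.congr_of_eventuallyEq ?_ hmom
  have d0 : HasDerivAt (fun t => ∫ s in a..t, q0 s) (q0 t) t :=
    intervalIntegral.integral_hasDerivAt_right (intervalIntegrable_of_bound m0 b0 _ _)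
      m0.stronglyMeasurable.stronglyMeasurableAtFilter (hcont _)
  have d1 : HasDerivAt (fun t => ∫ s in a..t, q1 s) (q1 t) t :=
    intervalIntegral.integral_hasDerivAt_right (intervalIntegrable_of_bound m1 b1 _ _)
      m1.stronglyMeasurable.stronglyMeasurableAtFilter (hcont _)
  exact ((d0.const_add D0).const_mul _).prodMk ((d1.const_add D1).const_mul _)

end TorusMetric

end regularity

namespace TorusMetric
variable {M : TorusMetric}

lemma IsoOn.uLip_clamp {γ : ℝ → ℝ × ℝ} {a b : ℝ} (h : M.IsoOn γ a b) (hab : a ≤ b) :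
    M.ULip fun s => γ (max a (min s b)) := fun s t hst => by
  have h1 : max a (min s b) ≤ max a (min t b) := max_le_max le_rfl (min_le_min_right _ hst)
  rw [h _ _ (le_max_left _ _) h1 (max_le hab (min_le_right _ _))]
  rcases le_total a (min s b) with h2 | h2 <;> rcases le_total a (min t b) with h3 | h3 <;>
    rcases le_total s b with h4 | h4 <;> rcases le_total t b with h5 | h5 <;>
    simp_all <;> linarith

lemma LocIso.hasDerivAt_aux {γ : ℝ → ℝ × ℝ} (h : M.LocIso γ) (t : ℝ) :
    HasDerivAt γ (deriv γ t) t ∧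
      HasDerivAt (fun s => M.mom (γ s, deriv γ s)) (M.force (γ t, deriv γ t)) t := by
  obtain ⟨ε, hε, hi⟩ := h t
  have hc := hi.uLip_clamp (by linarith)
  set γ' : ℝ → ℝ × ℝ := fun s => γ (max (t - ε) (min s (t + ε))) with hγ'
  have he : ∀ s ∈ Icc (t - ε) (t + ε), γ' s = γ s := fun s hs => by
    simp only [hγ', min_eq_left hs.2, max_eq_right hs.1]
  have hee : ∀ s ∈ Ioo (t - ε) (t + ε), γ' =ᶠ[𝓝 s] γ := fun s hs => by
    filter_upwards [Ioo_mem_nhds hs.1 hs.2] with r hr using he r (Ioo_subset_Icc_self hr)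
  have htm : t ∈ Ioo (t - ε) (t + ε) := ⟨by linarith, by linarith⟩
  have hab : t - ε < t + ε := by linarith
  have hd : (t + ε) - (t - ε) ≤ M.dist (γ' (t - ε)) (γ' (t + ε)) := by
    rw [he _ (left_mem_Icc.2 hab.le), he _ (right_mem_Icc.2 hab.le), hi _ _ le_rfl hab.le le_rfl]
  obtain ⟨h1, h2⟩ := hasDerivAt_of_minimal hc hab hd htm
  have h3 : deriv γ' t = deriv γ t := (hee t htm).deriv_eq
  rw [h3] at h1 h2
  rw [he t (Ioo_subset_Icc_self htm)] at h2
  refine ⟨h1.congr_of_eventuallyEq (hee t htm).symm, h2.congr_of_eventuallyEq ?_⟩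
  filter_upwards [Ioo_mem_nhds htm.1 htm.2] with s hs
  rw [he s (Ioo_subset_Icc_self hs), (hee s hs).deriv_eq]

lemma LocIso.hasDerivAt {γ : ℝ → ℝ × ℝ} (h : M.LocIso γ) (t : ℝ) : HasDerivAt γ (deriv γ t) t :=
  (h.hasDerivAt_aux t).1

lemma LocIso.differentiable {γ : ℝ → ℝ × ℝ} (h : M.LocIso γ) : Differentiable ℝ γ :=
  fun t => (h.hasDerivAt t).differentiableAt

lemma LocIso.continuous {γ : ℝ → ℝ × ℝ} (h : M.LocIso γ) : Continuous γ :=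
  h.differentiable.continuous

lemma LocIso.nrm_deriv {γ : ℝ → ℝ × ℝ} (h : M.LocIso γ) (t : ℝ) :
    M.nrm (γ t) (deriv γ t) = 1 := by
  refine tendsto_nhds_unique (tendsto_dist_div (h.hasDerivAt t)) ?_
  obtain ⟨ε, hε, hi⟩ := h t
  refine tendsto_const_nhds.congr' ?_
  filter_upwards [Ioo_mem_nhdsGT (show t < t + ε by linarith)] with s hs
  rw [hi t s (by linarith) hs.1.le hs.2.le, div_self (sub_pos.2 hs.1).ne']

lemma LocIso.norm_deriv_le {γ : ℝ → ℝ × ℝ} (h : M.LocIso γ) (t : ℝ) :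
    ‖deriv γ t‖ ≤ 1 / M.lo := by
  rw [le_div_iff₀ M.lo_pos, mul_comm, ← h.nrm_deriv t]
  exact M.lo_le_nrm _ _

lemma LocIso.deriv_ne_zero {γ : ℝ → ℝ × ℝ} (h : M.LocIso γ) (t : ℝ) : deriv γ t ≠ 0 := fun h0 => by
  have := h.nrm_deriv t
  rw [h0] at this
  simp [nrm, g_zero_left] at this

variable (M) in
/-- The lift of a curve to the cotangent bundle. -/
def phase (γ : ℝ → ℝ × ℝ) (t : ℝ) : (ℝ × ℝ) × (ℝ × ℝ) := (γ t, M.mom (γ t, deriv γ t))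

lemma LocIso.hasDerivAt_phase {γ : ℝ → ℝ × ℝ} (h : M.LocIso γ) (t : ℝ) :
    HasDerivAt (M.phase γ) (M.ham (M.phase γ t)) t := by
  have := (h.hasDerivAt_aux t).1.prodMk (h.hasDerivAt_aux t).2
  have e : M.ham (M.phase γ t) = (deriv γ t, M.force (γ t, deriv γ t)) := by
    simp only [ham, phase, leg_mom]
  rw [e]
  exact this

variable (M) in
lemma exists_mom_bound : ∃ C, ∀ γ, M.LocIso γ → ∀ t, ‖(M.phase γ t).2‖ ≤ C := by
  have hc : Continuous M.mom :=
    (M.continuous_g.comp (continuous_fst.prodMk (continuous_snd.prodMk continuous_const))).prodMk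
    (M.continuous_g.comp (continuous_fst.prodMk (continuous_snd.prodMk continuous_const)))
  obtain ⟨B, -, hB⟩ := exists_bound_of_periodic_fst hc
    (fun k z => by simp [mom, M.periodic]) (1 / M.lo)
  exact ⟨B, fun γ h t => hB (γ t, deriv γ t) (h.norm_deriv_le t)⟩

/-- A minimal curve is determined by its position and velocity at one time. -/
lemma LocIso.eq_of_deriv_eq {γ γ' : ℝ → ℝ × ℝ} (h : M.LocIso γ) (h' : M.LocIso γ') {t : ℝ}
    (e : γ t = γ' t) (e' : deriv γ t = deriv γ' t) : γ = γ' := by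
  obtain ⟨C, hC⟩ := M.exists_mom_bound
  obtain ⟨B, hB0, hB⟩ := exists_bound_of_periodic_fst (M.ham_contDiff.continuous_fderiv (by simp))
    (fun k => fderiv_periodic (M.ham_periodic k)) C
  set s : Set ((ℝ × ℝ) × (ℝ × ℝ)) := {z | ‖z.2‖ ≤ C} with hs
  have hconv : Convex ℝ s := by
    have : s = Prod.snd ⁻¹' (Metric.closedBall (0 : ℝ × ℝ) C) := by ext; simp [hs]
    rw [this]
    exact (convex_closedBall _ _).linear_preimage (LinearMap.snd ℝ (ℝ × ℝ) (ℝ × ℝ))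
  have hl : LipschitzOnWith (Real.toNNReal B) M.ham s :=
    hconv.lipschitzOnWith_of_nnnorm_fderiv_le
      (fun z _ => M.ham_contDiff.differentiable (by simp) z) fun z hz => by
        rw [← NNReal.coe_le_coe, coe_nnnorm, Real.coe_toNNReal _ hB0]
        exact hB z hz
  have := ODE_solution_unique_univ (v := fun _ => M.ham) (s := fun _ => s) (fun _ => hl)
    (fun t => ⟨h.hasDerivAt_phase t, hC γ h t⟩) (fun t => ⟨h'.hasDerivAt_phase t, hC γ' h' t⟩)
    (t₀ := t) (by simp only [phase, e, e'])
  exact funext fun t => congrArg Prod.fst (congrFun this t)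

variable (M) in
/-- Uniform Lipschitz bound for the velocities of minimal curves. -/
lemma exists_deriv_lipschitz :
    ∃ K, 0 ≤ K ∧ ∀ γ, M.LocIso γ → ∀ s t, ‖deriv γ t - deriv γ s‖ ≤ K * |t - s| := by
  obtain ⟨C, hC⟩ := M.exists_mom_bound
  obtain ⟨B, hB0, hB⟩ := exists_bound_of_periodic_fst (M.leg_contDiff.continuous_fderiv (by simp))
    (fun k => fderiv_periodic (M.leg_periodic k)) C
  obtain ⟨B', hB0', hB'⟩ := exists_bound_of_periodic_fst M.ham_contDiff.continuous
    M.ham_periodic C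
  refine ⟨B * B', mul_nonneg hB0 hB0', fun γ h s t => ?_⟩
  have hd : ∀ r, HasDerivAt (deriv γ)
      (fderiv ℝ M.leg (M.phase γ r) (M.ham (M.phase γ r))) r := fun r => by
    have h1 : HasFDerivAt M.leg (fderiv ℝ M.leg (M.phase γ r)) (M.phase γ r) :=
      (M.leg_contDiff.differentiable (by simp) _).hasFDerivAt
    have h2 := h1.comp_hasDerivAt r (h.hasDerivAt_phase r)
    refine h2.congr_of_eventuallyEq (Eventually.of_forall fun r => ?_)
    simp only [Function.comp, phase, leg_mom]
  have := convex_univ.norm_image_sub_le_of_norm_hasDerivWithin_le (C := B * B')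
    (fun r _ => (hd r).hasDerivWithinAt) (fun r _ => by
      refine (ContinuousLinearMap.le_opNorm _ _).trans ?_
      exact mul_le_mul (hB _ (hC γ h r)) (hB' _ (hC γ h r)) (norm_nonneg _) hB0)
    (mem_univ s) (mem_univ t)
  simpa using this

lemma LocIso.contDiff {γ : ℝ → ℝ × ℝ} (h : M.LocIso γ) : ContDiff ℝ (⊤ : ℕ∞) γ := by
  have hz : ∀ n : ℕ, ContDiff ℝ n (M.phase γ) := fun n => by
    induction n with
    | zero =>
      exact contDiff_zero.2 (continuous_iff_continuousAt.2
        fun t => (h.hasDerivAt_phase t).continuousAt)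
    | succ n ih =>
      have : deriv (M.phase γ) = M.ham ∘ M.phase γ := funext fun t => (h.hasDerivAt_phase t).deriv
      rw [Nat.cast_succ, contDiff_succ_iff_deriv]
      refine ⟨fun t => (h.hasDerivAt_phase t).differentiableAt, by simp, ?_⟩
      rw [this]
      exact (M.ham_contDiff.of_le (by exact_mod_cast le_top)).comp ih
  exact contDiff_fst.comp (contDiff_infty.2 hz)

lemma length_of_unit_speed {c : ℝ → ℝ × ℝ} (h : ∀ t, M.g (c t) (deriv c t) (deriv c t) = 1)
    (a b : ℝ) : M.length c a b = b - a := by simp [length, h]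

lemma LocIso.isGeodesic {γ : ℝ → ℝ × ℝ} (h : M.LocIso γ) : M.IsGeodesic γ := by
  have hs : ∀ t, M.g (γ t) (deriv γ t) (deriv γ t) = 1 := fun t => by
    rw [← nrm_sq, h.nrm_deriv, one_pow]
  refine ⟨h.contDiff, hs, fun t => ?_⟩
  obtain ⟨ε, hε, hi⟩ := h t
  refine ⟨ε, hε, fun s₁ s₂ h1 h2 h3 => ?_⟩
  rw [hi s₁ s₂ h1 h2 h3, length_of_unit_speed hs]

lemma IsGeodesic.locIso {γ : ℝ → ℝ × ℝ} (h : M.IsGeodesic γ) : M.LocIso γ := fun t => by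
  obtain ⟨ε, hε, hi⟩ := h.2.2 t
  refine ⟨ε, hε, fun s₁ s₂ h1 h2 h3 => ?_⟩
  rw [hi s₁ s₂ h1 h2 h3, length_of_unit_speed h.2.1]

lemma LocIso.uLip {γ : ℝ → ℝ × ℝ} (h : M.LocIso γ) : M.ULip γ := fun s t hst => by
  have := M.dist_le_length_sub (h.contDiff.of_le (by exact_mod_cast le_top)) hst
  rwa [length_of_unit_speed h.isGeodesic.2.1] at this

/-- Two minimal curves which agree on an interval coincide. -/
lemma LocIso.eq_of_eqOn {γ γ' : ℝ → ℝ × ℝ} (h : M.LocIso γ) (h' : M.LocIso γ') {a b : ℝ}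
    (hab : a < b) (e : ∀ t ∈ Ioo a b, γ t = γ' t) : γ = γ' := by
  obtain ⟨t, ht⟩ := exists_between hab
  refine h.eq_of_deriv_eq h' (e t ht) ?_
  refine EventuallyEq.deriv_eq ?_
  filter_upwards [Ioo_mem_nhds ht.1 ht.2] with s hs using e s hs

end TorusMetric

/-! ### Separation of the plane by periodic curves -/

lemma exists_log {F : ℝ → ℂ} (hF : Continuous F) (h0 : ∀ t, F t ≠ 0) :
    ∃ θ : ℝ → ℂ, Continuous θ ∧ ∀ t, Complex.exp (θ t) = F t := by
  have hs : IsSimplyConnected (univ : Set ℝ) := by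
    have : ContractibleSpace (univ : Set ℝ) :=
      (convex_univ : Convex ℝ (univ : Set ℝ)).contractibleSpace univ_nonempty
    exact SimplyConnectedSpace.ofContractible _
  obtain ⟨θ, h1, h2⟩ := Complex.exists_continuousOn_eqOn_exp_comp hs isOpen_univ
    hF.continuousOn (by rintro ⟨t, -, ht⟩; exact h0 t ht)
  exact ⟨θ, continuousOn_univ.1 h1, fun t => h2 (mem_univ t)⟩

lemma const_of_exp_eq_one {f : ℝ → ℂ} (hf : Continuous f) (h : ∀ t, Complex.exp (f t) = 1)
    (s t : ℝ) : f s = f t := by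
  have h1 : ∀ t, ∃ n : ℤ, f t = n * (2 * Real.pi * Complex.I) := fun t =>
    Complex.exp_eq_one_iff.1 (h t)
  choose n hn using h1
  have hc : Continuous fun t => ((n t : ℤ) : ℝ) := by
    have : (fun t => ((n t : ℤ) : ℝ)) = fun t => (f t).im / (2 * Real.pi) := by
      ext t
      rw [hn t]
      simp [Real.pi_ne_zero]
    rw [this]
    exact (Complex.continuous_im.comp hf).div_const _
  have hc' : Continuous n := Int.isClosedEmbedding_coe_real.isEmbedding.continuous_iff.2 hc
  rw [hn s, hn t, PreconnectedSpace.constant inferInstance hc']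

lemma log_eq_add_const {θ θ' : ℝ → ℂ} (h : Continuous θ) (h' : Continuous θ')
    (e : ∀ t, Complex.exp (θ t) = Complex.exp (θ' t)) (s t : ℝ) : θ s - θ' s = θ t - θ' t :=
  const_of_exp_eq_one (h.sub h') (fun t => by
    rw [Pi.sub_apply, Complex.exp_sub, e t, div_self (Complex.exp_ne_zero _)]) s t

/-- The complex coordinate of the plane in which `v` corresponds to `1`. -/
def cx (v x : ℝ × ℝ) : ℂ := (x.1 + x.2 * Complex.I) / (v.1 + v.2 * Complex.I)

lemma cx_denom {v : ℝ × ℝ} (hv : v ≠ 0) : (v.1 + v.2 * Complex.I : ℂ) ≠ 0 := fun h => hv (by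
  have h1 := congrArg Complex.re h
  have h2 := congrArg Complex.im h
  simp at h1 h2
  exact Prod.ext h1 h2)

lemma continuous_cx (v : ℝ × ℝ) : Continuous (cx v) := by
  unfold cx
  fun_prop

lemma cx_add (v x y : ℝ × ℝ) : cx v (x + y) = cx v x + cx v y := by
  simp only [cx, Prod.fst_add, Prod.snd_add, Complex.ofReal_add]
  ring

lemma cx_self {v : ℝ × ℝ} (hv : v ≠ 0) : cx v v = 1 := div_self (cx_denom hv)

lemma cx_smul {v : ℝ × ℝ} (hv : v ≠ 0) (r : ℝ) : cx v (r • v) = r := by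
  rw [cx, div_eq_iff (cx_denom hv)]
  simp only [Prod.smul_fst, Prod.smul_snd, smul_eq_mul, Complex.ofReal_mul]
  ring

lemma cx_injective {v : ℝ × ℝ} (hv : v ≠ 0) {x y : ℝ × ℝ} (h : cx v x = cx v y) : x = y := by
  unfold cx at h
  rw [div_left_inj' (cx_denom hv)] at h
  have h1 := congrArg Complex.re h
  have h2 := congrArg Complex.im h
  simp at h1 h2
  exact Prod.ext h1 h2

lemma cx_im (v x : ℝ × ℝ) : (cx v x).im = crossDet v x / (v.1 ^ 2 + v.2 ^ 2) := by
  rw [cx, Complex.div_im]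
  simp [Complex.normSq_apply, crossDet]
  ring

lemma crossDet_add (v x y : ℝ × ℝ) : crossDet v (x + y) = crossDet v x + crossDet v y := by
  simp [crossDet]; ring

lemma crossDet_smul_left (r : ℝ) (v x : ℝ × ℝ) : crossDet (r • v) x = r * crossDet v x := by
  simp [crossDet]; ring

lemma crossDet_smul_right (r : ℝ) (v x : ℝ × ℝ) : crossDet v (r • x) = r * crossDet v x := by
  simp [crossDet]; ring

lemma crossDet_self (v : ℝ × ℝ) : crossDet v v = 0 := by
  simp [crossDet]; ring

lemma continuous_crossDet (v : ℝ × ℝ) : Continuous (crossDet v) := by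
  unfold crossDet
  fun_prop

lemma sq_add_sq_pos {v : ℝ × ℝ} (hv : v ≠ 0) : 0 < v.1 ^ 2 + v.2 ^ 2 := by
  by_contra h
  have h1 : v.1 = 0 := by nlinarith [sq_nonneg v.1, sq_nonneg v.2]
  have h2 : v.2 = 0 := by nlinarith [sq_nonneg v.1, sq_nonneg v.2]
  exact hv (Prod.ext h1 h2)

/-- The exponential coordinate on the annulus `ℝ² / ℤv`. -/
def ex (v x : ℝ × ℝ) : ℂ := Complex.exp (2 * Real.pi * Complex.I * cx v x)

lemma continuous_ex (v : ℝ × ℝ) : Continuous (ex v) :=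
  Complex.continuous_exp.comp (continuous_const.mul (continuous_cx v))

lemma ex_add_self {v : ℝ × ℝ} (hv : v ≠ 0) (x : ℝ × ℝ) : ex v (x + v) = ex v x := by
  rw [ex, cx_add, cx_self hv, mul_add, mul_one, Complex.exp_add, Complex.exp_two_pi_mul_I, mul_one,
    ex]

lemma norm_ex (v x : ℝ × ℝ) :
    ‖ex v x‖ = Real.exp (-(2 * Real.pi / (v.1 ^ 2 + v.2 ^ 2) * crossDet v x)) := by
  rw [ex, Complex.norm_exp]
  congr 1
  simp [cx_im]
  ring

lemma norm_ex_lt {v x y : ℝ × ℝ} (hv : v ≠ 0) (h : crossDet v y < crossDet v x) :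
    ‖ex v x‖ < ‖ex v y‖ := by
  rw [norm_ex, norm_ex, Real.exp_lt_exp]
  have := sq_add_sq_pos hv
  have : 0 < 2 * Real.pi / (v.1 ^ 2 + v.2 ^ 2) := by have := Real.pi_pos; positivity
  nlinarith

lemma ex_eq_iff {v x y : ℝ × ℝ} (hv : v ≠ 0) : ex v x = ex v y ↔ ∃ n : ℤ, x = y + (n : ℝ) • v := by
  have hpi : (2 * Real.pi * Complex.I : ℂ) ≠ 0 := Complex.two_pi_I_ne_zero
  rw [ex, ex, Complex.exp_eq_exp_iff_exists_int]
  refine exists_congr fun n => ⟨fun h => ?_, fun h => ?_⟩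
  · apply cx_injective hv
    rw [cx_add, cx_smul hv]
    apply mul_left_cancel₀ hpi
    rw [h]; push_cast; ring
  · rw [h, cx_add, cx_smul hv]; push_cast; ring

section sides
variable {C : ℝ → ℝ × ℝ} {L : ℝ} {v : ℝ × ℝ}

/-- The points about which the periodic curve `C` winds once in the annulus. -/
def Rgt (C : ℝ → ℝ × ℝ) (L : ℝ) (v : ℝ × ℝ) : Set (ℝ × ℝ) :=
  {y | ∃ θ : ℝ → ℂ, Continuous θ ∧ (∀ t, Complex.exp (θ t) = ex v (C t) - ex v y) ∧
    ∀ t, θ (t + L) = θ t + 2 * Real.pi * Complex.I}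

/-- The points about which the periodic curve `C` does not wind once in the annulus. -/
def Lft (C : ℝ → ℝ × ℝ) (L : ℝ) (v : ℝ × ℝ) : Set (ℝ × ℝ) :=
  {y | ∃ θ : ℝ → ℂ, Continuous θ ∧ (∀ t, Complex.exp (θ t) = ex v (C t) - ex v y) ∧
    ∀ t, θ (t + L) ≠ θ t + 2 * Real.pi * Complex.I}

lemma rgt_add (hv : v ≠ 0) {y : ℝ × ℝ} : y + v ∈ Rgt C L v ↔ y ∈ Rgt C L v := by
  simp only [Rgt, mem_ofPred_eq, ex_add_self hv]

lemma lft_add (hv : v ≠ 0) {y : ℝ × ℝ} : y + v ∈ Lft C L v ↔ y ∈ Lft C L v := by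
  simp only [Lft, mem_ofPred_eq, ex_add_self hv]

lemma disjoint_sides : Disjoint (Rgt C L v) (Lft C L v) := by
  rw [Set.disjoint_left]
  rintro y ⟨θ, h1, h2, h3⟩ ⟨θ', h1', h2', h3'⟩
  have := log_eq_add_const h1 h1' (fun t => (h2 t).trans (h2' t).symm) (0 + L) 0
  rw [h3 0] at this
  exact h3' 0 (by linear_combination -this)

/-- A curve with `C (t + L) = C t + v`. -/
structure PerCurve (C : ℝ → ℝ × ℝ) (L : ℝ) (v : ℝ × ℝ) : Prop where
  cont : Continuous C
  per : ∀ t, C (t + L) = C t + v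
  ne : v ≠ 0

lemma PerCurve.per_int (hC : PerCurve C L v) (n : ℤ) (t : ℝ) :
    C (t + n * L) = C t + (n : ℝ) • v := by
  have hnat : ∀ (n : ℕ) t, C (t + n * L) = C t + (n : ℝ) • v := fun n => by
    induction n with
    | zero => intro t; simp
    | succ n ih =>
      intro t
      have := hC.per (t + n * L)
      rw [ih t] at this
      rw [show t + ((n + 1 : ℕ) : ℝ) * L = t + n * L + L by push_cast; ring, this]
      push_cast
      module
  obtain ⟨m, rfl | rfl⟩ := n.eq_nat_or_neg
  · exact_mod_cast hnat m t
  · have := hnat m (t + (-(m : ℤ) : ℤ) * L)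
    rw [show t + ((-(m : ℤ) : ℤ) : ℝ) * L + m * L = t by push_cast; ring] at this
    rw [this]; push_cast; module

lemma PerCurve.period_ne (hC : PerCurve C L v) : L ≠ 0 := fun h => hC.ne (by
  have := hC.per 0
  rw [h, add_zero] at this
  simpa using this.symm)

lemma PerCurve.ex_ne (hC : PerCurve C L v) {y : ℝ × ℝ} (hy : y ∉ range C) (t : ℝ) :
    ex v (C t) - ex v y ≠ 0 := fun h => by
  obtain ⟨n, hn⟩ := (ex_eq_iff hC.ne).1 (sub_eq_zero.1 h).symm
  exact hy ⟨t + n * L, by rw [hC.per_int, hn]⟩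

lemma PerCurve.ex_per (hC : PerCurve C L v) (t : ℝ) : ex v (C (t + L)) = ex v (C t) := by
  rw [hC.per, ex_add_self hC.ne]

lemma PerCurve.mem_sides (hC : PerCurve C L v) {y : ℝ × ℝ} (hy : y ∉ range C) :
    y ∈ Rgt C L v ∨ y ∈ Lft C L v := by
  obtain ⟨θ, h1, h2⟩ := exists_log (F := fun t => ex v (C t) - ex v y)
    (((continuous_ex v).comp hC.cont).sub continuous_const) (hC.ex_ne hy)
  have hc := log_eq_add_const (h1.comp (continuous_add_const L)) h1 (fun t => by
    simp only [Function.comp]; rw [h2, h2, hC.ex_per])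
  simp only [Function.comp] at hc
  by_cases h : θ (0 + L) - θ 0 = 2 * Real.pi * Complex.I
  · exact Or.inl ⟨θ, h1, h2, fun t => by linear_combination (hc t 0) + h⟩
  · exact Or.inr ⟨θ, h1, h2, fun t ht => h (by rw [hc 0 t, ht]; ring)⟩

lemma PerCurve.notMem_of_side {y : ℝ × ℝ} (h : y ∈ Rgt C L v ∨ y ∈ Lft C L v) :
    y ∉ range C := by
  rintro ⟨t, rfl⟩
  rcases h with ⟨θ, -, h, -⟩ | ⟨θ, -, h, -⟩ <;>
  · have := h t
    rw [sub_self] at this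
    exact Complex.exp_ne_zero _ this

/-- Logarithms of small perturbations. -/
lemma exists_log_perturb {F G : ℝ → ℂ} (hG : Continuous G) (hFp : ∀ t, F (t + L) = F t)
    (hGp : ∀ t, G (t + L) = G t) (h : ∀ t, ‖G t - F t‖ < ‖F t‖) {θ : ℝ → ℂ} (hθ : Continuous θ)
    (e : ∀ t, Complex.exp (θ t) = F t) : ∃ θ' : ℝ → ℂ, Continuous θ' ∧
      (∀ t, Complex.exp (θ' t) = G t) ∧ ∀ t, θ' (t + L) - θ' t = θ (t + L) - θ t := by
  have hF : Continuous F := by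
    rw [← (funext e : (fun t => Complex.exp (θ t)) = F)]
    exact Complex.continuous_exp.comp hθ
  have h0 : ∀ t, F t ≠ 0 := fun t => by rw [← e]; exact Complex.exp_ne_zero _
  have hs : ∀ t, G t / F t ∈ Complex.slitPlane := fun t => by
    have h1 : ‖G t / F t - 1‖ < 1 := by
      rw [div_sub_one (h0 t), norm_div, div_lt_one (norm_pos_iff.2 (h0 t))]
      exact h t
    have := Complex.mem_slitPlane_of_norm_lt_one h1
    simpa using this
  refine ⟨fun t => θ t + Complex.log (G t / F t),
    hθ.add ((hG.div hF h0).clog hs), fun t => ?_, fun t => ?_⟩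
  · rw [Complex.exp_add, Complex.exp_log (Complex.slitPlane_ne_zero (hs t)), e]
    field_simp [h0 t]
  · simp only [hFp, hGp]; ring

lemma PerCurve.exists_le_norm (hC : PerCurve C L v) {y : ℝ × ℝ} (hy : y ∉ range C) :
    ∃ ε > 0, ∀ t, ε ≤ ‖ex v (C t) - ex v y‖ := by
  have hc : Continuous fun t => ‖ex v (C t) - ex v y‖ :=
    (((continuous_ex v).comp hC.cont).sub continuous_const).norm
  have hp : Function.Periodic (fun t => ‖ex v (C t) - ex v y‖) L := fun t => by
    simp only [hC.ex_per]
  have hcomp := hp.compact_of_continuous hC.period_ne hc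
  obtain ⟨_, ⟨t, rfl⟩, ht⟩ := hcomp.exists_isLeast (range_nonempty _)
  exact ⟨_, norm_pos_iff.2 (hC.ex_ne hy t), fun s => ht ⟨s, rfl⟩⟩

lemma PerCurve.eventually_side (hC : PerCurve C L v) {y : ℝ × ℝ} {θ : ℝ → ℂ} (h1 : Continuous θ)
    (h2 : ∀ t, Complex.exp (θ t) = ex v (C t) - ex v y) :
    ∀ᶠ z in 𝓝 y, ∃ θ' : ℝ → ℂ, Continuous θ' ∧
      (∀ t, Complex.exp (θ' t) = ex v (C t) - ex v z) ∧
      ∀ t, θ' (t + L) - θ' t = θ (t + L) - θ t := by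
  have hy : y ∉ range C := by
    rintro ⟨t, rfl⟩
    have := h2 t
    rw [sub_self] at this
    exact Complex.exp_ne_zero _ this
  obtain ⟨ε, hε, hle⟩ := hC.exists_le_norm hy
  have : ∀ᶠ z in 𝓝 y, Dist.dist (ex v z) (ex v y) < ε :=
    (continuous_ex v).continuousAt.eventually (Metric.ball_mem_nhds _ hε)
  filter_upwards [this] with z hz
  refine exists_log_perturb (L := L) (F := fun t => ex v (C t) - ex v y)
    (G := fun t => ex v (C t) - ex v z) (((continuous_ex v).comp hC.cont).sub continuous_const)
    (fun t => by rw [hC.ex_per]) (fun t => by rw [hC.ex_per]) (fun t => ?_) h1 h2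
  rw [dist_comm, dist_eq_norm] at hz
  refine lt_of_lt_of_le ?_ (hle t)
  simpa using hz

lemma PerCurve.isOpen_rgt (hC : PerCurve C L v) : IsOpen (Rgt C L v) := by
  rw [isOpen_iff_mem_nhds]
  rintro y ⟨θ, h1, h2, h3⟩
  filter_upwards [hC.eventually_side h1 h2] with z ⟨θ', h1', h2', h3'⟩
  exact ⟨θ', h1', h2', fun t => by have := h3' t; rw [h3 t] at this; linear_combination this⟩

lemma PerCurve.isOpen_lft (hC : PerCurve C L v) : IsOpen (Lft C L v) := by
  rw [isOpen_iff_mem_nhds]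
  rintro y ⟨θ, h1, h2, h3⟩
  filter_upwards [hC.eventually_side h1 h2] with z ⟨θ', h1', h2', h3'⟩
  exact ⟨θ', h1', h2', fun t ht => h3 t (by have := h3' t; rw [ht] at this; linear_combination -this)⟩

lemma PerCurve.mem_rgt_of_lt (hC : PerCurve C L v) {y : ℝ × ℝ}
    (h : ∀ t, crossDet v (C t) < crossDet v y) : y ∈ Rgt C L v := by
  obtain ⟨θ, h1, h2, h3⟩ := exists_log_perturb (L := L) (F := fun t => ex v (C t))
    (G := fun t => ex v (C t) - ex v y) (θ := fun t => 2 * Real.pi * Complex.I * cx v (C t))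
    (((continuous_ex v).comp hC.cont).sub continuous_const)
    (fun t => hC.ex_per t) (fun t => by rw [hC.ex_per])
    (fun t => by simpa using norm_ex_lt hC.ne (h t))
    (continuous_const.mul ((continuous_cx v).comp hC.cont)) (fun t => rfl)
  refine ⟨θ, h1, h2, fun t => ?_⟩
  have := h3 t
  rw [hC.per, cx_add, cx_self hC.ne] at this
  linear_combination this

lemma PerCurve.mem_lft_of_lt (hC : PerCurve C L v) {y : ℝ × ℝ}
    (h : ∀ t, crossDet v y < crossDet v (C t)) : y ∈ Lft C L v := by
  obtain ⟨θ, h1, h2, h3⟩ := exists_log_perturb (L := L) (F := fun _ => -ex v y)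
    (G := fun t => ex v (C t) - ex v y)
    (θ := fun _ => 2 * Real.pi * Complex.I * cx v y + Real.pi * Complex.I)
    (((continuous_ex v).comp hC.cont).sub continuous_const)
    (fun t => rfl) (fun t => by rw [hC.ex_per])
    (fun t => by simpa using norm_ex_lt hC.ne (h t))
    continuous_const (fun t => by rw [Complex.exp_add, Complex.exp_pi_mul_I, ex]; ring)
  refine ⟨θ, h1, h2, fun t ht => ?_⟩
  have := h3 t
  rw [ht, sub_self, add_sub_cancel_left] at this
  exact Complex.two_pi_I_ne_zero this

lemma mem_closure_crossDet_lt {y : ℝ × ℝ} (hv : v ≠ 0) :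
    ∀ U ∈ 𝓝 y, (∃ z ∈ U, crossDet v y < crossDet v z) ∧ ∃ z ∈ U, crossDet v z < crossDet v y := by
  intro U hU
  have hc : Continuous fun r : ℝ => y + r • ((-v.2, v.1) : ℝ × ℝ) := by fun_prop
  have h1 : ∀ᶠ r in 𝓝 (0 : ℝ), y + r • ((-v.2, v.1) : ℝ × ℝ) ∈ U :=
    hc.continuousAt.eventually_mem (by simpa using hU)
  obtain ⟨δ, hδ, h⟩ := Metric.eventually_nhds_iff.1 h1
  have h2 := sq_add_sq_pos hv
  refine ⟨⟨_, h (y := δ / 2) (by simp [abs_of_pos hδ]; linarith), ?_⟩,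
    ⟨_, h (y := -(δ / 2)) (by simp [abs_of_pos hδ]; linarith), ?_⟩⟩
  · rw [crossDet_add, crossDet_smul_right, show crossDet v (-v.2, v.1) = v.1 ^ 2 + v.2 ^ 2 by
      simp [crossDet]; ring]
    have : 0 < δ / 2 * (v.1 ^ 2 + v.2 ^ 2) := by positivity
    linarith
  · rw [crossDet_add, crossDet_smul_right, show crossDet v (-v.2, v.1) = v.1 ^ 2 + v.2 ^ 2 by
      simp [crossDet]; ring]
    have : 0 < δ / 2 * (v.1 ^ 2 + v.2 ^ 2) := by positivity
    linarith

lemma PerCurve.mem_rgt_of_le (hC : PerCurve C L v) {y : ℝ × ℝ} (hy : y ∉ range C)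
    (h : ∀ t, crossDet v (C t) ≤ crossDet v y) : y ∈ Rgt C L v := by
  refine (hC.mem_sides hy).resolve_right fun hl => ?_
  obtain ⟨⟨z, hz, hlt⟩, -⟩ := mem_closure_crossDet_lt hC.ne _ (hC.isOpen_lft.mem_nhds hl)
  exact Set.disjoint_left.1 disjoint_sides (hC.mem_rgt_of_lt fun t => (h t).trans_lt hlt) hz

lemma PerCurve.mem_lft_of_le (hC : PerCurve C L v) {y : ℝ × ℝ} (hy : y ∉ range C)
    (h : ∀ t, crossDet v y ≤ crossDet v (C t)) : y ∈ Lft C L v := by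
  refine (hC.mem_sides hy).resolve_left fun hl => ?_
  obtain ⟨-, ⟨z, hz, hlt⟩⟩ := mem_closure_crossDet_lt hC.ne _ (hC.isOpen_rgt.mem_nhds hl)
  exact Set.disjoint_left.1 disjoint_sides hz (hC.mem_lft_of_lt fun t => hlt.trans_le (h t))

lemma PerCurve.subset_side (hC : PerCurve C L v) {K : Set (ℝ × ℝ)} (hK : IsPreconnected K)
    (h : Disjoint K (range C)) : K ⊆ Rgt C L v ∨ K ⊆ Lft C L v := by
  refine isPreconnected_iff_subset_of_disjoint.1 hK _ _ hC.isOpen_rgt hC.isOpen_lft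
    (fun y hy => hC.mem_sides (Set.disjoint_left.1 h hy)) ?_
  rw [disjoint_iff_inter_eq_empty.1 disjoint_sides, inter_empty]

lemma PerCurve.exists_max (hC : PerCurve C L v) :
    ∃ t, ∀ s, crossDet v (C s) ≤ crossDet v (C t) := by
  have hp : Function.Periodic (fun t => crossDet v (C t)) L := fun t => by
    simp only [hC.per, crossDet_add, crossDet_self, add_zero]
  have hcomp := hp.compact_of_continuous hC.period_ne ((continuous_crossDet v).comp hC.cont)
  obtain ⟨_, ⟨t, rfl⟩, ht⟩ := hcomp.exists_isGreatest (range_nonempty _)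
  exact ⟨t, fun s => ht ⟨s, rfl⟩⟩

lemma PerCurve.exists_min (hC : PerCurve C L v) :
    ∃ t, ∀ s, crossDet v (C t) ≤ crossDet v (C s) := by
  have hp : Function.Periodic (fun t => crossDet v (C t)) L := fun t => by
    simp only [hC.per, crossDet_add, crossDet_self, add_zero]
  have hcomp := hp.compact_of_continuous hC.period_ne ((continuous_crossDet v).comp hC.cont)
  obtain ⟨_, ⟨t, rfl⟩, ht⟩ := hcomp.exists_isLeast (range_nonempty _)
  exact ⟨t, fun s => ht ⟨s, rfl⟩⟩

/-- A curve with period `n • e` meets its translate by `e`. -/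
lemma PerCurve.exists_meet_translate (hC : PerCurve C L v) {w : ℝ × ℝ} (hw : crossDet v w = 0) :
    ∃ s t, C s = C t + w := by
  by_contra! hne
  have hC' : PerCurve (fun t => C t + w) L v :=
    ⟨hC.cont.add continuous_const, fun t => by simp only [hC.per]; abel, hC.ne⟩
  have hd : Disjoint (range C) (range fun t => C t + w) := by
    rw [Set.disjoint_left]
    rintro _ ⟨s, rfl⟩ ⟨t, ht⟩
    exact hne s t ht.symm
  obtain ⟨t, ht⟩ := hC.exists_max
  obtain ⟨t', ht'⟩ := hC.exists_min
  have h1 := hC'.mem_rgt_of_le (Set.disjoint_left.1 hd ⟨t, rfl⟩) fun s => by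
    rw [crossDet_add, hw, add_zero]; exact ht s
  have h2 := hC'.mem_lft_of_le (Set.disjoint_left.1 hd ⟨t', rfl⟩) fun s => by
    rw [crossDet_add, hw, add_zero]; exact ht' s
  rcases hC'.subset_side (isPreconnected_range hC.cont) hd with h | h
  · exact Set.disjoint_left.1 disjoint_sides (h ⟨t', rfl⟩) h2
  · exact Set.disjoint_left.1 disjoint_sides h1 (h ⟨t, rfl⟩)

section pairs

variable {C' : ℝ → ℝ × ℝ} {L' : ℝ}

lemma PerCurve.subset_rgt_of_max (hC : PerCurve C L v) (hC' : PerCurve C' L' v)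
    (hd : Disjoint (range C') (range C)) {t : ℝ}
    (h : ∀ s, crossDet v (C s) ≤ crossDet v (C' t)) : range C' ⊆ Rgt C L v :=
  (hC.subset_side (isPreconnected_range hC'.cont) hd).resolve_right fun hl =>
    Set.disjoint_left.1 disjoint_sides
      (hC.mem_rgt_of_le (Set.disjoint_left.1 hd ⟨t, rfl⟩) h) (hl ⟨t, rfl⟩)

lemma PerCurve.subset_lft_of_min (hC : PerCurve C L v) (hC' : PerCurve C' L' v)
    (hd : Disjoint (range C') (range C)) {t : ℝ}
    (h : ∀ s, crossDet v (C' t) ≤ crossDet v (C s)) : range C' ⊆ Lft C L v :=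
  (hC.subset_side (isPreconnected_range hC'.cont) hd).resolve_left fun hl =>
    Set.disjoint_left.1 disjoint_sides (hl ⟨t, rfl⟩)
      (hC.mem_lft_of_le (Set.disjoint_left.1 hd ⟨t, rfl⟩) h)

lemma PerCurve.not_both_rgt (hC : PerCurve C L v) (hC' : PerCurve C' L' v)
    (h : range C' ⊆ Rgt C L v) (h' : range C ⊆ Rgt C' L' v) : False := by
  have hd : Disjoint (range C') (range C) := Set.disjoint_left.2 fun y hy =>
    PerCurve.notMem_of_side (Or.inl (h hy))
  obtain ⟨t, ht⟩ := hC.exists_min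
  obtain ⟨t', ht'⟩ := hC'.exists_min
  rcases le_total (crossDet v (C t)) (crossDet v (C' t')) with hle | hle
  · exact Set.disjoint_left.1 disjoint_sides (h' ⟨t, rfl⟩)
      (hC'.subset_lft_of_min hC hd.symm (fun s => hle.trans (ht' s)) ⟨t, rfl⟩)
  · exact Set.disjoint_left.1 disjoint_sides (h ⟨t', rfl⟩)
      (hC.subset_lft_of_min hC' hd (fun s => hle.trans (ht s)) ⟨t', rfl⟩)

lemma PerCurve.not_both_lft (hC : PerCurve C L v) (hC' : PerCurve C' L' v)
    (h : range C' ⊆ Lft C L v) (h' : range C ⊆ Lft C' L' v) : False := by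
  have hd : Disjoint (range C') (range C) := Set.disjoint_left.2 fun y hy =>
    PerCurve.notMem_of_side (Or.inr (h hy))
  obtain ⟨t, ht⟩ := hC.exists_max
  obtain ⟨t', ht'⟩ := hC'.exists_max
  rcases le_total (crossDet v (C t)) (crossDet v (C' t')) with hle | hle
  · exact Set.disjoint_left.1 disjoint_sides
      (hC.subset_rgt_of_max hC' hd (fun s => (ht s).trans hle) ⟨t', rfl⟩) (h ⟨t', rfl⟩)
  · exact Set.disjoint_left.1 disjoint_sides
      (hC'.subset_rgt_of_max hC hd.symm (fun s => (ht' s).trans hle) ⟨t, rfl⟩) (h' ⟨t, rfl⟩)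

end pairs

end sides

/-! ### Concatenation of curves, and minimal axes -/

namespace TorusMetric
variable {M : TorusMetric}

lemma exists_index {t : ℤ → ℝ} {r : ℝ} (hr : 0 < r) (ht : ∀ k, r ≤ t (k + 1) - t k) (u : ℝ) :
    ∃ k, t k ≤ u ∧ u < t (k + 1) := by
  have hup : ∀ n : ℕ, t 0 + n * r ≤ t n := fun n => by
    induction n with
    | zero => simp
    | succ n ih => have := ht n; push_cast at *; linarith
  have hdn : ∀ n : ℕ, t (-n) ≤ t 0 - n * r := fun n => by
    induction n with
    | zero => simp
    | succ n ih =>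
      have := ht (-(n + 1 : ℕ))
      rw [show (-(n + 1 : ℕ) : ℤ) + 1 = -n by push_cast; ring] at this
      push_cast at *; linarith
  have hmono : StrictMono t := strictMono_int_of_lt_succ fun k => by linarith [ht k]
  obtain ⟨n, hn⟩ := exists_nat_gt ((u - t 0) / r)
  obtain ⟨m, hm⟩ := exists_nat_gt ((t 0 - u) / r)
  rw [div_lt_iff₀ hr] at hn hm
  obtain ⟨k, hk, hk'⟩ := Int.exists_greatest_of_bdd (P := fun k => t k ≤ u)
    ⟨n, fun z hz => by
      by_contra! h
      have := hmono h
      have := hup n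
      linarith⟩ ⟨-m, by have := hdn m; linarith⟩
  refine ⟨k, hk, ?_⟩
  by_contra! h
  have := hk' _ h
  omega

/-- Infinite concatenation of `1`-Lipschitz curves. -/
lemma exists_concat {t : ℤ → ℝ} {r : ℝ} (hr : 0 < r) (ht : ∀ k, r ≤ t (k + 1) - t k)
    {c : ℤ → ℝ → ℝ × ℝ} (hc : ∀ k, M.ULip (c k)) (he : ∀ k, c k (t (k + 1)) = c (k + 1) (t (k + 1))) :
    ∃ γ, M.ULip γ ∧ ∀ k u, t k ≤ u → u ≤ t (k + 1) → γ u = c k u := by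
  have hmono : StrictMono t := strictMono_int_of_lt_succ fun k => by linarith [ht k]
  choose i hi hi' using exists_index hr ht
  have key : ∀ k u, t k ≤ u → u ≤ t (k + 1) → c (i u) u = c k u := fun k u h1 h2 => by
    have a1 : k < i u + 1 := hmono.lt_iff_lt.1 (h1.trans_lt (hi' u))
    have a2 : i u ≤ k + 1 := hmono.le_iff_le.1 ((hi u).trans h2)
    rcases (show i u = k ∨ i u = k + 1 by omega) with h | h
    · rw [h]
    · have : u = t (k + 1) := le_antisymm h2 (h ▸ hi u)
      rw [h, this, he]
  refine ⟨fun u => c (i u) u, ?_, key⟩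
  have step : ∀ u, ∀ m : ℤ, i u + 1 ≤ m → M.dist (c (i u) u) (c (i (t m)) (t m)) ≤ t m - u := by
    intro u m hm
    induction m, hm using Int.leInduction with
    | base =>
      rw [key (i u) _ (hmono.monotone (by omega)) le_rfl]
      exact hc _ _ _ (hi' u).le
    | succ m hm ih =>
      have h1 := M.dist_triangle (c (i u) u) (c (i (t m)) (t m)) (c (i (t (m + 1))) (t (m + 1)))
      rw [key m (t (m + 1)) (hmono.monotone (by omega)) le_rfl,
        key m (t m) le_rfl (hmono.monotone (by omega))] at h1
      rw [key m (t m) le_rfl (hmono.monotone (by omega))] at ih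
      rw [key m (t (m + 1)) (hmono.monotone (by omega)) le_rfl]
      have h2 := hc m (t m) (t (m + 1)) (hmono.monotone (by omega))
      linarith
  intro u v huv
  have hle : i u ≤ i v := by
    have : i u < i v + 1 := hmono.lt_iff_lt.1 ((hi u).trans_lt (huv.trans_lt (hi' v)))
    omega
  rcases hle.eq_or_lt with h | h
  · simp only [← h]; exact hc _ _ _ huv
  · have h1 := step u (i v) (by omega)
    have h2 := M.dist_triangle (c (i u) u) (c (i (t (i v))) (t (i v))) (c (i v) v)
    rw [key (i v) (t (i v)) le_rfl (hmono.monotone (by omega))] at h1 h2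
    have h3 := hc (i v) _ _ (hi v)
    linarith

/-- Periodic extension of a `1`-Lipschitz curve. -/
lemma exists_periodic_ext {c : ℝ → ℝ × ℝ} (hc : M.ULip c) {T : ℝ} (hT : 0 < T) {k : ℤ × ℤ}
    (h : c T = c 0 + lat k) :
    ∃ γ, M.ULip γ ∧ (∀ u, 0 ≤ u → u ≤ T → γ u = c u) ∧ ∀ u, γ (u + T) = γ u + lat k := by
  obtain ⟨γ, h1, h2⟩ := exists_concat (t := fun n : ℤ => n * T) hT
    (fun n => le_of_eq (by push_cast; ring))
    (c := fun n u => c (u + -(n * T)) + lat (n • k)) (fun n => hc.comp_add _ _) (fun n => by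
      rw [show ((n + 1 : ℤ) : ℝ) * T + -(n * T) = T by push_cast; ring,
        show ((n + 1 : ℤ) : ℝ) * T + -((n + 1 : ℤ) * T) = 0 by ring, h, add_zsmul, one_zsmul, lat_add]
      abel)
  refine ⟨γ, h1, fun u hu hu' => ?_, fun u => ?_⟩
  · rw [h2 0 u (by simpa) (by simpa)]
    simp [lat_zero]
  · obtain ⟨n, hn, hn'⟩ := exists_index (t := fun n : ℤ => n * T) hT
      (fun n => le_of_eq (by push_cast; ring)) u
    push_cast at hn hn'
    rw [h2 n u hn (by push_cast; exact hn'.le),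
      h2 (n + 1) (u + T) (by push_cast; linarith) (by push_cast; linarith),
      show u + T + -((n + 1 : ℤ) * T) = u + -(n * T) by push_cast; ring, add_zsmul, one_zsmul, lat_add]
    abel

/-- Chains of minimal segments. -/
lemma exists_chain {Y : ℤ → ℝ × ℝ} {t : ℤ → ℝ} {r : ℝ} (hr : 0 < r)
    (ht : ∀ k, t (k + 1) - t k = M.dist (Y k) (Y (k + 1))) (hY : ∀ k, r ≤ M.dist (Y k) (Y (k + 1))) :
    ∃ γ, M.ULip γ ∧ ∀ k, γ (t k) = Y k := by
  choose c h1 h2 h3 using fun k => M.exists_segment (Y k) (Y (k + 1))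
  obtain ⟨γ, hγ, hγ'⟩ := exists_concat (t := t) hr (fun k => (hY k).trans_eq (ht k).symm)
    (c := fun k u => c k (u + -t k) + lat 0) (fun k => (h1 k).comp_add _ _) (fun k => by
      rw [← sub_eq_add_neg, ht, h3, add_neg_cancel, h2])
  refine ⟨γ, hγ, fun k => ?_⟩
  rw [hγ' k (t k) le_rfl (by linarith [hY k, ht k]), add_neg_cancel, h2, lat_zero, add_zero]

/-- Minimal axes of the translation `k`, of translation length `ℓ`. -/
structure Ax (M : TorusMetric) (k : ℤ × ℤ) (ℓ : ℝ) (γ : ℝ → ℝ × ℝ) : Prop where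
  line : M.IsLine γ
  per : ∀ t, γ (t + ℓ) = γ t + lat k

namespace Ax
variable {k : ℤ × ℤ} {ℓ : ℝ} {γ γ' : ℝ → ℝ × ℝ}

lemma per_int (h : M.Ax k ℓ γ) (n : ℤ) (t : ℝ) : γ (t + n * ℓ) = γ t + lat (n • k) := by
  induction n using Int.induction_on generalizing t with
  | zero => simp [lat_zero]
  | succ n ih =>
    push_cast at ih ⊢
    rw [show t + ((n : ℝ) + 1) * ℓ = t + n * ℓ + ℓ by ring, h.per, ih, add_zsmul, lat_add, one_zsmul,
      add_assoc]
  | pred n ih =>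
    have := h.per (t + (-(n : ℝ) - 1) * ℓ)
    push_cast at ih ⊢
    rw [show t + (-(n : ℝ) - 1) * ℓ + ℓ = t + -(n : ℝ) * ℓ by ring, ih] at this
    rw [eq_sub_of_add_eq this.symm, sub_zsmul, one_zsmul, sub_eq_add_neg, lat_add,
      lat_neg, add_assoc]

lemma comp_add (h : M.Ax k ℓ γ) (r : ℝ) (j : ℤ × ℤ) : M.Ax k ℓ fun t => γ (t + r) + lat j :=
  ⟨h.line.comp_add r j, fun t => by
    rw [show t + ℓ + r = t + r + ℓ by ring, h.per]; abel⟩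

lemma ne_zero (h : M.Ax k ℓ γ) (hℓ : 0 < ℓ) : lat k ≠ 0 := fun h0 => by
  have h1 := h.line 0 (0 + ℓ) (by linarith)
  rw [h.per, h0, add_zero, M.dist_self] at h1
  linarith

lemma perCurve (h : M.Ax k ℓ γ) (hℓ : 0 < ℓ) : PerCurve γ ℓ (lat k) :=
  ⟨h.line.uLip.continuous, h.per, h.ne_zero hℓ⟩

lemma dist_add (h : M.Ax k ℓ γ) (hℓ : 0 < ℓ) (n : ℕ) (t : ℝ) :
    M.dist (γ t) (γ t + lat ((n : ℤ) • k)) = n * ℓ := by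
  have h1 := h.line t (t + n * ℓ) (by have : 0 ≤ (n : ℝ) * ℓ := by positivity
                                      linarith)
  have h2 := h.per_int n t
  push_cast at h2
  rw [← h2, h1]; ring

lemma le_dist_nat (h : M.Ax k ℓ γ) (hℓ : 0 < ℓ) (n : ℕ) (x : ℝ × ℝ) :
    n * ℓ ≤ M.dist x (x + lat ((n : ℤ) • k)) := by
  set D := M.dist x (x + lat ((n : ℤ) • k)) with hD
  have hN : ∀ N : ℕ, M.dist x (x + lat (((N * n : ℕ) : ℤ) • k)) ≤ N * D := fun N => by
    induction N with
    | zero => simp [lat_zero, M.dist_self]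
    | succ N ih =>
      have h1 := M.dist_triangle x (x + lat (((N * n : ℕ) : ℤ) • k))
        (x + lat (((N * n : ℕ) : ℤ) • k) + lat ((n : ℤ) • k))
      have h2 : M.dist (x + lat (((N * n : ℕ) : ℤ) • k))
        (x + lat (((N * n : ℕ) : ℤ) • k) + lat ((n : ℤ) • k)) = D := by
        rw [add_right_comm, M.dist_add_lat]
      rw [h2, add_assoc, ← lat_add, ← add_zsmul] at h1
      have h3 : (((N * n : ℕ) : ℤ) + (n : ℤ)) = (((N + 1) * n : ℕ) : ℤ) := by push_cast; ring
      rw [h3] at h1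
      push_cast at *
      linarith
  have hA : ∀ N : ℕ, N * (n * ℓ - D) ≤ 2 * M.dist (γ 0) x := fun N => by
    have h1 := h.dist_add hℓ (N * n) 0
    have h2 := M.dist_triangle (γ 0) x (γ 0 + lat (((N * n : ℕ) : ℤ) • k))
    have h3 := M.dist_triangle x (x + lat (((N * n : ℕ) : ℤ) • k)) (γ 0 + lat (((N * n : ℕ) : ℤ) • k))
    rw [M.dist_add_lat, M.dist_comm x (γ 0)] at h3
    have h4 := hN N
    rw [h1] at h2
    push_cast at *
    linarith
  by_contra! hlt
  obtain ⟨N, hN'⟩ := exists_nat_gt (2 * M.dist (γ 0) x / (n * ℓ - D))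
  rw [div_lt_iff₀ (by linarith)] at hN'
  linarith [hA N]

lemma le_dist (h : M.Ax k ℓ γ) (hℓ : 0 < ℓ) (n : ℤ) (x : ℝ × ℝ) :
    |(n : ℝ)| * ℓ ≤ M.dist x (x + lat (n • k)) := by
  rcases le_total 0 n with hn | hn
  · obtain ⟨m, rfl⟩ := Int.eq_ofNat_of_zero_le hn
    simpa using h.le_dist_nat hℓ m x
  · obtain ⟨m, hm⟩ := Int.eq_ofNat_of_zero_le (neg_nonneg.2 hn)
    have h1 := h.le_dist_nat hℓ m (x + lat (n • k))
    rw [add_assoc, ← lat_add, ← add_zsmul, ← hm, add_neg_cancel, zero_zsmul, lat_zero, add_zero,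
      M.dist_comm] at h1
    have : (m : ℝ) = -n := by exact_mod_cast hm.symm
    rw [this] at h1
    rwa [abs_of_nonpos (by exact_mod_cast hn)]

/-- A `1`-Lipschitz curve with points `b`, `b + n k` at parameters `0`, `n ℓ` is a line. -/
lemma isLine_of_uLip (h : M.Ax k ℓ γ) (hℓ : 0 < ℓ) {c : ℝ → ℝ × ℝ} (hc : M.ULip c)
    (hs : ∃ s₀ : ℝ, ∀ s, ∃ a b : ℝ, ∃ n : ℕ, a ≤ s₀ - s ∧ s₀ + s ≤ b ∧ b - a ≤ n * ℓ ∧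
      c b = c a + lat ((n : ℤ) • k)) : M.IsLine c := by
  intro u v huv
  obtain ⟨s₀, hs⟩ := hs
  obtain ⟨a, b, n, ha, hb, hab, he⟩ := hs (max |u - s₀| |v - s₀|)
  have h1 := h.le_dist_nat hℓ n (c a)
  rw [← he] at h1
  have h2 := (le_max_left |u - s₀| |v - s₀|)
  have h3 := (le_max_right |u - s₀| |v - s₀|)
  refine hc.isoOn (a := a) (b := b) (by linarith) u v ?_ huv ?_
  · linarith [neg_abs_le (u - s₀)]
  · linarith [le_abs_self (v - s₀)]

/-- Through every point displaced by the minimal amount there is an axis. -/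
lemma exists_through (h : M.Ax k ℓ γ) (hℓ : 0 < ℓ) {b : ℝ × ℝ} (hb : M.dist b (b + lat k) ≤ ℓ) :
    ∃ β, M.Ax k ℓ β ∧ β 0 = b := by
  have hb' : M.dist b (b + lat k) = ℓ := le_antisymm hb (by simpa using h.le_dist hℓ 1 b)
  obtain ⟨c, h1, h2, h3⟩ := M.exists_segment b (b + lat k)
  rw [hb'] at h3
  obtain ⟨β, hβ, hβc, hper⟩ := exists_periodic_ext h1 hℓ (k := k) (by rw [h3, h2])
  have h0 : β 0 = b := by rw [hβc 0 le_rfl hℓ.le, h2]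
  have hpi : ∀ n : ℕ, ∀ t, β (t + n * ℓ) = β t + lat ((n : ℤ) • k) := fun n => by
    induction n with
    | zero => simp [lat_zero]
    | succ n ih =>
      intro t
      push_cast
      rw [show t + ((n : ℝ) + 1) * ℓ = t + n * ℓ + ℓ by ring, hper, ih, add_zsmul, one_zsmul, lat_add,
        add_assoc]
  refine ⟨β, ⟨h.isLine_of_uLip hℓ hβ ⟨0, fun s => ?_⟩, hper⟩, h0⟩
  obtain ⟨n, hn⟩ := exists_nat_gt (s / ℓ)
  rw [div_lt_iff₀ hℓ] at hn
  refine ⟨-(n * ℓ), n * ℓ, 2 * n, by linarith, by linarith, by push_cast; linarith, ?_⟩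
  have := hpi (2 * n) (-(n * ℓ))
  rw [← this]; congr 1; push_cast; ring

/-- Axes which meet coincide up to the parameter. -/
lemma eq_of_meet (h : M.Ax k ℓ γ) (h' : M.Ax k ℓ γ') (hℓ : 0 < ℓ) {s s' : ℝ} (e : γ s = γ' s')
    (t : ℝ) : γ t = γ' (t + (s' - s)) := by
  have hm : M.Ax k ℓ fun t => γ' (t + (s' - s)) := by simpa [lat_zero] using h'.comp_add (s' - s) 0
  have e' : γ s = (fun t => γ' (t + (s' - s))) s := by simp [e]
  generalize hg : (fun t => γ' (t + (s' - s))) = g at hm e'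
  suffices γ = g by rw [this, ← hg]
  set c := fun t => if t ≤ s then γ t else g t with hc
  have hcl : M.IsLine c := by
    refine h.isLine_of_uLip hℓ (h.line.uLip.glue hm.line.uLip e') ⟨s, fun u => ?_⟩
    obtain ⟨n, hn⟩ := exists_nat_gt (|u| / ℓ)
    rw [div_lt_iff₀ hℓ] at hn
    have hn0 : 0 < n * ℓ := (abs_nonneg u).trans_lt hn
    refine ⟨s - n * ℓ, s + n * ℓ, 2 * n, by linarith [le_abs_self u], by linarith [le_abs_self u],
      by push_cast; linarith, ?_⟩
    simp only [hc]
    rw [if_neg (by linarith), if_pos (by linarith)]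
    have h1 := hm.per_int n s
    have h2 := h.per_int (-n) s
    push_cast at h1 h2
    rw [h1, ← e', show s - n * ℓ = s + -n * ℓ by ring, h2, add_assoc, ← lat_add, ← add_zsmul]
    congr 3
    push_cast; ring
  have h1 : c = γ := hcl.locIso.eq_of_eqOn h.line.locIso (a := s - 1) (b := s) (by linarith)
    fun t ht => if_pos ht.2.le
  have h2 : c = g := hcl.locIso.eq_of_eqOn hm.line.locIso (a := s) (b := s + 1) (by linarith)
    fun t ht => if_neg (not_le.2 ht.1)
  rw [← h1, h2]

lemma disjoint_or (h : M.Ax k ℓ γ) (h' : M.Ax k ℓ γ') (hℓ : 0 < ℓ) :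
    Disjoint (range γ) (range γ') ∨ range γ = range γ' := by
  by_cases hd : Disjoint (range γ) (range γ')
  · exact Or.inl hd
  right
  rw [Set.not_disjoint_iff] at hd
  obtain ⟨_, ⟨s, rfl⟩, ⟨s', hs'⟩⟩ := hd
  have := h.eq_of_meet h' hℓ hs'.symm
  refine Subset.antisymm ?_ ?_
  · rintro _ ⟨t, rfl⟩; exact ⟨_, (this t).symm⟩
  · rintro _ ⟨t, rfl⟩; exact ⟨t - (s' - s), by rw [this]; congr 1; ring⟩

/-- A minimal segment whose endpoints are on an axis is contained in the axis. -/
lemma mem_range_of_isoOn (h : M.Ax k ℓ γ) {c : ℝ → ℝ × ℝ} {a b : ℝ}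
    (hc : M.IsoOn c a b) {s t : ℝ} (ha : c a = γ s) (hb : c b = γ t) {u : ℝ} (hau : a ≤ u)
    (hub : u ≤ b) : c u ∈ range γ := by
  wlog hst : s ≤ t generalizing c a b s t u
  · have := this (c := fun u => c (a + b - u)) (a := a) (b := b) (s := t) (t := s) (u := a + b - u)
      (fun p q hp hpq hq => by
        rw [M.dist_comm, hc _ _ (by linarith) (by linarith) (by linarith)]; ring)
      (by simpa using hb) (by simpa using ha) (by linarith) (by linarith) (by linarith)
    simpa using this
  have hd : b - a = t - s := by
    rw [← hc a b le_rfl (hau.trans hub) le_rfl, ha, hb, h.line s t hst]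
  rcases (hau.trans hub).eq_or_lt with hab | hab
  · have : u = a := le_antisymm (hab ▸ hub) hau
    rw [this, ha]; exact ⟨s, rfl⟩
  -- parametrize by the parameter of `γ`
  set c₀ := fun v => c (max a (min v b)) with hc₀
  have hg : M.ULip c₀ := hc.uLip_clamp hab.le
  have hγl : M.IsLine fun v => γ (v + (s - a)) := h.line.comp_add' _
  set g := fun v => γ (v + (s - a)) with hgdef
  have e1 : g a = c₀ a := by simp [hgdef, hc₀, ha, hab.le]
  have e2 : c₀ b = g b := by
    simp only [hgdef, hc₀, min_self, max_eq_right hab.le, hb]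
    congr 1; linarith
  have hgl := (hγl.uLip.glue hg e1)
  have e3 : (fun v => if v ≤ a then g v else c₀ v) b = g b := by simp [e2]
  have hG := hgl.glue hγl.uLip e3
  set G := fun v => if v ≤ b then (fun v => if v ≤ a then g v else c₀ v) v else g v with hGdef
  have hGl : M.IsLine G := by
    intro p q hpq
    refine hG.isoOn (a := min p a) (b := max q (b + 1)) ?_ p q (min_le_left _ _) hpq
      (le_max_left _ _)
    have e4 : G (min p a) = g (min p a) := by
      simp [hGdef, hab.le]
    have e5 : G (max q (b + 1)) = g (max q (b + 1)) := by
      have : ¬ max q (b + 1) ≤ b := not_le.2 (by linarith [le_max_right q (b + 1)])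
      simp only [hGdef, if_neg this]
    rw [e4, e5, hγl]
    linarith [min_le_right p a, le_max_right q (b + 1)]
  have hGg : G = g := hGl.locIso.eq_of_eqOn hγl.locIso (a := a - 1) (b := a) (by linarith)
    fun v hv => by simp [hGdef, hv.2.le, (hv.2.le.trans hab.le)]
  have := congrFun hGg u
  rcases hau.eq_or_lt with rfl | hau
  · rw [ha]; exact ⟨s, rfl⟩
  · simp only [hGdef, if_pos hub, if_neg (not_le.2 hau), hc₀, min_eq_left hub, max_eq_right hau.le]
      at this
    rw [this]; exact ⟨_, rfl⟩

end Ax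

end TorusMetric

/-! ### Extremal axes, and detection of intersections -/

namespace TorusMetric
variable {M : TorusMetric}

lemma Ax.of_limit {k : ℤ × ℤ} {ℓ : ℝ} {u : ℕ → ℝ → ℝ × ℝ} (hu : ∀ n, M.Ax k ℓ (u n))
    {γ : ℝ → ℝ × ℝ} (hγ : M.ULip γ) (hl : ∀ t, Tendsto (fun n => u n t) ulim (𝓝 (γ t))) :
    M.Ax k ℓ γ := by
  refine ⟨M.isLine_of_limit hγ hl (κ := fun _ => 0) tendsto_const_nhds fun s t hst =>
    Eventually.of_forall fun n => by rw [(hu n).line s t hst, add_zero], fun t => ?_⟩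
  refine tendsto_nhds_unique (hl (t + ℓ)) ?_
  simp only [(hu _).per]
  exact (hl t).add_const _

lemma isLine_of_limit_line {u : ℕ → ℝ → ℝ × ℝ} (hu : ∀ n, M.IsLine (u n))
    {γ : ℝ → ℝ × ℝ} (hγ : M.ULip γ) (hl : ∀ t, Tendsto (fun n => u n t) ulim (𝓝 (γ t))) :
    M.IsLine γ :=
  M.isLine_of_limit hγ hl (κ := fun _ => 0) tendsto_const_nhds fun s t hst =>
    Eventually.of_forall fun n => by rw [hu n s t hst, add_zero]

lemma Ax.exists_mem_Icc {k : ℤ × ℤ} {ℓ : ℝ} {γ : ℝ → ℝ × ℝ} (h : M.Ax k ℓ γ) (hℓ : 0 < ℓ)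
    (t : ℝ) : ∃ n : ℤ, ∃ r ∈ Icc 0 ℓ, γ t = γ r + lat (n • k) := by
  obtain ⟨n, hn, hn'⟩ := exists_index (t := fun n : ℤ => n * ℓ) hℓ
    (fun n => le_of_eq (by push_cast; ring)) t
  push_cast at hn hn'
  refine ⟨n, t - n * ℓ, ⟨by linarith, by linarith⟩, ?_⟩
  rw [← h.per_int]; congr 1; ring

/-- Among the axes meeting a compact set there is one which is extremal for a given
invariant function. -/
lemma Ax.exists_extremal {k : ℤ × ℤ} {ℓ : ℝ} {α : ℝ → ℝ × ℝ} (hα : M.Ax k ℓ α) (hℓ : 0 < ℓ)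
    {K : Set (ℝ × ℝ)} (hK : IsCompact K) {s : ℝ} (hs : α s ∈ K) {φ : ℝ × ℝ → ℝ}
    (hφ : Continuous φ) (hφp : ∀ n : ℤ, ∀ x, φ (x + lat (n • k)) = φ x) :
    ∃ β, M.Ax k ℓ β ∧ β 0 ∈ K ∧ ∃ t, ∀ γ, M.Ax k ℓ γ → (∃ s, γ s ∈ K) → ∀ u, φ (γ u) ≤ φ (β t) := by
  set V := {y | ∃ γ, M.Ax k ℓ γ ∧ γ 0 ∈ K ∧ ∃ t ∈ Icc 0 ℓ, φ (γ t) = y} with hV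
  obtain ⟨C, hC⟩ := hK.isBounded.exists_norm_le
  have hbd : BddAbove V := by
    obtain ⟨B, hB⟩ := (isCompact_closedBall (0 : ℝ × ℝ) (C + ℓ / M.lo)).bddAbove_image hφ.continuousOn
    refine ⟨B, ?_⟩
    rintro _ ⟨γ, hγ, h0, t, ht, rfl⟩
    refine hB ⟨_, ?_, rfl⟩
    rw [mem_closedBall_zero_iff]
    have h1 := hγ.line.uLip.norm_le 0 t
    rw [sub_zero, abs_of_nonneg ht.1] at h1
    have h2 := norm_le_norm_add_norm_sub' (γ t) (γ 0)
    have h3 : t / M.lo ≤ ℓ / M.lo := div_le_div_of_nonneg_right ht.2 M.lo_pos.le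
    linarith [hC _ h0]
  have mem : ∀ γ, M.Ax k ℓ γ → (∃ s, γ s ∈ K) → ∀ u, φ (γ u) ∈ V := by
    rintro γ hγ ⟨r, hr⟩ u
    have h' : M.Ax k ℓ fun t => γ (t + r) := by simpa [lat_zero] using hγ.comp_add r 0
    obtain ⟨n, q, hq, e⟩ := h'.exists_mem_Icc hℓ (u - r)
    rw [sub_add_cancel] at e
    exact ⟨_, h', by simpa using hr, q, hq, by rw [e, hφp]⟩
  have hne : V.Nonempty := ⟨_, mem α hα ⟨s, hs⟩ 0⟩
  have : ∀ n : ℕ, ∃ γ, M.Ax k ℓ γ ∧ γ 0 ∈ K ∧ ∃ t ∈ Icc 0 ℓ, sSup V - 1 / ((n : ℝ) + 1) < φ (γ t) := by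
    intro n
    obtain ⟨_, ⟨γ, h1, h2, t, ht, rfl⟩, h3⟩ := exists_lt_of_lt_csSup hne
      (show sSup V - 1 / ((n : ℝ) + 1) < sSup V by
        have : 0 < 1 / ((n : ℝ) + 1) := by positivity
        linarith)
    exact ⟨γ, h1, h2, t, ht, h3⟩
  choose u hu hu0 t ht hlt using this
  obtain ⟨β, hβ, hl⟩ := M.exists_limit (fun n => (hu n).line.uLip) fun n => hC _ (hu0 n)
  obtain ⟨r, hr, hrt⟩ := exists_tendsto_of_isCompact isCompact_Icc (Eventually.of_forall ht)
  refine ⟨β, Ax.of_limit hu hβ hl, hK.isClosed.mem_of_tendsto (hl 0) (Eventually.of_forall hu0), r,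
    fun γ hγ hm v => (le_csSup hbd (mem γ hγ hm v)).trans ?_⟩
  have h1 := (hφ.tendsto _).comp (M.tendsto_moving (fun n => (hu n).line.uLip) hl hrt)
  have h2 := (tendsto_const_nhds (x := sSup V)).sub tendsto_one_div_ulim
  rw [sub_zero] at h2
  exact le_of_tendsto_of_tendsto h2 h1 (Eventually.of_forall fun n => (hlt n).le)

lemma exists_smul_of_crossDet {v w : ℝ × ℝ} (hv : v ≠ 0) (h : crossDet v w = 0) :
    ∃ r : ℝ, w = r • v := by
  have h2 := sq_add_sq_pos hv
  refine ⟨(v.1 * w.1 + v.2 * w.2) / (v.1 ^ 2 + v.2 ^ 2), ?_⟩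
  simp only [crossDet] at h
  ext
  · simp only [Prod.smul_fst, smul_eq_mul]
    field_simp
    linear_combination (-v.2) * h
  · simp only [Prod.smul_snd, smul_eq_mul]
    field_simp
    linear_combination v.1 * h

/-- The linear map `(σ, t) ↦ σ v - t w`. -/
def diffMap (v w : ℝ × ℝ) : ℝ × ℝ →L[ℝ] ℝ × ℝ :=
  (ContinuousLinearMap.fst ℝ ℝ ℝ).smulRight v - (ContinuousLinearMap.snd ℝ ℝ ℝ).smulRight w

lemma diffMap_apply (v w x : ℝ × ℝ) : diffMap v w x = x.1 • v - x.2 • w := rfl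

lemma diffMap_range {v w : ℝ × ℝ} (h : crossDet v w ≠ 0) : (diffMap v w).range = ⊤ := by
  rw [LinearMap.range_eq_top]
  intro y
  refine ⟨(crossDet y w / crossDet v w, crossDet y v / crossDet v w), ?_⟩
  change diffMap v w _ = y
  rw [diffMap_apply]
  simp only [crossDet] at *
  ext <;> simp only [Prod.smul_fst, Prod.smul_snd, Prod.fst_sub, Prod.snd_sub, smul_eq_mul] <;>
    rw [div_mul_eq_mul_div, div_mul_eq_mul_div, ← sub_div, div_eq_iff h] <;> ring

lemma LocIso.norm_sub_sub_le {γ : ℝ → ℝ × ℝ} (h : M.LocIso γ) {K : ℝ} (hK : 0 ≤ K)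
    (hL : ∀ s t, ‖deriv γ t - deriv γ s‖ ≤ K * |t - s|) (p : ℝ) {r u v : ℝ} (hu : |u| ≤ r)
    (hv : |v| ≤ r) : ‖γ (p + u) - γ (p + v) - (u - v) • deriv γ p‖ ≤ K * r * |u - v| := by
  have h1 : ∀ x ∈ Icc (-r) r, HasDerivWithinAt (fun x => γ (p + x) - x • deriv γ p)
      (deriv γ (p + x) - (1 : ℝ) • deriv γ p) (Icc (-r) r) x := fun x _ =>
    (((h.hasDerivAt (p + x)).comp_const_add p x).sub
      ((hasDerivAt_id x).smul_const (deriv γ p))).hasDerivWithinAt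
  have h2 := (convex_Icc (-r) r).norm_image_sub_le_of_norm_hasDerivWithin_le (C := K * r) h1
    (fun x hx => by
      rw [one_smul]
      refine (hL _ _).trans (mul_le_mul_of_nonneg_left ?_ hK)
      rw [add_sub_cancel_left]; exact abs_le.2 hx) (abs_le.1 hv) (abs_le.1 hu)
  rw [Real.norm_eq_abs] at h2
  rwa [show γ (p + u) - γ (p + v) - (u - v) • deriv γ p =
    γ (p + u) - u • deriv γ p - (γ (p + v) - v • deriv γ p) by rw [sub_smul]; abel]

/-- If the curves `u n` converge to a line crossing `c` transversally then they meet `c`. -/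
lemma eventually_meet {c γ : ℝ → ℝ × ℝ} (hc : M.LocIso c) {u : ℕ → ℝ → ℝ × ℝ}
    (hu : ∀ n, M.IsLine (u n)) (hl : ∀ t, Tendsto (fun n => u n t) ulim (𝓝 (γ t)))
    {s : ℝ} (hs : γ 0 = c s) (ht : crossDet (deriv c s) (deriv γ 0) ≠ 0) {δ : ℝ} (hδ : 0 < δ) :
    ∀ᶠ n in ulim, ∃ σ t, |σ| ≤ δ ∧ c (s + σ) = u n t := by
  obtain ⟨K, hK, hL⟩ := M.exists_deriv_lipschitz
  obtain ⟨w, hw⟩ := exists_tendsto_of_norm_le (u := fun n => deriv (u n) 0) (C := 1 / M.lo)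
    (Eventually.of_forall fun n => (hu n).locIso.norm_deriv_le 0)
  have hwγ : w = deriv γ 0 := by
    have h1 : ∀ t : ℝ, ‖γ t - γ 0 - t • w‖ ≤ K * |t| * |t| := fun t => by
      have h2 : Tendsto (fun n => ‖u n t - u n 0 - t • deriv (u n) 0‖) ulim
          (𝓝 ‖γ t - γ 0 - t • w‖) := (((hl t).sub (hl 0)).sub (hw.const_smul t)).norm
      refine le_of_tendsto h2 (Eventually.of_forall fun n => ?_)
      have := (hu n).locIso.norm_sub_sub_le hK (hL _ (hu n).locIso) 0 (r := |t|) (u := t) (v := 0)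
        le_rfl (by simp)
      simpa using this
    have h3 : HasDerivAt γ w 0 := by
      rw [hasDerivAt_iff_isLittleO_nhds_zero]
      simp only [zero_add]
      refine Asymptotics.IsBigO.trans_isLittleO (g := fun t : ℝ => |t| * |t|) ?_ ?_
      · exact Asymptotics.IsBigO.of_bound K (Eventually.of_forall fun t => by
          rw [Real.norm_eq_abs, abs_mul, abs_abs, ← mul_assoc]; exact h1 t)
      · simp only [abs_mul_abs_self]
        simpa [pow_two] using Asymptotics.isLittleO_pow_id (𝕜 := ℝ) one_lt_two
    exact h3.deriv.symm
  have hR := diffMap_range ht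
  set A := diffMap (deriv c s) (deriv γ 0) with hA
  set B := A.nonlinearRightInverseOfSurjective hR
  have hBpos : 0 < B.nnnorm := A.nonlinearRightInverseOfSurjective_nnnorm_pos hR
  obtain ⟨c0, hc0, hc0B⟩ : ∃ c0 : NNReal, 0 < c0 ∧ (c0 : ℝ) < (B.nnnorm : ℝ)⁻¹ :=
    ⟨B.nnnorm⁻¹ / 2, by positivity, by push_cast; exact half_lt_self (by positivity)⟩
  have hc0' : (0 : ℝ) < c0 := hc0
  obtain ⟨r, hr, hrδ, hrK⟩ : ∃ r > 0, r ≤ δ ∧ 2 * K * r ≤ c0 / 2 := by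
    refine ⟨min δ (c0 / 2 / (2 * K + 1)), lt_min hδ (by positivity), min_le_left _ _, ?_⟩
    have h1 := min_le_right δ (c0 / 2 / (2 * K + 1))
    rw [le_div_iff₀ (by positivity)] at h1
    have h2 : 0 ≤ min δ (c0 / 2 / (2 * K + 1)) := le_min hδ.le (by positivity)
    nlinarith
  have e1 : ∀ᶠ n in ulim, ‖deriv (u n) 0 - deriv γ 0‖ ≤ c0 / 2 := by
    have := ((hw.sub_const (deriv γ 0)).norm)
    rw [hwγ, sub_self, norm_zero] at this
    exact (this.eventually_lt_const (half_pos hc0')).mono fun n hn => hn.le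
  have e2 : ∀ᶠ n in ulim, ‖c s - u n 0‖ ≤ ((B.nnnorm : ℝ)⁻¹ - c0) * r := by
    have := ((hl 0).const_sub (c s)).norm
    rw [hs, sub_self, norm_zero] at this
    exact (this.eventually_lt_const (mul_pos (sub_pos.2 hc0B) hr)).mono fun n hn => hn.le
  filter_upwards [e1, e2] with n hn1 hn2
  have happ : ApproximatesLinearOn (fun x : ℝ × ℝ => c (s + x.1) - u n x.2) A
      (Metric.closedBall (0 : ℝ × ℝ) r) c0 := by
    intro x hx y hy
    rw [mem_closedBall_zero_iff] at hx hy
    have a1 := hc.norm_sub_sub_le hK (hL _ hc) s (r := r) (u := x.1) (v := y.1)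
      ((norm_fst_le x).trans hx) ((norm_fst_le y).trans hy)
    have a2 := (hu n).locIso.norm_sub_sub_le hK (hL _ (hu n).locIso) 0 (r := r) (u := x.2) (v := y.2)
      ((norm_snd_le x).trans hx) ((norm_snd_le y).trans hy)
    have b1 : |x.1 - y.1| ≤ ‖x - y‖ := norm_fst_le (x - y)
    have b2 : |x.2 - y.2| ≤ ‖x - y‖ := norm_snd_le (x - y)
    have a3 : ‖(x.2 - y.2) • (deriv (u n) 0 - deriv γ 0)‖ ≤ c0 / 2 * ‖x - y‖ := by
      rw [norm_smul, mul_comm]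
      exact mul_le_mul hn1 b2 (norm_nonneg _) (by positivity)
    have key : c (s + x.1) - u n x.2 - (c (s + y.1) - u n y.2) - A (x - y) =
        (c (s + x.1) - c (s + y.1) - (x.1 - y.1) • deriv c s) -
        (u n (0 + x.2) - u n (0 + y.2) - (x.2 - y.2) • deriv (u n) 0) -
        (x.2 - y.2) • (deriv (u n) 0 - deriv γ 0) := by
      rw [hA, diffMap_apply, zero_add, zero_add, smul_sub, Prod.fst_sub, Prod.snd_sub]
      abel
    simp only
    rw [key]
    refine (norm_sub_le _ _).trans ?_
    have a4 := norm_sub_le (c (s + x.1) - c (s + y.1) - (x.1 - y.1) • deriv c s)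
      (u n (0 + x.2) - u n (0 + y.2) - (x.2 - y.2) • deriv (u n) 0)
    have hKr : 0 ≤ K * r := by positivity
    have b3 := mul_le_mul_of_nonneg_left b1 hKr
    have b4 := mul_le_mul_of_nonneg_left b2 hKr
    have b5 := mul_le_mul_of_nonneg_right hrK (norm_nonneg (x - y))
    linarith
  have hsurj := happ.surjOn_closedBall_of_nonlinearRightInverse B hr.le (b := 0) le_rfl
  obtain ⟨x, hx, hx0⟩ := hsurj (show (0 : ℝ × ℝ) ∈ _ by
    rw [mem_closedBall_iff_norm']
    simpa using hn2)
  rw [mem_closedBall_zero_iff] at hx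
  exact ⟨x.1, x.2, ((norm_fst_le x).trans hx).trans hrδ, sub_eq_zero.1 hx0⟩

/-- A line which is tangent to a geodesic contains it. -/
lemma LocIso.mem_range_of_tangent {c γ : ℝ → ℝ × ℝ} (hc : M.LocIso c) (hγ : M.LocIso γ) {s : ℝ}
    (hs : γ 0 = c s) (ht : crossDet (deriv c s) (deriv γ 0) = 0) (t : ℝ) : c t ∈ range γ := by
  obtain ⟨r, hr⟩ := exists_smul_of_crossDet (hc.deriv_ne_zero s) ht
  have h1 := hγ.nrm_deriv 0
  rw [hr, hs, nrm_smul, hc.nrm_deriv, mul_one] at h1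
  rcases (abs_eq zero_le_one).1 h1 with rfl | rfl
  · have hc' := hc.comp_add s
    have e1 : deriv (fun t => c (t + s)) 0 = deriv c s := by
      rw [deriv_comp_add_const, zero_add]
    have := hγ.eq_of_deriv_eq hc' (t := 0) (by simp [hs]) (by rw [e1, hr, one_smul])
    exact ⟨t - s, by rw [this]; simp⟩
  · have hc' := hc.reverse s
    have e1 : deriv (fun t => c (s - t)) 0 = -deriv c s := by
      rw [deriv_comp_const_sub, sub_zero]
    have := hγ.eq_of_deriv_eq hc' (t := 0) (by simp [hs]) (by rw [e1, hr, neg_one_smul])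
    exact ⟨s - t, by rw [this]; simp⟩

/-- Lines in a closed set `S` which pass close to a geodesic segment with endpoints outside of `S`
meet the segment. -/
lemma exists_detect {S : Set (ℝ × ℝ)} (hS : IsClosed S) {c : ℝ → ℝ × ℝ} (hc : M.LocIso c) {a : ℝ}
    (h0 : c 0 ∉ S) (ha : c a ∉ S) :
    ∃ ρ > 0, ∀ γ, M.IsLine γ → (∀ t, γ t ∈ S) → ∀ t, ∀ x ∈ c '' Icc 0 a, M.dist x (γ t) ≤ ρ →
      ∃ t, γ t ∈ c '' Icc 0 a := by
  by_contra! H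
  have : ∀ n : ℕ, ∃ γ, M.IsLine γ ∧ (∀ t, γ t ∈ S) ∧ (∃ s ∈ Icc 0 a, M.dist (c s) (γ 0) ≤ 1 / ((n : ℝ) + 1)) ∧
      ∀ t, γ t ∉ c '' Icc 0 a := by
    intro n
    obtain ⟨γ, h1, h2, t, _, ⟨s, hs, rfl⟩, h3, h4⟩ := H (1 / ((n : ℝ) + 1)) (by positivity)
    exact ⟨fun r => γ (r + t), h1.comp_add' t, fun r => h2 _, ⟨s, hs, by simpa using h3⟩,
      fun r => h4 _⟩
  choose u hu huS hs hne using this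
  choose s hs hd using hs
  obtain ⟨r, hr, hsr⟩ := exists_tendsto_of_isCompact isCompact_Icc (Eventually.of_forall hs)
  have hcs : Tendsto (fun n => c (s n)) ulim (𝓝 (c r)) := (hc.continuous.tendsto r).comp hsr
  have hu0 : Tendsto (fun n => u n 0) ulim (𝓝 (c r)) :=
    M.tendsto_of_dist hcs tendsto_one_div_ulim (Eventually.of_forall hd)
  obtain ⟨C, hC⟩ := (isCompact_Icc.image hc.continuous : IsCompact (c '' Icc 0 a)).isBounded.exists_norm_le
  obtain ⟨γ, hγ, hl⟩ := M.exists_limit (fun n => (hu n).uLip) (C := C + 1 / M.lo) fun n => by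
    have h1 := hC _ ⟨s n, hs n, rfl⟩
    have h2 := M.norm_sub_le_dist (c (s n)) (u n 0)
    have h3 : M.dist (c (s n)) (u n 0) / M.lo ≤ 1 / M.lo :=
      div_le_div_of_nonneg_right ((hd n).trans (by
        rw [div_le_one (by positivity)]; linarith [(Nat.cast_nonneg n : (0 : ℝ) ≤ n)])) M.lo_pos.le
    have h4 := norm_le_norm_add_norm_sub' (u n 0) (c (s n))
    linarith
  have hline := isLine_of_limit_line hu hγ hl
  have hγS : ∀ t, γ t ∈ S := fun t =>
    hS.mem_of_tendsto (hl t) (Eventually.of_forall fun n => huS n t)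
  have h00 : γ 0 = c r := tendsto_nhds_unique (hl 0) hu0
  have hr0 : r ≠ 0 := fun h => h0 (by rw [← h, ← h00]; exact hγS 0)
  have hra : r ≠ a := fun h => ha (by rw [← h, ← h00]; exact hγS 0)
  have htr : crossDet (deriv c r) (deriv γ 0) ≠ 0 := fun h => by
    obtain ⟨t, ht⟩ := hc.mem_range_of_tangent hline.locIso h00 h 0
    exact h0 (ht ▸ hγS t)
  have hlt0 : 0 < r := lt_of_le_of_ne hr.1 (Ne.symm hr0)
  have hlta : r < a := lt_of_le_of_ne hr.2 hra
  obtain ⟨n, σ, t, hσ, e⟩ := (eventually_meet hc hu hl h00 htr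
    (δ := min r (a - r)) (lt_min hlt0 (sub_pos.2 hlta))).exists
  refine hne n t ⟨r + σ, ⟨?_, ?_⟩, e⟩
  · linarith [neg_abs_le σ, min_le_left r (a - r)]
  · linarith [le_abs_self σ, min_le_right r (a - r)]

end TorusMetric

/-! ### The strip bounded by two extremal axes -/

namespace TorusMetric
variable {M : TorusMetric}

/-- A closed strip `S`, invariant under the translation `k` and convex for minimal segments,
together with two disjoint axes `β X` in `S` and two compact sets `K X`, such that every line in `S`
which passes `ρ`-close to `K X` meets `K X`, and `β X` is the only axis in `S` meeting `K X`. -/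
structure Config (M : TorusMetric) (k : ℤ × ℤ) (ℓ : ℝ) (S : Set (ℝ × ℝ)) (K : Bool → Set (ℝ × ℝ))
    (β : Bool → ℝ → ℝ × ℝ) (ρ : ℝ) : Prop where
  pos : 0 < ℓ
  rho : 0 < ρ
  closed : IsClosed S
  add_mem : ∀ n : ℤ, ∀ x ∈ S, x + lat (n • k) ∈ S
  bdd : ∃ C, ∀ x ∈ S, ∃ n : ℤ, ‖x + lat (n • k)‖ ≤ C
  convex : ∀ γ a b, M.IsoOn γ a b → γ a ∈ S → γ b ∈ S → ∀ t, a ≤ t → t ≤ b → γ t ∈ S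
  compact : ∀ X, IsCompact (K X)
  ax : ∀ X, M.Ax k ℓ (β X)
  ax_mem : ∀ X t, β X t ∈ S
  ax_zero : ∀ X, β X 0 ∈ K X
  detect : ∀ X γ, M.IsLine γ → (∀ t, γ t ∈ S) → ∀ t, ∀ x ∈ K X, M.dist x (γ t) ≤ ρ →
    ∃ t, γ t ∈ K X
  uniq : ∀ X γ, M.Ax k ℓ γ → (∀ t, γ t ∈ S) → (∃ t, γ t ∈ K X) → range γ = range (β X)
  disj : Disjoint (range (β false)) (range (β true))

lemma LocIso.add_lat {γ : ℝ → ℝ × ℝ} (h : M.LocIso γ) (j : ℤ × ℤ) :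
    M.LocIso fun t => γ t + lat j := by
  intro t
  obtain ⟨ε, hε, H⟩ := h t
  exact ⟨ε, hε, fun u v hu huv hv => by rw [M.dist_add_lat, H u v hu huv hv]⟩

lemma IsoOn.exists_mem_of_separates {γ : ℝ → ℝ × ℝ} {a b : ℝ} (hγ : M.IsoOn γ a b) (hab : a ≤ b)
    {A U V : Set (ℝ × ℝ)} (hUV : Disjoint U V)
    (hs : ∀ K, IsPreconnected K → Disjoint K A → K ⊆ U ∨ K ⊆ V) {p q : ℝ}
    (hp : p ∈ Icc a b) (hq : q ∈ Icc a b) (hpq : p ≤ q)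
    (h' : (γ p ∉ U ∧ γ q ∈ U) ∨ (γ p ∈ U ∧ γ q ∉ U)) : ∃ u ∈ Icc p q, γ u ∈ A := by
  by_contra! hn
  have hc := (hγ.uLip_clamp hab).continuous
  have e : ∀ s ∈ Icc p q, γ (max a (min s b)) = γ s := fun s hs => by
    rw [min_eq_left (hs.2.trans hq.2), max_eq_right (hp.1.trans hs.1)]
  have := hs _ (isPreconnected_Icc.image _ (hc.continuousOn (s := Icc p q))) (by
    rw [Set.disjoint_left]
    rintro _ ⟨s, hs, rfl⟩
    have := hn s hs
    simpa only [e s hs] using this)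
  have m1 : γ p ∈ (fun s => γ (max a (min s b))) '' Icc p q := ⟨p, ⟨le_rfl, hpq⟩, e p ⟨le_rfl, hpq⟩⟩
  have m2 : γ q ∈ (fun s => γ (max a (min s b))) '' Icc p q := ⟨q, ⟨hpq, le_rfl⟩, e q ⟨hpq, le_rfl⟩⟩
  rcases h' with ⟨h1, h2⟩ | ⟨h1, h2⟩ <;> rcases this with h3 | h3
  · exact h1 (h3 m1)
  · exact Set.disjoint_left.1 hUV h2 (h3 m2)
  · exact h2 (h3 m2)
  · exact Set.disjoint_left.1 hUV h1 (h3 m1)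

namespace Ax
variable {k : ℤ × ℤ} {ℓ : ℝ} {β : ℝ → ℝ × ℝ}

lemma notMem_side_of_isoOn (h : M.Ax k ℓ β) {γ : ℝ → ℝ × ℝ} {a b : ℝ}
    (hγ : M.IsoOn γ a b) {U V : Set (ℝ × ℝ)} (hUV : Disjoint U V) (hU : Disjoint U (range β))
    (hs : ∀ K, IsPreconnected K → Disjoint K (range β) → K ⊆ U ∨ K ⊆ V)
    (ha : γ a ∉ U) (hb : γ b ∉ U) {t : ℝ} (hat : a ≤ t) (htb : t ≤ b) : γ t ∉ U := by
  intro ht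
  have hab := hat.trans htb
  obtain ⟨u, hu, s, hs1⟩ := hγ.exists_mem_of_separates hab hUV hs (p := a) (q := t) ⟨le_rfl, hab⟩
    ⟨hat, htb⟩ hat (Or.inl ⟨ha, ht⟩)
  obtain ⟨v, hv, s', hs2⟩ := hγ.exists_mem_of_separates hab hUV hs (p := t) (q := b) ⟨hat, htb⟩
    ⟨hab, le_rfl⟩ htb (Or.inr ⟨ht, hb⟩)
  exact Set.disjoint_left.1 hU ht (h.mem_range_of_isoOn (hγ.mono hu.1 hv.2) hs1.symm hs2.symm hu.2 hv.1)

end Ax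

lemma crossDet_lat_zsmul (k : ℤ × ℤ) (n : ℤ) : crossDet (lat k) (lat (n • k)) = 0 := by
  rw [lat_smul, crossDet_smul_right, crossDet_self, mul_zero]

lemma exists_norm_add_lat_le {k : ℤ × ℤ} (hk : lat k ≠ 0) (B : ℝ) :
    ∃ C, ∀ x, |crossDet (lat k) x| ≤ B → ∃ n : ℤ, ‖x + lat (n • k)‖ ≤ C := by
  set e := lat k with he
  have h2 := sq_add_sq_pos hk
  set q := e.1 ^ 2 + e.2 ^ 2 with hq
  refine ⟨‖e‖ + B / q * ‖((-e.2, e.1) : ℝ × ℝ)‖, fun x hx => ?_⟩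
  set r := (e.1 * x.1 + e.2 * x.2) / q with hr
  refine ⟨-⌊r⌋, ?_⟩
  have hx' : x + lat (-⌊r⌋ • k) = (r - ⌊r⌋) • e + (crossDet e x / q) • ((-e.2, e.1) : ℝ × ℝ) := by
    rw [lat_smul, ← he]
    simp only [crossDet, hr]
    ext
    · simp only [Prod.fst_add, Prod.smul_fst, smul_eq_mul]
      push_cast
      field_simp
      rw [hq]; ring
    · simp only [Prod.snd_add, Prod.smul_snd, smul_eq_mul]
      push_cast
      field_simp
      rw [hq]; ring
  rw [hx']
  refine (norm_add_le _ _).trans (add_le_add ?_ ?_)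
  · rw [norm_smul, Real.norm_eq_abs, abs_of_nonneg (sub_nonneg.2 (Int.floor_le r))]
    exact mul_le_of_le_one_left (norm_nonneg _) (by linarith [Int.lt_floor_add_one r])
  · rw [norm_smul, Real.norm_eq_abs, abs_div, abs_of_pos h2]
    exact mul_le_mul_of_nonneg_right (div_le_div_of_nonneg_right hx h2.le) (norm_nonneg _)

lemma mem_add_zsmul {U : Set (ℝ × ℝ)} {k : ℤ × ℤ} (h : ∀ x, x + lat k ∈ U ↔ x ∈ U) (n : ℤ)
    (x : ℝ × ℝ) : x + lat (n • k) ∈ U ↔ x ∈ U := by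
  induction n using Int.induction_on with
  | zero => simp [lat_zero]
  | succ n ih => rw [add_zsmul, one_zsmul, lat_add, ← add_assoc, h, ih]
  | pred n ih =>
    have hn : (-(n : ℤ) - 1) • k + k = -(n : ℤ) • k := by rw [sub_zsmul, one_zsmul]; abel
    rw [← ih, ← h (x + lat ((-(n : ℤ) - 1) • k)), add_assoc, ← lat_add, hn]

theorem exists_config {k η : ℤ × ℤ} {ℓ : ℝ} {α c₁ c₂ : ℝ → ℝ × ℝ} (hα : M.Ax k ℓ α) (hℓ : 0 < ℓ)
    (h₁ : M.LocIso c₁) (h₂ : M.LocIso c₂) {a b : ℝ} (h₁0 : c₁ 0 ∈ range α) (h₁a : c₁ a ∈ range α)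
    (h₂0 : c₂ 0 ∈ range α) (h₂b : c₂ b ∈ range α) (hη : 0 < crossDet (lat k) (lat η))
    (hm₁ : ∃ s ∈ Icc 0 a, ∃ t, c₁ s = α t + lat η)
    (hm₂ : ∃ s ∈ Icc 0 b, ∃ t, c₂ s = α t + lat (-η)) :
    ∃ S K β ρ, Config M k ℓ S K β ρ := by
  set h := crossDet (lat k) with hh
  have hcont : Continuous h := continuous_crossDet _
  have hper : ∀ n : ℤ, ∀ x, h (x + lat (n • k)) = h x := fun n x => by
    rw [hh, crossDet_add, crossDet_lat_zsmul, add_zero]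
  have htr : ∀ j, M.Ax k ℓ fun t => α t + lat j := fun j => by simpa using hα.comp_add 0 j
  obtain ⟨s₁, hs₁, u₁, e₁⟩ := hm₁
  obtain ⟨s₂, hs₂, u₂, e₂⟩ := hm₂
  -- the first axis
  have hK₁ : IsCompact (c₁ '' Icc 0 a) := isCompact_Icc.image h₁.continuous
  obtain ⟨β₁, hβ₁, hβ₁0, t₁, hmax₁⟩ := (htr η).exists_extremal hℓ hK₁ (s := u₁)
    ⟨s₁, hs₁, e₁⟩ hcont hper
  have P₁ := hβ₁.perCurve hℓ
  have Pα := hα.perCurve hℓ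
  have hα₁ : ∀ t, h (α t) < h (β₁ t₁) := fun t => by
    have := hmax₁ _ (htr η) ⟨u₁, s₁, hs₁, e₁⟩ t
    rw [hh, crossDet_add] at this
    rw [hh]; linarith
  have hdα₁ : Disjoint (range α) (range β₁) := (hα.disjoint_or hβ₁ hℓ).resolve_right fun he => by
    obtain ⟨t, ht⟩ : β₁ t₁ ∈ range α := he ▸ ⟨t₁, rfl⟩
    exact absurd (hα₁ t) (by rw [ht]; exact lt_irrefl _)
  have hαL : range α ⊆ Lft β₁ ℓ (lat k) :=
    (P₁.subset_side (isPreconnected_range Pα.cont) hdα₁).resolve_left fun hr =>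
      P₁.not_both_rgt Pα hr (Pα.subset_rgt_of_max P₁ hdα₁.symm fun s => (hα₁ s).le)
  -- the second axis
  obtain ⟨C, hC⟩ := ((isCompact_Icc (a := (0 : ℝ)) (b := b)).image
    (hcont.comp h₂.continuous)).isBounded.exists_norm_le
  obtain ⟨j, hj⟩ := exists_nat_gt ((h (β₁ t₁) + C) / h (lat η))
  rw [div_lt_iff₀ hη] at hj
  have hjη : h (lat ((j : ℤ) • η)) = j * h (lat η) := by
    rw [lat_smul, hh, crossDet_smul_right]; simp
  set c := fun t => c₂ t + lat ((j : ℤ) • η) with hc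
  have hcI : M.LocIso c := h₂.add_lat _
  have hK₂ : IsCompact (c '' Icc 0 b) := isCompact_Icc.image hcI.continuous
  have e₂' : α u₂ + lat ((j : ℤ) • η - η) = c s₂ := by
    rw [hc]; simp only
    rw [e₂, add_assoc, ← lat_add]; congr 2; abel
  obtain ⟨β₂, hβ₂, hβ₂0, t₂, hmin₂'⟩ := (htr ((j : ℤ) • η - η)).exists_extremal hℓ hK₂ (s := u₂)
    ⟨s₂, hs₂, e₂'.symm⟩ hcont.neg (fun n x => by simp only [Pi.neg_apply, hper])
  have hmin₂ : ∀ γ, M.Ax k ℓ γ → (∃ s, γ s ∈ c '' Icc 0 b) → ∀ u, h (β₂ t₂) ≤ h (γ u) :=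
    fun γ h1 h2 u => neg_le_neg_iff.1 (hmin₂' γ h1 h2 u)
  have P₂ := hβ₂.perCurve hℓ
  have hβ₂h : h (β₁ t₁) < h (β₂ 0) := by
    obtain ⟨s, hs, es⟩ := hβ₂0
    have := hC _ ⟨s, hs, rfl⟩
    rw [← es, hc]; simp only
    rw [hh, crossDet_add, ← hh, hjη]
    have h3 := neg_abs_le (h (c₂ s))
    simp only [Function.comp, Real.norm_eq_abs] at this
    linarith
  have hβ₁h : ∀ s, h (β₁ s) ≤ h (β₁ t₁) := hmax₁ _ hβ₁ ⟨0, hβ₁0⟩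
  have hβ₂h' : ∀ s, h (β₂ t₂) ≤ h (β₂ s) := hmin₂ _ hβ₂ ⟨0, hβ₂0⟩
  have hd : Disjoint (range β₂) (range β₁) := (hβ₂.disjoint_or hβ₁ hℓ).resolve_right fun he => by
    obtain ⟨t, ht⟩ : β₂ 0 ∈ range β₁ := he ▸ ⟨0, rfl⟩
    exact absurd (hβ₁h t) (by rw [ht]; exact not_le.2 hβ₂h)
  have h21 : range β₂ ⊆ Rgt β₁ ℓ (lat k) :=
    P₁.subset_rgt_of_max P₂ hd fun s => (hβ₁h s).trans hβ₂h.le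
  have h12 : range β₁ ⊆ Lft β₂ ℓ (lat k) :=
    (P₂.subset_side (isPreconnected_range P₁.cont) hd.symm).resolve_left fun hr =>
      P₁.not_both_rgt P₂ h21 hr
  have Pj := (htr ((j : ℤ) • η)).perCurve hℓ
  have hα₂ : ∀ t, h (β₂ t₂) < h (α t + lat ((j : ℤ) • η)) := fun t => by
    have := hmin₂ _ (htr ((j : ℤ) • η - η)) ⟨u₂, s₂, hs₂, e₂'.symm⟩ t
    have e3 : lat ((j : ℤ) • η) = lat ((j : ℤ) • η - η) + lat η := by rw [← lat_add]; congr 1; abel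
    rw [e3, ← add_assoc]
    rw [hh, crossDet_add _ _ (lat η)]
    rw [← hh]; linarith
  have hdα₂ : Disjoint (range fun t => α t + lat ((j : ℤ) • η)) (range β₂) :=
    ((htr _).disjoint_or hβ₂ hℓ).resolve_right fun he => by
      obtain ⟨t, ht⟩ : β₂ t₂ ∈ range fun t => α t + lat ((j : ℤ) • η) := he ▸ ⟨t₂, rfl⟩
      exact absurd (hα₂ t) (by simp only at ht; rw [ht]; exact lt_irrefl _)
  have hαR : (range fun t => α t + lat ((j : ℤ) • η)) ⊆ Rgt β₂ ℓ (lat k) :=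
    (P₂.subset_side (isPreconnected_range Pj.cont) hdα₂).resolve_right fun hr =>
      P₂.not_both_lft Pj hr (Pj.subset_lft_of_min P₂ hdα₂.symm fun s => (hα₂ s).le)
  -- the strip
  set S := (Lft β₁ ℓ (lat k) ∪ Rgt β₂ ℓ (lat k))ᶜ with hS
  have hSc : IsClosed S := (P₁.isOpen_lft.union P₂.isOpen_rgt).isClosed_compl
  have hcadd : ∀ t, c₂ t ∈ range α → c t ∈ Rgt β₂ ℓ (lat k) := by
    rintro t ⟨r, hr⟩
    exact hαR ⟨r, by simp only [hc, hr]⟩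
  obtain ⟨ρ₁, hρ₁, D₁⟩ := exists_detect hSc h₁ (a := a) (fun hn => hn (Or.inl (hαL h₁0)))
    (fun hn => hn (Or.inl (hαL h₁a)))
  obtain ⟨ρ₂, hρ₂, D₂⟩ := exists_detect hSc hcI (a := b) (fun hn => hn (Or.inr (hcadd _ h₂0)))
    (fun hn => hn (Or.inr (hcadd _ h₂b)))
  refine ⟨S, fun X => cond X (c '' Icc 0 b) (c₁ '' Icc 0 a), fun X => cond X β₂ β₁, min ρ₁ ρ₂,
    hℓ, lt_min hρ₁ hρ₂, hSc, ?_, ?_, ?_, ?_, ?_, ?_, ?_, ?_, ?_, hd.symm⟩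
  · intro n x hx hx'
    refine hx (hx'.imp ?_ ?_)
    · exact (mem_add_zsmul (fun x => lft_add P₁.ne) n x).1
    · exact (mem_add_zsmul (fun x => rgt_add P₁.ne) n x).1
  · obtain ⟨q₁, hq₁⟩ := P₁.exists_min
    obtain ⟨q₂, hq₂⟩ := P₂.exists_max
    obtain ⟨B, hB⟩ := exists_norm_add_lat_le P₁.ne (max |h (β₁ q₁)| |h (β₂ q₂)|)
    refine ⟨B, fun x hx => hB x ?_⟩
    have a1 : h (β₁ q₁) ≤ h x := by
      by_contra! hlt
      exact hx (Or.inl (P₁.mem_lft_of_lt fun t => hlt.trans_le (hq₁ t)))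
    have a2 : h x ≤ h (β₂ q₂) := by
      by_contra! hlt
      exact hx (Or.inr (P₂.mem_rgt_of_lt fun t => (hq₂ t).trans_lt hlt))
    rw [abs_le]
    constructor
    · linarith [neg_abs_le (h (β₁ q₁)), le_max_left |h (β₁ q₁)| |h (β₂ q₂)|]
    · linarith [le_abs_self (h (β₂ q₂)), le_max_right |h (β₁ q₁)| |h (β₂ q₂)|]
  · intro γ p q hγ hp hq t hpt htq
    rintro (ht | ht)
    · exact hβ₁.notMem_side_of_isoOn hγ disjoint_sides.symm
        (Set.disjoint_left.2 fun y hy => PerCurve.notMem_of_side (Or.inr hy))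
        (fun K hK hd => (P₁.subset_side hK hd).symm) (fun hn => hp (Or.inl hn))
        (fun hn => hq (Or.inl hn)) hpt htq ht
    · exact hβ₂.notMem_side_of_isoOn hγ disjoint_sides
        (Set.disjoint_left.2 fun y hy => PerCurve.notMem_of_side (Or.inl hy))
        (fun K hK hd => P₂.subset_side hK hd) (fun hn => hp (Or.inr hn))
        (fun hn => hq (Or.inr hn)) hpt htq ht
  · rintro (_ | _) <;> assumption
  · rintro (_ | _) <;> assumption
  · rintro (_ | _) t
    · rintro (hn | hn)
      · exact PerCurve.notMem_of_side (Or.inr hn) ⟨t, rfl⟩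
      · exact Set.disjoint_left.1 disjoint_sides hn (h12 ⟨t, rfl⟩)
    · rintro (hn | hn)
      · exact Set.disjoint_left.1 disjoint_sides (h21 ⟨t, rfl⟩) hn
      · exact PerCurve.notMem_of_side (Or.inl hn) ⟨t, rfl⟩
  · rintro (_ | _) <;> assumption
  · rintro (_ | _) γ hγ hγS t x hx hd
    · exact D₁ γ hγ hγS t x hx (hd.trans (min_le_left _ _))
    · exact D₂ γ hγ hγS t x hx (hd.trans (min_le_right _ _))
  · rintro (_ | _) γ hγ hγS hm
    · refine (hγ.disjoint_or hβ₁ hℓ).resolve_left fun hdj => ?_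
      have Pγ := hγ.perCurve hℓ
      refine P₁.not_both_rgt Pγ ?_ (Pγ.subset_rgt_of_max P₁ hdj.symm (hmax₁ γ hγ hm))
      exact (P₁.subset_side (isPreconnected_range Pγ.cont) hdj).resolve_right fun hl =>
        hγS 0 (Or.inl (hl ⟨0, rfl⟩))
    · refine (hγ.disjoint_or hβ₂ hℓ).resolve_left fun hdj => ?_
      have Pγ := hγ.perCurve hℓ
      refine P₂.not_both_lft Pγ ?_ (Pγ.subset_lft_of_min P₂ hdj.symm (hmin₂ γ hγ hm))
      exact (P₂.subset_side (isPreconnected_range Pγ.cont) hdj).resolve_left fun hl =>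
        hγS 0 (Or.inr (hl ⟨0, rfl⟩))

end TorusMetric

/-! ### Calibrating functions -/

namespace TorusMetric
variable {M : TorusMetric}

/-- A function which is `1`-Lipschitz for the Riemannian distance and grows by `ℓ` under the
translation `k`. -/
structure Cal (M : TorusMetric) (k : ℤ × ℤ) (ℓ : ℝ) (f : ℝ × ℝ → ℝ) : Prop where
  lip : ∀ x y, f y - f x ≤ M.dist x y
  per : ∀ x, f (x + lat k) = f x + ℓ

lemma Ax.exists_cal {k : ℤ × ℤ} {ℓ : ℝ} {γ : ℝ → ℝ × ℝ} (h : M.Ax k ℓ γ) (hℓ : 0 < ℓ) :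
    ∃ f, M.Cal k ℓ f := by
  set F : ℝ × ℝ → ℤ → ℝ := fun x n => M.dist (γ 0 + lat (n • k)) x + n * ℓ with hF
  have hb : ∀ x, BddBelow (range (F x)) := fun x => by
    refine ⟨-M.dist (γ 0) x, ?_⟩
    rintro _ ⟨n, rfl⟩
    have h1 := h.le_dist hℓ n (γ 0)
    have h2 := M.dist_triangle (γ 0) x (γ 0 + lat (n • k))
    rw [M.dist_comm x] at h2
    have h3 : 0 ≤ (|(n : ℝ)| + n) * ℓ := mul_nonneg (by linarith [neg_abs_le (n : ℝ)]) hℓ.le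
    simp only [hF]
    linarith
  refine ⟨fun x => ⨅ n, F x n, fun x y => ?_, fun x => ?_⟩
  · have : (⨅ n, F y n) - M.dist x y ≤ ⨅ n, F x n := le_ciInf fun n => by
      have h1 := ciInf_le (hb y) n
      have h2 := M.dist_triangle (γ 0 + lat (n • k)) x y
      simp only [hF] at h1 ⊢
      linarith
    linarith
  · have e : ∀ n, F (x + lat k) n = F x (n - 1) + ℓ := fun n => by
      have : γ 0 + lat (n • k) = γ 0 + lat ((n - 1) • k) + lat k := by
        rw [add_assoc, ← lat_add]; congr 2; rw [sub_smul, one_smul]; abel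
      simp only [hF]
      rw [this, M.dist_add_lat]
      push_cast
      ring
    refine le_antisymm ?_ ?_
    · rw [← sub_le_iff_le_add]
      refine le_ciInf fun n => ?_
      have h1 := ciInf_le (hb (x + lat k)) (n + 1)
      rw [e, add_sub_cancel_right] at h1
      linarith
    · refine le_ciInf fun n => ?_
      rw [e]
      linarith [ciInf_le (hb x) (n - 1)]

namespace Cal
variable {k : ℤ × ℤ} {ℓ : ℝ} {f : ℝ × ℝ → ℝ}

lemma per_int (h : M.Cal k ℓ f) (n : ℤ) (x : ℝ × ℝ) : f (x + lat (n • k)) = f x + n * ℓ := by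
  induction n using Int.induction_on with
  | zero => simp [lat_zero]
  | succ n ih =>
    rw [add_smul, one_smul, lat_add, ← add_assoc, h.per, ih]; push_cast; ring
  | pred n ih =>
    have hn : (-(n : ℤ) - 1) • k + k = -(n : ℤ) • k := by rw [sub_zsmul, one_zsmul]; abel
    have := h.per (x + lat ((-(n : ℤ) - 1) • k))
    rw [add_assoc, ← lat_add, hn, ih] at this
    push_cast at this ⊢
    linarith

lemma abs_sub_le (h : M.Cal k ℓ f) (x y : ℝ × ℝ) : |f y - f x| ≤ M.dist x y :=
  abs_le.2 ⟨by have := h.lip y x; rw [M.dist_comm] at this; linarith, h.lip x y⟩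

lemma continuous (h : M.Cal k ℓ f) : Continuous f := by
  have : LipschitzWith M.up.toNNReal f := LipschitzWith.of_dist_le_mul fun x y => by
    rw [Real.coe_toNNReal _ M.up_pos.le, Real.dist_eq, _root_.dist_comm x y, dist_eq_norm,
      abs_sub_comm]
    exact (h.abs_sub_le x y).trans (M.dist_le_up x y)
  exact this.continuous

lemma le_of_uLip (h : M.Cal k ℓ f) {γ : ℝ → ℝ × ℝ} (hγ : M.ULip γ) {s t : ℝ} (hst : s ≤ t) :
    f (γ t) - f (γ s) ≤ t - s := (h.lip _ _).trans (hγ s t hst)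

/-- The defect of a curve on an interval dominates the defect on every subinterval. -/
lemma le_of_subset (h : M.Cal k ℓ f) {γ : ℝ → ℝ × ℝ} (hγ : M.ULip γ) {a b s t κ : ℝ}
    (hab : b - a ≤ f (γ b) - f (γ a) + κ) (has : a ≤ s) (htb : t ≤ b) :
    t - s ≤ f (γ t) - f (γ s) + κ := by
  linarith [h.le_of_uLip hγ has, h.le_of_uLip hγ htb]

lemma isLine (h : M.Cal k ℓ f) {γ : ℝ → ℝ × ℝ} (hγ : M.ULip γ)
    (hc : ∀ s t, s ≤ t → t - s ≤ f (γ t) - f (γ s)) : M.IsLine γ := fun s t hst =>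
  le_antisymm (hγ s t hst) ((hc s t hst).trans (h.lip _ _))

lemma ax (h : M.Cal k ℓ f) (hℓ : 0 < ℓ) {γ : ℝ → ℝ × ℝ} (hγ : M.Ax k ℓ γ) (s t : ℝ) :
    f (γ t) - f (γ s) = t - s := by
  have key : ∀ s t, s ≤ t → f (γ t) - f (γ s) = t - s := fun s t hst => by
    refine le_antisymm (h.le_of_uLip hγ.line.uLip hst) ?_
    obtain ⟨n, hn⟩ := exists_nat_ge ((t - s) / ℓ)
    rw [div_le_iff₀ hℓ] at hn
    have h1 := h.le_of_uLip hγ.line.uLip (s := t) (t := s + n * ℓ) (by linarith)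
    have h2 := hγ.per_int n s
    rw [Int.cast_natCast] at h2
    rw [h2, h.per_int, Int.cast_natCast] at h1
    linarith
  rcases le_total s t with hst | hst
  · exact key s t hst
  · linarith [key t s hst]

/-- A calibrated curve meeting an axis is that axis. -/
lemma eq_ax (h : M.Cal k ℓ f) (hℓ : 0 < ℓ) {γ β : ℝ → ℝ × ℝ} (hγ : M.ULip γ)
    (hc : ∀ s t, s ≤ t → t - s ≤ f (γ t) - f (γ s)) (hβ : M.Ax k ℓ β) {s r : ℝ}
    (e : γ s = β r) (t : ℝ) : γ t = β (t + (r - s)) := by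
  have hm : M.Ax k ℓ fun t => β (t + (r - s)) := by simpa [lat_zero] using hβ.comp_add (r - s) 0
  have e' : γ s = (fun t => β (t + (r - s))) s := by simp [e]
  generalize hg : (fun t => β (t + (r - s))) = g at hm e'
  rw [show β (t + (r - s)) = g t by rw [← hg]]
  have hG := hγ.glue hm.line.uLip e'
  have hl : M.IsLine fun t => if t ≤ s then γ t else g t := by
    refine h.isLine hG fun u v huv => ?_
    by_cases hu : u ≤ s <;> by_cases hv : v ≤ s <;> simp only [hu, hv, if_true, if_false]
    · exact hc u v huv
    · have h1 := hc u s hu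
      have h2 := h.ax hℓ hm s v
      rw [← e'] at h2
      linarith
    · exact absurd (huv.trans hv) hu
    · exact (h.ax hℓ hm u v).ge
  have e1 := (h.isLine hγ hc).locIso.eq_of_eqOn hl.locIso (show s - 1 < s by linarith)
    fun u hu => by simp [hu.2.le]
  have e2 := hm.line.locIso.eq_of_eqOn hl.locIso (show s < s + 1 by linarith)
    fun u hu => by simp [not_le.2 hu.1]
  exact (congrFun e1 t).trans (congrFun e2 t).symm

lemma of_limit (h : M.Cal k ℓ f) {u : ℕ → ℝ → ℝ × ℝ} {γ : ℝ → ℝ × ℝ}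
    (hl : ∀ t, Tendsto (fun n => u n t) ulim (𝓝 (γ t))) {κ : ℕ → ℝ} (hκ : Tendsto κ ulim (𝓝 0))
    {s t : ℝ} (hu : ∀ᶠ n in ulim, t - s ≤ f (u n t) - f (u n s) + κ n) :
    t - s ≤ f (γ t) - f (γ s) := by
  have h1 : Tendsto (fun n => f (u n t) - f (u n s) + κ n) ulim
      (𝓝 (f (γ t) - f (γ s) + 0)) :=
    (((h.continuous.tendsto _).comp (hl t)).sub ((h.continuous.tendsto _).comp (hl s))).add hκ
  simpa using ge_of_tendsto h1 hu

end Cal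

end TorusMetric

/-! ### Gates -/

lemma exists_eventually_eq (X : ℕ → Bool) : ∃ b, ∀ᶠ n in ulim, X n = b := by
  obtain ⟨b, -, hb⟩ := exists_tendsto_of_isCompact (K := univ) (isCompact_univ (X := Bool)) (u := X)
    (Eventually.of_forall fun _ => mem_univ _)
  rw [nhds_discrete, tendsto_pure] at hb
  exact ⟨b, hb⟩

namespace TorusMetric
variable {M : TorusMetric}

lemma exists_pair_dist_le (M : TorusMetric) {K : Set (ℝ × ℝ)} (hK : IsCompact K) {δ : ℝ}
    (hδ : 0 < δ) : ∃ N : ℕ, ∀ (a : ℤ) (y : ℤ → ℝ × ℝ), (∀ i, a ≤ i → i ≤ a + N → y i ∈ K) →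
      ∃ i j, a ≤ i ∧ i < j ∧ j ≤ a + N ∧ M.dist (y i) (y j) ≤ δ := by
  obtain ⟨t, -, ht, hc⟩ := hK.finite_cover_balls (e := δ / (2 * M.up))
    (by have := M.up_pos; positivity)
  lift t to Finset (ℝ × ℝ) using ht
  refine ⟨t.card, fun a y hy => ?_⟩
  have hx : ∀ i ∈ Finset.Icc a (a + t.card), ∃ x ∈ t, y i ∈ Metric.ball x (δ / (2 * M.up)) := by
    intro i hi
    rw [Finset.mem_Icc] at hi
    have := hc (hy i hi.1 hi.2)
    simpa only [mem_iUnion, exists_prop, Finset.mem_coe] using this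
  choose! F hF hF' using hx
  obtain ⟨i, hi, j, hj, hne, he⟩ := Finset.exists_ne_map_eq_of_card_lt_of_maps_to
    (s := Finset.Icc a (a + t.card)) (t := t) (f := F) (by rw [Int.card_Icc]; omega) hF
  have key : ∀ i j, i ∈ Finset.Icc a (a + t.card) → j ∈ Finset.Icc a (a + t.card) → F i = F j →
      M.dist (y i) (y j) ≤ δ := fun i j hi hj he => by
    refine (M.dist_le_up _ _).trans ?_
    have h1 := hF' i hi
    have h2 := hF' j hj
    rw [he] at h1
    rw [Metric.mem_ball] at h1 h2
    have h3 : ‖y j - y i‖ ≤ δ / M.up := by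
      rw [← dist_eq_norm]
      refine (dist_triangle_right _ _ (F j)).trans ?_
      have : δ / M.up = δ / (2 * M.up) + δ / (2 * M.up) := by field_simp; ring
      linarith
    calc M.up * ‖y j - y i‖ ≤ M.up * (δ / M.up) := mul_le_mul_of_nonneg_left h3 M.up_pos.le
      _ = δ := by have := M.up_pos; field_simp
  rw [Finset.mem_Icc] at hi hj
  rcases lt_or_gt_of_ne hne with hlt | hlt
  · exact ⟨i, j, hi.1, hlt, hj.2, key i j (Finset.mem_Icc.2 hi) (Finset.mem_Icc.2 hj) he⟩
  · exact ⟨j, i, hj.1, hlt, hi.2, key j i (Finset.mem_Icc.2 hj) (Finset.mem_Icc.2 hi) he.symm⟩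

/-- The points of `S` which are `ρ`-close to `K X`. -/
def gate (M : TorusMetric) (S : Set (ℝ × ℝ)) (K : Bool → Set (ℝ × ℝ)) (ρ : ℝ) (X : Bool) :
    Set (ℝ × ℝ) := {x | x ∈ S ∧ ∃ y ∈ K X, M.dist y x ≤ ρ}

namespace Config
variable {k : ℤ × ℤ} {ℓ : ℝ} {S : Set (ℝ × ℝ)} {K : Bool → Set (ℝ × ℝ)} {β : Bool → ℝ → ℝ × ℝ}
  {ρ : ℝ} {f : ℝ × ℝ → ℝ}

lemma isClosed_gate (h : M.Config k ℓ S K β ρ) (X : Bool) : IsClosed (M.gate S K ρ X) := by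
  refine IsSeqClosed.isClosed fun x p hx hp => ?_
  have hp' := hp.mono_left ulim_le
  choose hxS y hy hd using hx
  obtain ⟨q, hq, hyq⟩ := exists_tendsto_of_isCompact (h.compact X) (u := y)
    (Eventually.of_forall hy)
  exact ⟨h.closed.mem_of_tendsto hp (Eventually.of_forall hxS), q, hq,
    le_of_tendsto (M.tendsto_dist hyq hp') (Eventually.of_forall hd)⟩

lemma exists_norm_gate (h : M.Config k ℓ S K β ρ) :
    ∃ C, ∀ X, ∀ x ∈ M.gate S K ρ X, ‖x‖ ≤ C := by
  have : ∀ X, ∃ C, ∀ x ∈ M.gate S K ρ X, ‖x‖ ≤ C := fun X => by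
    obtain ⟨C, hC⟩ := (h.compact X).isBounded.exists_norm_le
    refine ⟨C + ρ / M.lo, fun x hx => ?_⟩
    obtain ⟨-, y, hy, hd⟩ := hx
    have h1 := (M.norm_sub_le_dist y x).trans (div_le_div_of_nonneg_right hd M.lo_pos.le)
    have h2 := norm_le_norm_add_norm_sub' x y
    linarith [hC y hy]
  choose C hC using this
  refine ⟨max (C false) (C true), ?_⟩
  rintro (_ | _) x hx
  · exact (hC _ x hx).trans (le_max_left _ _)
  · exact (hC _ x hx).trans (le_max_right _ _)

lemma isCompact_gate (h : M.Config k ℓ S K β ρ) (X : Bool) : IsCompact (M.gate S K ρ X) := by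
  obtain ⟨C, hC⟩ := h.exists_norm_gate
  exact (isCompact_closedBall (0 : ℝ × ℝ) C).of_isClosed_subset (h.isClosed_gate X)
    fun x hx => by simpa using hC X x hx

lemma zero_mem_gate (h : M.Config k ℓ S K β ρ) (X : Bool) : β X 0 ∈ M.gate S K ρ X :=
  ⟨h.ax_mem X 0, β X 0, h.ax_zero X, by rw [M.dist_self]; exact h.rho.le⟩

lemma exists_dist_gate (h : M.Config k ℓ S K β ρ) :
    ∃ B, 0 < B ∧ ∀ X Y, ∀ x ∈ M.gate S K ρ X, ∀ y ∈ M.gate S K ρ Y, M.dist x y ≤ B := by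
  obtain ⟨C, hC⟩ := h.exists_norm_gate
  have hC0 : 0 ≤ C := (norm_nonneg _).trans (hC _ _ (h.zero_mem_gate true))
  refine ⟨M.up * (C + C) + 1, by have := M.up_pos; positivity, fun X Y x hx y hy => ?_⟩
  have h1 := M.dist_le_up x y
  have h2 : ‖y - x‖ ≤ C + C := (norm_sub_le _ _).trans (add_le_add (hC _ _ hy) (hC _ _ hx))
  linarith [mul_le_mul_of_nonneg_left h2 M.up_pos.le]

lemma mem_limit (h : M.Config k ℓ S K β ρ) {u : ℕ → ℝ → ℝ × ℝ} {γ : ℝ → ℝ × ℝ}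
    (hu : ∀ n t, u n t ∈ S) (hl : ∀ t, Tendsto (fun n => u n t) ulim (𝓝 (γ t))) (t : ℝ) :
    γ t ∈ S := h.closed.mem_of_tendsto (hl t) (Eventually.of_forall fun n => hu n t)

lemma mem_gate_limit (h : M.Config k ℓ S K β ρ) {u : ℕ → ℝ × ℝ} {X : ℕ → Bool} {Y : Bool}
    {x : ℝ × ℝ} (hX : ∀ᶠ n in ulim, X n = Y) (hu : ∀ n, u n ∈ M.gate S K ρ (X n))
    (hl : Tendsto u ulim (𝓝 x)) : x ∈ M.gate S K ρ Y :=
  (h.isClosed_gate Y).mem_of_tendsto hl (hX.mono fun n hn => hn ▸ hu n)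

/-- A path in `S` which is almost minimizing on a long interval around a time at which it passes a
gate also passes the interior of that gate. -/
lemma exists_enter (h : M.Config k ℓ S K β ρ) :
    ∃ T > 0, ∃ κ > 0, ∀ X u, M.ULip u → (∀ t, u t ∈ S) →
      2 * T ≤ M.dist (u (-T)) (u T) + κ → u 0 ∈ M.gate S K ρ X →
      ∃ t, |t| ≤ T ∧ ∃ y ∈ K X, M.dist y (u t) < ρ := by
  by_contra! H
  have hpos : ∀ n : ℕ, (0 : ℝ) < (n : ℝ) + 1 := fun n => by positivity
  choose X u hu hS hd h0 hn using fun n : ℕ => H ((n : ℝ) + 1) (hpos n) (1 / ((n : ℝ) + 1))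
    (one_div_pos.2 (hpos n))
  obtain ⟨Y, hY⟩ := exists_eventually_eq X
  obtain ⟨C, hC⟩ := h.exists_norm_gate
  obtain ⟨γ, hγ, hl⟩ := M.exists_limit hu (fun n => hC _ _ (h0 n))
  have hbig : ∀ t : ℝ, ∀ᶠ n : ℕ in ulim, |t| ≤ (n : ℝ) + 1 := fun t =>
    ((tendsto_natCast_atTop_atTop (R := ℝ)).mono_left ulim_le).eventually
      (eventually_ge_atTop |t|) |>.mono fun n hn => by linarith
  have hline : M.IsLine γ := M.isLine_of_limit hγ hl tendsto_one_div_ulim fun s t hst => by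
    filter_upwards [hbig s, hbig t] with n hs ht
    exact (hu n).sub_le (by linarith [hd n]) (abs_le.1 hs).1 (abs_le.1 ht).2
  have hγS := h.mem_limit hS hl
  obtain ⟨-, y, hy, hyd⟩ := h.mem_gate_limit hY h0 (hl 0)
  obtain ⟨t, ht⟩ := h.detect Y γ hline hγS 0 y hy hyd
  have h1 : Tendsto (fun n => M.dist (γ t) (u n t)) ulim (𝓝 0) := by
    simpa [M.dist_self] using M.tendsto_dist (tendsto_const_nhds (x := γ t)) (hl t)
  obtain ⟨n, hn1, hn2, hn3⟩ := ((h1.eventually (gt_mem_nhds h.rho)).and ((hbig t).and hY)).exists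
  exact absurd hn1 (not_lt.2 (hn n t hn2 _ (hn3 ▸ ht)))

/-- Distinct axes stay away from each others gates. -/
lemma exists_away (h : M.Config k ℓ S K β ρ) (hf : M.Cal k ℓ f) :
    ∃ ε > 0, ∀ X Y, X ≠ Y → ∀ x ∈ M.gate S K ρ X, ∀ r, ε < M.dist x (β Y r) := by
  by_contra! H
  have hpos : ∀ n : ℕ, (0 : ℝ) < (n : ℝ) + 1 := fun n => by positivity
  choose X Y hXY x hx r hr using fun n : ℕ => H (1 / ((n : ℝ) + 1)) (one_div_pos.2 (hpos n))
  obtain ⟨X', hX'⟩ := exists_eventually_eq X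
  obtain ⟨Y', hY'⟩ := exists_eventually_eq Y
  have hne : X' ≠ Y' := by
    obtain ⟨n, h1, h2⟩ := (hX'.and hY').exists
    exact h1 ▸ h2 ▸ hXY n
  obtain ⟨B, hB, hBd⟩ := h.exists_dist_gate
  have hrb : ∀ n, r n ∈ Icc (-(B + 1)) (B + 1) := fun n => by
    have h1 := hf.ax h.pos (h.ax (Y n)) 0 (r n)
    have h2 := hf.abs_sub_le (x n) (β (Y n) (r n))
    have h3 := hf.abs_sub_le (x n) (β (Y n) 0)
    have h4 := hBd _ _ _ (hx n) _ (h.zero_mem_gate (Y n))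
    have h5 : 1 / ((n : ℝ) + 1) ≤ 1 := by
      rw [div_le_one (hpos n)]; linarith [Nat.cast_nonneg (α := ℝ) n]
    have h6 := hr n
    rw [abs_le] at h2 h3
    constructor <;> linarith [h2.1, h2.2, h3.1, h3.2]
  obtain ⟨q, -, hq⟩ := exists_tendsto_of_isCompact isCompact_Icc (Eventually.of_forall hrb)
  have hl : Tendsto (fun n => β (Y n) (r n)) ulim (𝓝 (β Y' q)) :=
    (((h.ax Y').line.uLip.continuous.tendsto q).comp hq).congr'
      (hY'.mono fun n hn => by simp [hn])
  have hl' : Tendsto x ulim (𝓝 (β Y' q)) := M.tendsto_of_dist hl tendsto_one_div_ulim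
    (Eventually.of_forall fun n => by rw [M.dist_comm]; exact hr n)
  obtain ⟨-, y, hy, hyd⟩ := h.mem_gate_limit hX' hx hl'
  have hm := h.uniq X' (β Y') (h.ax Y') (h.ax_mem Y')
    (h.detect X' _ (h.ax Y').line (h.ax_mem Y') q y hy hyd)
  have hd := h.disj
  rcases X' with _ | _ <;> rcases Y' with _ | _
  · exact hne rfl
  · rw [hm] at hd; exact Set.disjoint_left.1 hd ⟨0, rfl⟩ ⟨0, rfl⟩
  · rw [hm] at hd; exact Set.disjoint_left.1 hd ⟨0, rfl⟩ ⟨0, rfl⟩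
  · exact hne rfl

/-- A path with small defect which starts close to an axis stays close to it. -/
lemma exists_stay (h : M.Config k ℓ S K β ρ) (hf : M.Cal k ℓ f) (C : ℝ) {ε : ℝ} (hε : 0 < ε) :
    ∃ T > 0, ∃ δ > 0, ∀ X u, M.ULip u → 2 * T ≤ f (u T) - f (u (-T)) + δ →
      u 0 ∈ M.gate S K ρ X → (∃ r, M.dist (u 0) (β X r) ≤ δ) →
      ∀ t, |t| ≤ C → ∃ r, M.dist (u t) (β X r) ≤ ε := by
  by_contra! H
  have hpos : ∀ n : ℕ, (0 : ℝ) < (n : ℝ) + 1 := fun n => by positivity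
  choose X u hu hd h0 hr t ht hn using fun n : ℕ => H ((n : ℝ) + 1) (hpos n) (1 / ((n : ℝ) + 1))
    (one_div_pos.2 (hpos n))
  choose r hr using hr
  obtain ⟨Y, hY⟩ := exists_eventually_eq X
  obtain ⟨C', hC'⟩ := h.exists_norm_gate
  obtain ⟨γ, hγ, hl⟩ := M.exists_limit hu (fun n => hC' _ _ (h0 n))
  have hbig : ∀ t : ℝ, ∀ᶠ n : ℕ in ulim, |t| ≤ (n : ℝ) + 1 := fun t =>
    ((tendsto_natCast_atTop_atTop (R := ℝ)).mono_left ulim_le).eventually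
      (eventually_ge_atTop |t|) |>.mono fun n hn => by linarith
  have hcal : ∀ s t, s ≤ t → t - s ≤ f (γ t) - f (γ s) := fun s t _ =>
    hf.of_limit hl tendsto_one_div_ulim <| by
      filter_upwards [hbig s, hbig t] with n hs ht
      exact hf.le_of_subset (hu n) (by linarith [hd n]) (abs_le.1 hs).1 (abs_le.1 ht).2
  obtain ⟨B, hB, hBd⟩ := h.exists_dist_gate
  have hrb : ∀ n, r n ∈ Icc (-(B + 1)) (B + 1) := fun n => by
    have h1 := hf.ax h.pos (h.ax (X n)) 0 (r n)
    have h2 := hf.abs_sub_le (u n 0) (β (X n) (r n))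
    have h3 := hf.abs_sub_le (u n 0) (β (X n) 0)
    have h4 := hBd _ _ _ (h0 n) _ (h.zero_mem_gate (X n))
    have h5 : 1 / ((n : ℝ) + 1) ≤ 1 := by
      rw [div_le_one (hpos n)]; linarith [Nat.cast_nonneg (α := ℝ) n]
    have h6 := hr n
    rw [abs_le] at h2 h3
    constructor <;> linarith [h2.1, h2.2, h3.1, h3.2]
  obtain ⟨q, -, hq⟩ := exists_tendsto_of_isCompact isCompact_Icc (Eventually.of_forall hrb)
  obtain ⟨τ, -, hτ⟩ := exists_tendsto_of_isCompact isCompact_Icc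
    (Eventually.of_forall fun n => abs_le.1 (ht n))
  have hlq : Tendsto (fun n => β (X n) (r n)) ulim (𝓝 (β Y q)) :=
    (((h.ax Y).line.uLip.continuous.tendsto q).comp hq).congr'
      (hY.mono fun n hn => by simp [hn])
  have e0 : γ 0 = β Y q := tendsto_nhds_unique (hl 0) <|
    M.tendsto_of_dist hlq tendsto_one_div_ulim
      (Eventually.of_forall fun n => by rw [M.dist_comm]; exact hr n)
  have e1 := hf.eq_ax h.pos hγ hcal (h.ax Y) e0 τ
  have h1 : Tendsto (fun n => M.dist (u n (t n)) (β Y (τ + (q - 0)))) ulim (𝓝 0) := by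
    have := M.tendsto_dist (M.tendsto_moving hu hl hτ)
      (tendsto_const_nhds (x := β Y (τ + (q - 0))))
    rwa [e1, M.dist_self] at this
  obtain ⟨n, hn1, hn2⟩ := ((h1.eventually (gt_mem_nhds hε)).and hY).exists
  have := hn n (τ + (q - 0))
  rw [hn2] at this
  linarith

/-- The asymptotic cost of passing from one axis to the other one. -/
lemma exists_transition (h : M.Config k ℓ S K β ρ) (hf : M.Cal k ℓ f) {ε : ℝ} (hε : 0 < ε) :
    ∃ D : Bool → Bool → ℝ, ∃ J₀ : ℕ, (∀ X Y s t, D X Y + (t - s) ≤ M.dist (β X s) (β Y t)) ∧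
      ∀ J : ℕ, J₀ ≤ J → ∀ X Y,
        M.dist (β X 0) (β Y 0 + lat ((J : ℤ) • k)) ≤ J * ℓ + D X Y + ε := by
  have key : ∀ X Y, ∃ D : ℝ, ∃ J₀ : ℕ, (∀ s t, D + (t - s) ≤ M.dist (β X s) (β Y t)) ∧
      ∀ J : ℕ, J₀ ≤ J → M.dist (β X 0) (β Y 0 + lat ((J : ℤ) • k)) ≤ J * ℓ + D + ε := by
    intro X Y
    set F : ℝ × ℝ → ℝ := fun p => M.dist (β X p.1) (β Y p.2) - (p.2 - p.1) with hF
    have hb : BddBelow (range F) := by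
      refine ⟨f (β Y 0) - f (β X 0), ?_⟩
      rintro _ ⟨⟨s, t⟩, rfl⟩
      have h1 := hf.lip (β X s) (β Y t)
      have h2 := hf.ax h.pos (h.ax X) 0 s
      have h3 := hf.ax h.pos (h.ax Y) 0 t
      simp only [hF]
      linarith
    obtain ⟨⟨s, t⟩, hst⟩ := exists_lt_of_ciInf_lt (show (⨅ p, F p) < (⨅ p, F p) + ε by linarith)
    obtain ⟨n, hn⟩ := exists_nat_ge (-s / ℓ)
    obtain ⟨J₀, hJ₀⟩ := exists_nat_ge ((t + n * ℓ) / ℓ)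
    rw [div_le_iff₀ h.pos] at hn hJ₀
    refine ⟨⨅ p, F p, J₀, fun s t => ?_, fun J hJ => ?_⟩
    · have := ciInf_le hb (s, t)
      simp only [hF] at this
      simp only [hF]
      linarith
    · have h1 := (h.ax X).line.uLip 0 (s + n * ℓ) (by linarith)
      have hJ' : (J₀ : ℝ) * ℓ ≤ J * ℓ :=
        mul_le_mul_of_nonneg_right (Nat.cast_le.2 hJ) h.pos.le
      have h2 := (h.ax Y).line.uLip (t + n * ℓ) (0 + J * ℓ) (by linarith)
      have h3 : M.dist (β X (s + n * ℓ)) (β Y (t + n * ℓ)) = M.dist (β X s) (β Y t) := by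
        have := (h.ax X).per_int n s
        have e2 := (h.ax Y).per_int n t
        rw [Int.cast_natCast] at this e2
        rw [this, e2, M.dist_add_lat]
      have h4 := (h.ax Y).per_int J 0
      rw [Int.cast_natCast] at h4
      rw [← h4]
      have h5 := M.dist_triangle (β X 0) (β X (s + n * ℓ)) (β Y (0 + J * ℓ))
      have h6 := M.dist_triangle (β X (s + n * ℓ)) (β Y (t + n * ℓ)) (β Y (0 + J * ℓ))
      simp only [hF] at hst ⊢
      linarith
  choose D J₀ h1 h2 using key
  refine ⟨D, (J₀ true true + J₀ true false) + (J₀ false true + J₀ false false), h1,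
    fun J hJ X Y => h2 X Y J (le_trans ?_ hJ)⟩
  rcases X with _ | _ <;> rcases Y with _ | _ <;> omega

end Config

end TorusMetric

/-! ### Loops and low-defect paths -/

namespace TorusMetric
variable {M : TorusMetric}

/-- A path which is almost invariant under the translation `N • k` and not much longer than an axis
passes close to a point which is moved by `k` by hardly more than the minimal amount. -/
lemma Ax.exists_near_of_loop {k : ℤ × ℤ} {ℓ : ℝ} {α : ℝ → ℝ × ℝ} (hα : M.Ax k ℓ α) (hℓ : 0 < ℓ)
    {u : ℝ → ℝ × ℝ} (hu : M.ULip u) {a b δ : ℝ} (hab : a < b) {N : ℤ} (hN : 2 ≤ N)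
    (hd : M.dist (u b) (u a + lat (N • k)) ≤ δ) (hT : b - a ≤ N * ℓ + 2 * δ) (hδ : 3 * δ < ℓ) :
    ∃ t ∈ Icc a b, ∃ z, M.dist (u t) z ≤ δ ∧ M.dist z (z + lat k) ≤ ℓ + 3 * δ := by
  set D := M.dist (u b) (u a + lat (N • k)) with hD
  have hD0 : 0 ≤ D := M.dist_nonneg _ _
  obtain ⟨σ, hσ, hσ0, hσD⟩ := M.exists_segment (u b) (u a + lat (N • k))
  rw [← hD] at hσD
  have hu' : M.ULip fun t => u (t + a) := by simpa [lat_zero] using hu.comp_add a 0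
  have hσ' : M.ULip fun t => σ (t + -(b - a)) := by simpa [lat_zero] using hσ.comp_add (-(b - a)) 0
  have hc := hu'.glue hσ' (r := b - a) (by simp [hσ0])
  set c : ℝ → ℝ × ℝ := fun t => if t ≤ b - a then u (t + a) else σ (t + -(b - a)) with hcdef
  set T := b - a + D with hTdef
  have hT0 : 0 < T := by linarith
  have hcT : c T = c 0 + lat (N • k) := by
    have h0 : c 0 = u a := by
      simp only [hcdef]
      rw [if_pos (by linarith), zero_add]
    rw [h0, ← hσD]
    simp only [hcdef]
    split_ifs with h1
    · have : D = 0 := by linarith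
      rw [hTdef, this, add_zero, sub_add_cancel, hσ0]
    · rw [hTdef]; congr 1; ring
  obtain ⟨C, hC, hCc, hCp⟩ := exists_periodic_ext hc hT0 hcT
  have hNR : (2 : ℝ) ≤ N := by exact_mod_cast hN
  have hP : PerCurve C T (lat (N • k)) := ⟨hC.continuous, hCp, by
    rw [lat_smul]
    exact smul_ne_zero (by linarith) (hα.ne_zero hℓ)⟩
  obtain ⟨s, t, hst⟩ := hP.exists_meet_translate (w := lat k)
    (by rw [lat_smul, crossDet_smul_left, crossDet_self, mul_zero])
  have hidx : ∀ x, ∃ m : ℤ, m * T ≤ x ∧ x < (m + 1) * T := fun x => by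
    obtain ⟨m, h1, h2⟩ := exists_index (t := fun n : ℤ => n * T) hT0
      (fun n => le_of_eq (by push_cast; ring)) x
    exact ⟨m, h1, by push_cast at h2; exact h2⟩
  have hper : ∀ (m : ℤ) x, C (x + m * T) = C x + lat ((m * N) • k) := fun m x => by
    rw [hP.per_int, mul_smul, lat_smul m]
  have hadd : ∀ (x : ℝ × ℝ) (i j : ℤ), x + lat (i • k) + lat (j • k) = x + lat ((i + j) • k) :=
    fun x i j => by rw [add_assoc, ← lat_add, add_smul]
  obtain ⟨m, hm1, hm2⟩ := hidx (s - t)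
  set q := s - t - m * T with hq
  have e1 : C (t + q) = C t + lat ((1 - m * N) • k) := by
    have h1 := hper m (t + q)
    rw [show t + q + m * T = s by rw [hq]; ring, hst] at h1
    have h2 : C t + lat ((1 : ℤ) • k) = C (t + q) + lat ((m * N) • k) := by rw [one_smul]; exact h1
    have h3 := congrArg (· + lat ((-(m * N)) • k)) h2
    simp only [hadd] at h3
    rw [add_neg_cancel, zero_smul, lat_zero, add_zero] at h3
    rw [← h3]; rfl
  have e2 : C (t + T) = C (t + q) + lat ((N - 1 + m * N) • k) := by
    rw [hCp, e1, hadd]; congr 3; ring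
  have i1 := hα.le_dist hℓ (1 - m * N) (C t)
  rw [← e1] at i1
  have i2 := hα.le_dist hℓ (N - 1 + m * N) (C (t + q))
  rw [← e2] at i2
  have j1 := hC t (t + q) (by linarith)
  have j2 := hC (t + q) (t + T) (by linarith)
  have hm0 : m = 0 := by
    have h1 : (|((1 - m * N : ℤ) : ℝ)| + |((N - 1 + m * N : ℤ) : ℝ)|) * ℓ < (N + 1 : ℤ) * ℓ := by
      push_cast at i1 i2 ⊢
      linarith
    have h2 : |1 - m * N| + |N - 1 + m * N| < N + 1 := by
      have := lt_of_mul_lt_mul_right h1 hℓ.le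
      exact_mod_cast this
    rcases lt_trichotomy m 0 with hlt | h0 | hgt
    · have := le_abs_self (1 - m * N)
      have h3 := abs_nonneg (N - 1 + m * N)
      nlinarith
    · exact h0
    · have := neg_le_abs (1 - m * N)
      have h3 := le_abs_self (N - 1 + m * N)
      nlinarith
  subst hm0
  have hq' : q ≤ ℓ + 3 * δ := by
    have : |((N - 1 + 0 * N : ℤ) : ℝ)| = N - 1 := by
      push_cast; rw [zero_mul, add_zero, abs_of_nonneg (by linarith)]
    rw [this] at i2
    linarith
  obtain ⟨m', hm'1, hm'2⟩ := hidx t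
  set t₀ := t - m' * T with ht₀
  have hz : M.dist (C t₀) (C t₀ + lat k) ≤ ℓ + 3 * δ := by
    have h1 : C t = C t₀ + lat ((m' * N) • k) := by rw [← hper, ht₀]; congr 1; ring
    rw [← M.dist_add_lat ((m' * N) • k), add_right_comm, ← h1]
    have h2 : C t + lat k = C (t + q) := by rw [e1]; simp
    rw [h2]
    linarith
  have hCt : C t₀ = c t₀ := hCc _ (by linarith) (by linarith)
  by_cases hle : t₀ ≤ b - a
  · refine ⟨t₀ + a, ⟨by linarith, by linarith⟩, C t₀, ?_, hz⟩
    rw [hCt, hcdef]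
    simp only [hle, if_true]
    rw [M.dist_self]; linarith
  · refine ⟨b, ⟨hab.le, le_rfl⟩, C t₀, ?_, hz⟩
    rw [hCt, hcdef]
    simp only [hle, if_false]
    rw [← hσ0]
    have := hσ 0 (t₀ + -(b - a)) (by linarith)
    linarith

end TorusMetric

/-! ### Paths through a sequence of gates -/

lemma exists_step_mem {s : ℤ → ℝ} {i j : ℤ} (hij : i < j) {t : ℝ} (hi : s i ≤ t) (hj : t ≤ s j) :
    ∃ p, i ≤ p ∧ p < j ∧ s p ≤ t ∧ t ≤ s (p + 1) := by
  obtain ⟨p, ⟨h1, h2, h3⟩, h4⟩ := Int.exists_greatest_of_bdd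
    (P := fun p => i ≤ p ∧ p < j ∧ s p ≤ t) ⟨j, fun z hz => hz.2.1.le⟩ ⟨i, le_rfl, hij, hi⟩
  refine ⟨p, h1, h2, h3, ?_⟩
  by_contra! h5
  by_cases h6 : p + 1 = j
  · rw [h6] at h5; linarith
  · have := h4 (p + 1) ⟨by omega, by omega, h5.le⟩
    omega

namespace TorusMetric
variable {M : TorusMetric}

/-- The path `u` in `S` passes at the times `s i` the translates by `(i * J) • k` of the gates
`w i`. -/
structure Itin (M : TorusMetric) (k : ℤ × ℤ) (S : Set (ℝ × ℝ)) (K : Bool → Set (ℝ × ℝ)) (ρ : ℝ)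
    (J : ℕ) (w : ℤ → Bool) (u : ℝ → ℝ × ℝ) (s : ℤ → ℝ) (y : ℤ → ℝ × ℝ) : Prop where
  uLip : M.ULip u
  mono : Monotone s
  mem : ∀ t, u t ∈ S
  gate : ∀ i, y i ∈ M.gate S K ρ (w i)
  eq : ∀ i, u (s i) = y i + lat ((i * J) • k)

namespace Config
variable {k : ℤ × ℤ} {ℓ : ℝ} {S : Set (ℝ × ℝ)} {K : Bool → Set (ℝ × ℝ)} {β : Bool → ℝ → ℝ × ℝ}
  {ρ : ℝ} {f : ℝ × ℝ → ℝ}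

/-- A path of small defect which passes the same gate sufficiently often passes the gate close to
the axis. -/
lemma exists_good (h : M.Config k ℓ S K β ρ) (hf : M.Cal k ℓ f) {J : ℕ} (hJ : 2 ≤ J) {ε : ℝ}
    (hε : 0 < ε) : ∃ δ > 0, ∃ L : ℕ, ∀ w u s y, M.Itin k S K ρ J w u s y → ∀ X, ∀ a : ℤ,
      (∀ i, a ≤ i → i ≤ a + L → w i = X) →
      s (a + L) - s a ≤ f (u (s (a + L))) - f (u (s a)) + δ →
      ∃ i, a ≤ i ∧ i ≤ a + L ∧ ∃ r, M.dist (y i) (β X r) ≤ ε := by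
  have hℓ := h.pos
  obtain ⟨B, hB, hBd⟩ := h.exists_dist_gate
  set δ : ℕ → ℝ := fun n => ℓ / 4 * (1 / ((n : ℝ) + 1)) with hδ
  have hδ0 : ∀ n, 0 < δ n := fun n => by simp only [hδ]; positivity
  have hδ1 : ∀ n, δ n ≤ ℓ / 4 := fun n => by
    have : 1 / ((n : ℝ) + 1) ≤ 1 := by
      rw [div_le_one (by positivity)]; linarith [Nat.cast_nonneg (α := ℝ) n]
    simp only [hδ]; nlinarith
  have hδl : Tendsto δ ulim (𝓝 0) := by
    simpa only [mul_zero] using tendsto_one_div_ulim.const_mul (ℓ / 4)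
  choose N hN using fun n => M.exists_pair_dist_le
    ((h.isCompact_gate false).union (h.isCompact_gate true)) (hδ0 n)
  by_contra! H
  choose w u s y hI X a hw hd hn using fun n : ℕ => H (δ n) (hδ0 n) (2 * n + 2 + N n)
  have hfu : ∀ n i, f (u n (s n i)) = f (y n i) + i * J * ℓ := fun n i => by
    rw [(hI n).eq, hf.per_int]; push_cast; ring
  have hfy : ∀ n i j, |f (y n j) - f (y n i)| ≤ B := fun n i j =>
    (hf.abs_sub_le _ _).trans (hBd _ _ _ ((hI n).gate i) _ ((hI n).gate j))
  have hup : ∀ n i j, a n ≤ i → i ≤ j → j ≤ a n + (2 * n + 2 + N n : ℕ) →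
      s n j - s n i ≤ f (y n j) - f (y n i) + ((j - i : ℤ) : ℝ) * J * ℓ + δ n := fun n i j h1 h2 h3 => by
    have := hf.le_of_subset (hI n).uLip (κ := δ n) (a := s n (a n))
      (b := s n (a n + (2 * n + 2 + N n : ℕ))) (by linarith [hd n]) ((hI n).mono h1) ((hI n).mono h3)
    rw [hfu, hfu] at this
    push_cast
    linarith
  have hlo : ∀ n i j, i ≤ j →
      f (y n j) - f (y n i) + ((j - i : ℤ) : ℝ) * J * ℓ ≤ s n j - s n i := fun n i j h1 => by
    have := hf.le_of_uLip (hI n).uLip ((hI n).mono h1)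
    rw [hfu, hfu] at this
    push_cast
    linarith
  have hmem : ∀ n i, y n i ∈ M.gate S K ρ false ∪ M.gate S K ρ true := fun n i => by
    have := (hI n).gate i
    cases h : w n i <;> rw [h] at this
    · exact Or.inl this
    · exact Or.inr this
  have key : ∀ n, ∃ p τ, a n + n + 1 ≤ p ∧ p ≤ a n + n + 1 + N n ∧ 0 ≤ τ ∧ τ ≤ J * ℓ + B + ℓ ∧
      M.dist (u n (s n p + τ)) (u n (s n p + τ) + lat k) ≤ ℓ + 5 * δ n := by
    intro n
    obtain ⟨i, j, hi, hij, hj, hyd⟩ := hN n (a n + n + 1) (y n) fun i _ _ => hmem n i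
    have hJR : (2 : ℝ) ≤ J := by exact_mod_cast hJ
    have hji : (1 : ℝ) ≤ ((j - i : ℤ) : ℝ) := by exact_mod_cast (by omega : (1 : ℤ) ≤ j - i)
    have h1 := hup n i j (by omega) hij.le (by push_cast; omega)
    have h2 := hlo n i j hij.le
    have h3 := hf.abs_sub_le (y n i) (y n j)
    rw [abs_le] at h3
    have h4 : (1 : ℝ) * 2 ≤ ((j - i : ℤ) : ℝ) * J := mul_le_mul hji hJR (by norm_num) (by linarith)
    have h5 : 2 * ℓ ≤ ((j - i : ℤ) : ℝ) * J * ℓ := mul_le_mul_of_nonneg_right (by linarith) hℓ.le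
    obtain ⟨t, ht, z, hz1, hz2⟩ := (h.ax false).exists_near_of_loop hℓ (hI n).uLip
      (a := s n i) (b := s n j) (δ := δ n) (N := (j - i) * J) (by linarith [hδ1 n])
      (by nlinarith [(by omega : 1 ≤ j - i), (by exact_mod_cast hJ : (2 : ℤ) ≤ J)])
      (by
        rw [(hI n).eq, (hI n).eq, add_assoc, ← lat_add, ← add_smul,
          show i * (J : ℤ) + (j - i) * J = j * J by ring, M.dist_add_lat, M.dist_comm]
        exact hyd)
      (by push_cast at h1 ⊢; linarith) (by linarith [hδ1 n])
    obtain ⟨p, hp1, hp2, hp3, hp4⟩ := exists_step_mem hij ht.1 ht.2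
    refine ⟨p, t - s n p, by omega, by omega, by linarith, ?_, ?_⟩
    · have h6 := hup n p (p + 1) (by omega) (by omega) (by push_cast; omega)
      have h7 := abs_le.1 (hfy n p (p + 1))
      push_cast at h6
      rw [add_sub_cancel_left, one_mul] at h6
      linarith [h7.2, hδ1 n]
    · rw [add_sub_cancel]
      have t1 := M.dist_triangle (u n t) z (u n t + lat k)
      have t2 := M.dist_triangle z (z + lat k) (u n t + lat k)
      rw [M.dist_add_lat, M.dist_comm z (u n t)] at t2
      linarith
  choose p τ hp1 hp2 hτ0 hτ1 hτd using key
  set v : ℕ → ℝ → ℝ × ℝ := fun n t => u n (t + s n (p n)) + lat ((-(p n * J)) • k) with hv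
  have hvL : ∀ n, M.ULip (v n) := fun n => (hI n).uLip.comp_add _ _
  have hvS : ∀ n t, v n t ∈ S := fun n t => h.add_mem _ _ ((hI n).mem _)
  have hv0 : ∀ n, v n 0 = y n (p n) := fun n => by
    simp only [hv]
    rw [zero_add, (hI n).eq, add_assoc, ← lat_add, ← add_smul, add_neg_cancel, zero_smul, lat_zero,
      add_zero]
  have hpw : ∀ n, w n (p n) = X n := fun n => hw n _ (by linarith [hp1 n]) (by
    have := hp2 n
    push_cast; linarith)
  have hg : ∀ n, v n 0 ∈ M.gate S K ρ (X n) := fun n => by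
    rw [hv0, ← hpw]; exact (hI n).gate _
  obtain ⟨Y, hY⟩ := exists_eventually_eq X
  obtain ⟨C', hC'⟩ := h.exists_norm_gate
  obtain ⟨γ, hγ, hl⟩ := M.exists_limit hvL (fun n => hC' _ _ (hg n))
  have hbig : ∀ c : ℝ, ∀ᶠ n : ℕ in ulim, c ≤ (n + 1) * ℓ - B := fun c =>
    ((tendsto_natCast_atTop_atTop (R := ℝ)).mono_left ulim_le).eventually
      (eventually_ge_atTop ((c + B) / ℓ)) |>.mono fun n hn => by
        rw [div_le_iff₀ hℓ] at hn
        linarith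
  have hJ1 : (1 : ℝ) ≤ J := by exact_mod_cast (by omega : 1 ≤ J)
  have hcal : ∀ c d, c ≤ d → d - c ≤ f (γ d) - f (γ c) := fun c d hcd =>
    hf.of_limit hl hδl <| by
      filter_upwards [hbig (-c), hbig d] with n hc hd'
      have e1 := hlo n (a n) (p n) (by have := hp1 n; omega)
      have e2 := hlo n (p n) (a n + (2 * n + 2 + N n : ℕ)) (by have := hp2 n; push_cast; omega)
      have e3 := abs_le.1 (hfy n (a n) (p n))
      have e4 := abs_le.1 (hfy n (p n) (a n + (2 * n + 2 + N n : ℕ)))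
      have e5 : ((n : ℝ) + 1) * 1 ≤ ((p n - a n : ℤ) : ℝ) * J :=
        mul_le_mul (by exact_mod_cast (by have := hp1 n; omega : (n : ℤ) + 1 ≤ p n - a n)) hJ1
          (by norm_num) (by exact_mod_cast (by have := hp1 n; omega : (0 : ℤ) ≤ p n - a n))
      have e6 : ((n : ℝ) + 1) * 1 ≤ ((a n + (2 * n + 2 + N n : ℕ) - p n : ℤ) : ℝ) * J :=
        mul_le_mul (by exact_mod_cast (by have := hp2 n; push_cast; omega :
            (n : ℤ) + 1 ≤ a n + (2 * n + 2 + N n : ℕ) - p n)) hJ1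
          (by norm_num) (by
            exact_mod_cast (by have := hp2 n; push_cast; omega :
              (0 : ℤ) ≤ a n + (2 * n + 2 + N n : ℕ) - p n))
      have e7 := mul_le_mul_of_nonneg_right e5 hℓ.le
      have e8 := mul_le_mul_of_nonneg_right e6 hℓ.le
      have := hf.le_of_subset (hI n).uLip (by linarith [hd n]) (s := c + s n (p n))
        (t := d + s n (p n)) (κ := δ n) (a := s n (a n)) (b := s n (a n + (2 * n + 2 + N n : ℕ)))
        (by linarith [e3.1]) (by linarith [e4.1])
      simp only [hv]
      rw [hf.per_int, hf.per_int]
      linarith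
  obtain ⟨q, -, hq⟩ := exists_tendsto_of_isCompact isCompact_Icc
    (Eventually.of_forall fun n => (⟨hτ0 n, hτ1 n⟩ : τ n ∈ Icc 0 (J * ℓ + B + ℓ)))
  have hlq := M.tendsto_moving hvL hl hq
  have hqd : M.dist (γ q) (γ q + lat k) ≤ ℓ := by
    have h1 := M.tendsto_dist hlq (hlq.add_const (lat k))
    have h2 : Tendsto (fun n => ℓ + 5 * δ n) ulim (𝓝 (ℓ + 5 * 0)) := (hδl.const_mul 5).const_add ℓ
    rw [mul_zero, add_zero] at h2
    refine le_of_tendsto_of_tendsto' h1 h2 fun n => ?_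
    simp only [hv]
    rw [add_right_comm, M.dist_add_lat, add_comm (τ n)]
    exact hτd n
  obtain ⟨b, hb, hb0⟩ := (h.ax false).exists_through hℓ hqd
  have hγb := hf.eq_ax hℓ hγ hcal hb hb0.symm
  have hγA : M.Ax k ℓ γ := by
    have h1 : γ = fun t => b (t + (0 - q)) := funext hγb
    rw [h1]
    simpa [lat_zero] using hb.comp_add (0 - q) 0
  have hγS := h.mem_limit hvS hl
  obtain ⟨-, x, hx, hxd⟩ := h.mem_gate_limit hY hg (hl 0)
  have hr := h.uniq Y γ hγA hγS (h.detect Y γ hγA.line hγS 0 x hx hxd)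
  obtain ⟨r, hr⟩ : γ 0 ∈ range (β Y) := hr ▸ ⟨0, rfl⟩
  have h1 : Tendsto (fun n => M.dist (v n 0) (β Y r)) ulim (𝓝 0) := by
    have := M.tendsto_dist (hl 0) (tendsto_const_nhds (x := β Y r))
    rwa [← hr, M.dist_self] at this
  obtain ⟨n, hn1, hn2⟩ := ((h1.eventually (gt_mem_nhds hε)).and hY).exists
  have h2 := hn n (p n) (by linarith [hp1 n]) (by
    have := hp2 n
    push_cast; linarith) r
  rw [hn2, ← hv0] at h2
  linarith

end Config
end TorusMetric

/-! ### Chains which are minimal with respect to a sequence of gates -/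

lemma Ico_add_one_int {a b : ℤ} (h : a ≤ b) : Finset.Ico a (b + 1) = insert b (Finset.Ico a b) := by
  ext i; simp only [Finset.mem_Ico, Finset.mem_insert]; omega

lemma exists_partial_sum (d : ℤ → ℝ) : ∃ t : ℤ → ℝ, t 0 = 0 ∧ ∀ i, t (i + 1) - t i = d i := by
  refine ⟨fun i => ∑ j ∈ Finset.Ico 0 i, d j - ∑ j ∈ Finset.Ico i 0, d j, by simp, fun i => ?_⟩
  beta_reduce
  rcases lt_or_ge i 0 with hi | hi
  · have h1 : Finset.Ico i 0 = insert i (Finset.Ico (i + 1) 0) := by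
      ext; simp only [Finset.mem_Ico, Finset.mem_insert]; omega
    rw [h1, Finset.sum_insert (by simp), Finset.Ico_eq_empty (by omega : ¬ 0 < i + 1),
      Finset.Ico_eq_empty (by omega : ¬ 0 < i)]
    ring
  · rw [Ico_add_one_int hi, Finset.sum_insert (by simp),
      Finset.Ico_eq_empty (by omega : ¬ i + 1 < 0), Finset.Ico_eq_empty (by omega : ¬ i < 0)]
    ring

lemma sum_Ico_int_sub (t : ℤ → ℝ) {a b : ℤ} (h : a ≤ b) :
    ∑ i ∈ Finset.Ico a b, (t (i + 1) - t i) = t b - t a := by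
  induction b, h using Int.leInduction with
  | base => simp
  | succ b hab ih => rw [Ico_add_one_int hab, Finset.sum_insert (by simp), ih]; ring

lemma exists_window_minimizer {E : Type*} [TopologicalSpace E] {G : ℤ → Set E}
    (hG : ∀ i, IsCompact (G i)) (hne : ∀ i, (G i).Nonempty) {c : ℤ → E → E → ℝ}
    (hc : ∀ i, Continuous fun p : E × E => c i p.1 p.2) :
    ∃ y : ℤ → E, (∀ i, y i ∈ G i) ∧ ∀ a b, a ≤ b → ∀ y' : ℤ → E, (∀ i, y' i ∈ G i) →
      y' a = y a → y' b = y b →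
      ∑ i ∈ Finset.Ico a b, c i (y i) (y (i + 1)) ≤
        ∑ i ∈ Finset.Ico a b, c i (y' i) (y' (i + 1)) := by
  have hP : IsCompact (univ.pi G) := isCompact_univ_pi hG
  have hPn : (univ.pi G).Nonempty := univ_pi_nonempty_iff.2 hne
  have hF : ∀ a b : ℤ, Continuous fun y : ℤ → E =>
      ∑ i ∈ Finset.Ico a b, c i (y i) (y (i + 1)) := fun a b =>
    continuous_finsetSum _ fun i _ =>
      (hc i).comp (f := fun y : ℤ → E => (y i, y (i + 1)))
        ((continuous_apply i).prodMk (continuous_apply (i + 1)))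
  choose z hz hzm using fun n : ℕ => hP.exists_isMinOn hPn (hF (-n) n).continuousOn
  obtain ⟨y, hy, hl⟩ := exists_tendsto_of_isCompact hP (Eventually.of_forall hz)
  refine ⟨y, fun i => hy i (mem_univ i), fun a b hab y' hy' ha hb => ?_⟩
  set R : (ℤ → E) → ℤ → E := fun v i => if a < i ∧ i < b then y' i else v i with hR
  have hRc : Continuous R := by
    refine continuous_pi fun i => ?_
    simp only [hR]
    split_ifs
    · exact continuous_const
    · exact continuous_apply i
  have hRy : ∀ i, a ≤ i → i ≤ b → R y i = y' i := fun i h1 h2 => by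
    simp only [hR]
    split_ifs with h
    · rfl
    · rcases eq_or_lt_of_le h1 with rfl | h3
      · exact ha.symm
      · obtain rfl : i = b := by omega
        exact hb.symm
  have key : ∑ i ∈ Finset.Ico a b, c i (y i) (y (i + 1)) ≤
      ∑ i ∈ Finset.Ico a b, c i (R y i) (R y (i + 1)) := by
    refine le_of_tendsto_of_tendsto (((hF a b).tendsto y).comp hl)
      ((((hF a b).comp hRc).tendsto y).comp hl) ?_
    filter_upwards [ulim_le (eventually_ge_atTop (max a.natAbs b.natAbs))] with n hn
    have h1 : R (z n) ∈ univ.pi G := fun i _ => by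
      simp only [hR]
      split_ifs
      · exact hy' i
      · exact hz n i (mem_univ i)
    have h2 := isMinOn_iff.1 (hzm n) _ h1
    rw [← sub_nonneg, ← Finset.sum_sub_distrib] at h2
    rw [← Finset.sum_subset (s₁ := Finset.Ico a b)] at h2
    · rw [Finset.sum_sub_distrib, sub_nonneg] at h2
      exact h2
    · intro i hi
      simp only [Finset.mem_Ico] at hi ⊢
      omega
    · intro i _ hi
      have e1 : R (z n) i = z n i := by
        simp only [hR, Finset.mem_Ico] at hi ⊢
        rw [if_neg (by omega)]
      have e2 : R (z n) (i + 1) = z n (i + 1) := by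
        simp only [hR, Finset.mem_Ico] at hi ⊢
        rw [if_neg (by omega)]
      rw [e1, e2, sub_self]
  refine key.trans (le_of_eq (Finset.sum_congr rfl fun i hi => ?_))
  rw [Finset.mem_Ico] at hi
  rw [hRy i hi.1 hi.2.le, hRy (i + 1) (by omega) (by omega)]

namespace TorusMetric
variable {M : TorusMetric}

/-- A path through a sequence of gates, starting at time `0` in the gate with index `0`, all whose
finite pieces are the shortest concatenations of minimal segments with fixed endpoints which pass
these gates. -/
structure MinItin (M : TorusMetric) (k : ℤ × ℤ) (S : Set (ℝ × ℝ)) (K : Bool → Set (ℝ × ℝ)) (ρ : ℝ)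
    (J : ℕ) (w : ℤ → Bool) (u : ℝ → ℝ × ℝ) (s : ℤ → ℝ) (y : ℤ → ℝ × ℝ) : Prop
    extends M.Itin k S K ρ J w u s y where
  zero : s 0 = 0
  step : ∀ i, s (i + 1) - s i = M.dist (u (s i)) (u (s (i + 1)))
  min : ∀ a b, a ≤ b → ∀ (y' : ℤ → ℝ × ℝ) (p : ℤ → ℝ), (∀ i, y' i ∈ M.gate S K ρ (w i)) →
    y' a = y a → y' b = y b → (∀ i, a ≤ i → i < b →
      M.dist (y' i) (y' (i + 1) + lat ((J : ℤ) • k)) ≤ p (i + 1) - p i) → s b - s a ≤ p b - p a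

lemma dist_add_lat_succ (M : TorusMetric) (k : ℤ × ℤ) (J i : ℤ) (x y : ℝ × ℝ) :
    M.dist (x + lat ((i * J) • k)) (y + lat (((i + 1) * J) • k)) = M.dist x (y + lat (J • k)) := by
  rw [← M.dist_add_lat ((i * J) • k) x, add_assoc, ← lat_add, ← add_smul]
  congr 4; ring

namespace Config
variable {k : ℤ × ℤ} {ℓ : ℝ} {S : Set (ℝ × ℝ)} {K : Bool → Set (ℝ × ℝ)} {β : Bool → ℝ → ℝ × ℝ}
  {ρ : ℝ} {f : ℝ × ℝ → ℝ}

lemma exists_minItin (h : M.Config k ℓ S K β ρ) (hf : M.Cal k ℓ f) {B : ℝ}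
    (hB : ∀ X Y, ∀ x ∈ M.gate S K ρ X, ∀ y ∈ M.gate S K ρ Y, M.dist x y ≤ B) {J : ℕ}
    (hJ : B < J * ℓ) (w : ℤ → Bool) : ∃ u s y, M.MinItin k S K ρ J w u s y := by
  have hd : ∀ x y, Continuous fun p : (ℝ × ℝ) × (ℝ × ℝ) => M.dist (p.1 + x) (p.2 + y) := fun x y =>
    M.continuous_dist.comp
      ((continuous_fst.add continuous_const).prodMk (continuous_snd.add continuous_const))
  obtain ⟨y, hy, hm⟩ := exists_window_minimizer (fun i => h.isCompact_gate (w i))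
    (fun i => ⟨_, h.zero_mem_gate (w i)⟩)
    (c := fun i x y => M.dist (x + lat ((i * J) • k)) (y + lat (((i + 1) * J) • k)))
    (fun i => hd _ _)
  set x : ℤ → ℝ × ℝ := fun i => y i + lat ((i * J) • k) with hx
  obtain ⟨s, hs0, hs⟩ := exists_partial_sum fun i => M.dist (x i) (x (i + 1))
  have hr : ∀ i, J * ℓ - B ≤ M.dist (x i) (x (i + 1)) := fun i => by
    have h1 := hf.lip (x i) (x (i + 1))
    simp only [hx] at h1 ⊢
    rw [hf.per_int, hf.per_int] at h1
    have h2 := abs_le.1 ((hf.abs_sub_le (y i) (y (i + 1))).trans (hB _ _ _ (hy i) _ (hy (i + 1))))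
    push_cast at h1
    linarith [h2.1]
  have hr0 : 0 < J * ℓ - B := by linarith
  obtain ⟨u, hu, hux⟩ := M.exists_chain hr0 hs hr
  have hxS : ∀ i, x i ∈ S := fun i => h.add_mem _ _ (hy i).1
  refine ⟨u, s, y, ⟨hu, monotone_int_of_le_succ fun i => by linarith [hs i, hr i], fun t => ?_, hy,
    hux⟩, hs0, fun i => by rw [hs, hux, hux], fun a b hab y' p hy' ha hb hp => ?_⟩
  · obtain ⟨i, h1, h2⟩ := exists_index hr0 (fun i => by rw [hs]; exact hr i) t
    exact h.convex u (s i) (s (i + 1)) (hu.isoOn (by rw [hs, hux, hux])) (by rw [hux]; exact hxS i)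
      (by rw [hux]; exact hxS _) t h1 h2.le
  · rw [← sum_Ico_int_sub s hab, ← sum_Ico_int_sub p hab]
    simp only [hs]
    refine (hm a b hab y' hy' ha hb).trans (Finset.sum_le_sum fun i hi => ?_)
    rw [Finset.mem_Ico] at hi
    rw [M.dist_add_lat_succ]
    exact hp i hi.1 hi.2

end Config
end TorusMetric

/-! ### Estimates for minimal chains -/

namespace TorusMetric
variable {M : TorusMetric}

namespace MinItin
variable {k : ℤ × ℤ} {ℓ : ℝ} {S : Set (ℝ × ℝ)} {K : Bool → Set (ℝ × ℝ)} {β : Bool → ℝ → ℝ × ℝ}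
  {ρ : ℝ} {f : ℝ × ℝ → ℝ} {B : ℝ} {J : ℕ} {w : ℤ → Bool} {u : ℝ → ℝ × ℝ} {s : ℤ → ℝ}
  {y : ℤ → ℝ × ℝ}

lemma f_eq (hm : M.MinItin k S K ρ J w u s y) (hf : M.Cal k ℓ f) (i : ℤ) :
    f (u (s i)) = f (y i) + i * (J * ℓ) := by
  rw [hm.eq, hf.per_int]; push_cast; ring

lemma f_sub_le (hm : M.MinItin k S K ρ J w u s y) (hf : M.Cal k ℓ f)
    (hB : ∀ X Y, ∀ x ∈ M.gate S K ρ X, ∀ y ∈ M.gate S K ρ Y, M.dist x y ≤ B) (i j : ℤ) :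
    |f (y j) - f (y i)| ≤ B :=
  (hf.abs_sub_le _ _).trans (hB _ _ _ (hm.gate i) _ (hm.gate j))

lemma le_sub (hm : M.MinItin k S K ρ J w u s y) (hf : M.Cal k ℓ f)
    (hB : ∀ X Y, ∀ x ∈ M.gate S K ρ X, ∀ y ∈ M.gate S K ρ Y, M.dist x y ≤ B) {i j : ℤ}
    (hij : i ≤ j) : (j - i) * (J * ℓ) - B ≤ s j - s i := by
  have h1 := hf.le_of_uLip hm.uLip (hm.mono hij)
  rw [hm.f_eq hf, hm.f_eq hf] at h1
  linarith [(abs_le.1 (hm.f_sub_le hf hB i j)).1]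

lemma sub_le_of_const (hm : M.MinItin k S K ρ J w u s y) (h : M.Config k ℓ S K β ρ)
    (hB : ∀ X Y, ∀ x ∈ M.gate S K ρ X, ∀ y ∈ M.gate S K ρ Y, M.dist x y ≤ B) {X : Bool} {a b : ℤ}
    (hab : a ≤ b) (hw : ∀ i, a < i → i < b → w i = X) :
    s b - s a ≤ (b - a) * (J * ℓ) + 2 * B := by
  have hB0 : 0 ≤ B := (M.dist_nonneg _ _).trans (hB _ _ _ (hm.gate 0) _ (hm.gate 0))
  rcases eq_or_lt_of_le hab with rfl | hlt
  · simpa using hB0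
  have h1 := hm.min a b hab (fun i => if a < i ∧ i < b then β X 0 else y i)
    (fun i => i * (J * ℓ) + (if i ≤ a then -B else if b ≤ i then B else 0)) (fun i => by
      split_ifs with hi
      · rw [hw i hi.1 hi.2]; exact h.zero_mem_gate X
      · exact hm.gate i) (by simp) (by simp) (fun i h1 h2 => by
      have t1 := M.dist_triangle (if a < i ∧ i < b then β X 0 else y i) (β X 0)
        ((if a < i + 1 ∧ i + 1 < b then β X 0 else y (i + 1)) + lat ((J : ℤ) • k))
      have t2 := M.dist_triangle (β X 0) (β X 0 + lat ((J : ℤ) • k))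
        ((if a < i + 1 ∧ i + 1 < b then β X 0 else y (i + 1)) + lat ((J : ℤ) • k))
      rw [M.dist_add_lat, (h.ax X).dist_add h.pos] at t2
      have t3 : M.dist (if a < i ∧ i < b then β X 0 else y i) (β X 0) ≤ if i ≤ a then B else 0 := by
        split_ifs with h3 h4 h4
        · omega
        · rw [M.dist_self]
        · exact hB _ _ _ (hm.gate i) _ (h.zero_mem_gate X)
        · omega
      have t4 : M.dist (β X 0) (if a < i + 1 ∧ i + 1 < b then β X 0 else y (i + 1)) ≤
          if b ≤ i + 1 then B else 0 := by
        split_ifs with h3 h4 h4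
        · omega
        · rw [M.dist_self]
        · exact hB _ _ _ (h.zero_mem_gate X) _ (hm.gate (i + 1))
        · omega
      have t5 : (if i + 1 ≤ a then -B else if b ≤ i + 1 then B else 0) -
          (if i ≤ a then -B else if b ≤ i then B else 0) =
          (if b ≤ i + 1 then B else 0) + if i ≤ a then B else 0 := by
        rw [if_neg (by omega : ¬ i + 1 ≤ a), if_neg (by omega : ¬ b ≤ i)]
        split_ifs <;> ring
      push_cast
      linarith)
  simp only [le_refl, if_true, if_neg (not_le.2 hlt)] at h1
  linarith

lemma succ_le (hm : M.MinItin k S K ρ J w u s y) (h : M.Config k ℓ S K β ρ)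
    (hB : ∀ X Y, ∀ x ∈ M.gate S K ρ X, ∀ y ∈ M.gate S K ρ Y, M.dist x y ≤ B) (i : ℤ) :
    s (i + 1) - s i ≤ J * ℓ + 2 * B := by
  have := hm.sub_le_of_const h hB (X := true) (a := i) (b := i + 1) (by omega)
    (fun j h1 h2 => by omega)
  push_cast at this
  linarith

lemma sub_le_of_two (hm : M.MinItin k S K ρ J w u s y) (h : M.Config k ℓ S K β ρ)
    {X Y : Bool} {a e b : ℤ} (hae : a < e) (heb : e + 1 < b) (hwX : ∀ i, a < i → i ≤ e → w i = X)
    (hwY : ∀ i, e < i → i < b → w i = Y) {A c A' : ℝ}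
    (hA : M.dist (y a) (β X 0 + lat ((J : ℤ) • k)) ≤ J * ℓ + A)
    (hc : M.dist (β X 0) (β Y 0 + lat ((J : ℤ) • k)) ≤ J * ℓ + c)
    (hA' : M.dist (β Y 0) (y b + lat ((J : ℤ) • k)) ≤ J * ℓ + A') :
    s b - s a ≤ (b - a) * (J * ℓ) + A + c + A' := by
  have h1 := hm.min a b (by omega)
    (fun i => if i ≤ a then y i else if i ≤ e then β X 0 else if i < b then β Y 0 else y i)
    (fun i => i * (J * ℓ) + (if i ≤ a then -A else if i ≤ e then 0 else if i < b then c else c + A'))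
    (fun i => by
      split_ifs with h1 h2 h3
      · exact hm.gate i
      · rw [hwX i (by omega) h2]; exact h.zero_mem_gate X
      · rw [hwY i (by omega) h3]; exact h.zero_mem_gate Y
      · exact hm.gate i) (by simp) (by
      simp only [if_neg (by omega : ¬ b ≤ a), if_neg (by omega : ¬ b ≤ e), lt_irrefl, if_false])
    (fun i h1 h2 => by
      rcases lt_trichotomy i e with h3 | rfl | h3
      · rw [if_neg (by omega : ¬ i + 1 ≤ a), if_pos (by omega : i + 1 ≤ e),
          if_neg (by omega : ¬ i + 1 ≤ a), if_pos (by omega : i + 1 ≤ e)]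
        rcases eq_or_lt_of_le h1 with rfl | h4
        · rw [if_pos le_rfl, if_pos le_rfl]; push_cast; linarith
        · rw [if_neg (by omega), if_pos h3.le, if_neg (by omega), if_pos h3.le,
            (h.ax X).dist_add h.pos]
          push_cast; linarith
      · simp only [if_neg (by omega : ¬ i + 1 ≤ a), if_neg (by omega : ¬ i + 1 ≤ i), if_pos heb,
          if_neg (by omega : ¬ i ≤ a), le_refl, if_true]
        push_cast; linarith
      · simp only [if_neg (by omega : ¬ i + 1 ≤ a), if_neg (by omega : ¬ i + 1 ≤ e),
          if_neg (by omega : ¬ i ≤ a), if_neg (by omega : ¬ i ≤ e), if_pos h2]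
        by_cases h4 : i + 1 < b
        · rw [if_pos h4, if_pos h4, (h.ax Y).dist_add h.pos]
          push_cast; linarith
        · obtain rfl : i + 1 = b := by omega
          simp only [lt_irrefl, if_false]
          push_cast; linarith)
  simp only [le_refl, if_true, if_neg (by omega : ¬ b ≤ a), if_neg (by omega : ¬ b ≤ e), lt_irrefl,
    if_false] at h1
  linarith

/-- Between two sites at which the chain is close to the axes, with at most one change of letter,
the chain is almost minimizing. -/
lemma sub_le_dist (hm : M.MinItin k S K ρ J w u s y) (h : M.Config k ℓ S K β ρ)
    (hf : M.Cal k ℓ f) (hB : ∀ X Y, ∀ x ∈ M.gate S K ρ X, ∀ y ∈ M.gate S K ρ Y, M.dist x y ≤ B)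
    {ε : ℝ} (hJ : B + ε ≤ J * ℓ) {D : Bool → Bool → ℝ}
    (hD : ∀ X Y s t, D X Y + (t - s) ≤ M.dist (β X s) (β Y t))
    (hD' : ∀ X Y, M.dist (β X 0) (β Y 0 + lat ((J : ℤ) • k)) ≤ J * ℓ + D X Y + ε)
    {X Y : Bool} {a e b : ℤ} (hae : a < e) (heb : e + 1 < b)
    (hwX : ∀ i, a ≤ i → i ≤ e → w i = X) (hwY : ∀ i, e < i → i ≤ b → w i = Y)
    (ha : ∃ r, M.dist (y a) (β X r) ≤ ε) (hb : ∃ r, M.dist (y b) (β Y r) ≤ ε) :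
    s b - s a ≤ M.dist (u (s a)) (u (s b)) + 5 * ε ∧
      (X = Y → s b - s a ≤ f (u (s b)) - f (u (s a)) + 5 * ε) := by
  have hr : ∀ X i r, M.dist (y i) (β X r) ≤ ε → |r| ≤ B + ε ∧ |f (y i) - f (β X 0) - r| ≤ ε := by
    intro X i r hd
    have h1 := hf.ax h.pos (h.ax X) 0 r
    have h2 := abs_le.1 (hf.abs_sub_le (y i) (β X r))
    have h3 := abs_le.1 ((hf.abs_sub_le (y i) (β X 0)).trans
      (hB _ _ _ (hm.gate i) _ (h.zero_mem_gate X)))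
    exact ⟨abs_le.2 ⟨by linarith [h2.1, h2.2, h3.1, h3.2], by linarith [h2.1, h2.2, h3.1, h3.2]⟩,
      abs_le.2 ⟨by linarith [h2.1, h2.2], by linarith [h2.1, h2.2]⟩⟩
  have hper : ∀ X, ∀ (n : ℤ) r, β X r + lat ((n * J) • k) = β X (r + n * (J * ℓ)) := fun X n r => by
    rw [← (h.ax X).per_int]; congr 1; push_cast; ring
  obtain ⟨r, hra⟩ := ha
  obtain ⟨r', hrb⟩ := hb
  obtain ⟨a1, a2⟩ := hr _ _ _ hra
  obtain ⟨b1, b2⟩ := hr _ _ _ hrb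
  have k1 : ∀ X, β X 0 + lat ((J : ℤ) • k) = β X (J * ℓ) := fun X => by
    have := hper X 1 0
    simpa using this
  have k2 : β Y r' + lat ((J : ℤ) • k) = β Y (r' + J * ℓ) := by
    have := hper Y 1 r'
    simpa using this
  rw [abs_le] at a1 b1 a2 b2
  have key := hm.sub_le_of_two h hae heb (fun i h1 h2 => hwX i h1.le h2)
    (fun i h1 h2 => hwY i h1 h2.le) (A := ε - r) (c := D X Y + ε) (A' := r' + ε) (by
      have t1 := M.dist_triangle (y a) (β X r) (β X (J * ℓ))
      rw [(h.ax X).line _ _ (by linarith [a1.2])] at t1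
      rw [k1]; linarith) (by linarith [hD' X Y]) (by
      have t1 := M.dist_triangle (β Y 0) (β Y (r' + J * ℓ)) (y b + lat ((J : ℤ) • k))
      rw [(h.ax Y).line _ _ (by linarith [b1.1]), ← k2, M.dist_add_lat, M.dist_comm _ (y b)] at t1
      linarith)
  have h1 := hD X Y (r + a * (J * ℓ)) (r' + b * (J * ℓ))
  rw [← hper, ← hper] at h1
  have e1 : M.dist (β X r + lat ((a * J) • k)) (u (s a)) ≤ ε := by
    rw [hm.eq, M.dist_add_lat, M.dist_comm]; exact hra
  have e2 : M.dist (u (s b)) (β Y r' + lat ((b * J) • k)) ≤ ε := by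
    rw [hm.eq, M.dist_add_lat]; exact hrb
  have t1 := M.dist_triangle (β X r + lat ((a * J) • k)) (u (s a)) (β Y r' + lat ((b * J) • k))
  have t2 := M.dist_triangle (u (s a)) (u (s b)) (β Y r' + lat ((b * J) • k))
  refine ⟨by linarith, fun hXY => ?_⟩
  subst hXY
  have h2 := hD X X 0 0
  rw [M.dist_self] at h2
  rw [hm.f_eq hf, hm.f_eq hf]
  linarith [a2.1, a2.2, b2.1, b2.2]

end MinItin
end TorusMetric

/-! ### Minimal chains are geodesics -/

namespace TorusMetric
variable {M : TorusMetric} {k : ℤ × ℤ} {ℓ : ℝ} {S : Set (ℝ × ℝ)} {K : Bool → Set (ℝ × ℝ)}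
  {β : Bool → ℝ → ℝ × ℝ} {ρ : ℝ} {f : ℝ × ℝ → ℝ} {B : ℝ} {J : ℕ}

lemma Config.exists_good_site (h : M.Config k ℓ S K β ρ) (hf : M.Cal k ℓ f)
    (hB : ∀ X Y, ∀ x ∈ M.gate S K ρ X, ∀ y ∈ M.gate S K ρ Y, M.dist x y ≤ B) (hJ : 2 ≤ J) {ε : ℝ}
    (hε : 0 < ε) : ∃ m : ℕ, ∀ w u s y, M.MinItin k S K ρ J w u s y → ∀ X, ∀ a : ℤ,
      (∀ i, a ≤ i → i ≤ a + m → w i = X) →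
      ∃ i, a ≤ i ∧ i ≤ a + m ∧ ∃ r, M.dist (y i) (β X r) ≤ ε := by
  obtain ⟨δ, hδ, L, H⟩ := h.exists_good hf hJ hε
  obtain ⟨Q, hQ⟩ := exists_nat_gt (3 * B / δ)
  rw [div_lt_iff₀ hδ] at hQ
  refine ⟨Q * L, fun w u s y hm X a hw => ?_⟩
  by_contra! hn
  have key : ∀ j : ℕ, j ≤ Q → j * δ ≤ (s (a + j * L) - f (u (s (a + j * L)))) -
      (s a - f (u (s a))) := by
    intro j
    induction j with
    | zero => simp
    | succ j ih =>
      intro hj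
      have h1 := ih (by omega)
      have h2 : (j : ℤ) * L + L ≤ Q * L := by
        have : ((j : ℤ) + 1) * L ≤ Q * L :=
          mul_le_mul_of_nonneg_right (by omega) (by positivity)
        linarith
      have h3 : (0 : ℤ) ≤ j * L := by positivity
      have h4 : ¬ (s (a + j * L + L) - s (a + j * L) ≤
          f (u (s (a + j * L + L))) - f (u (s (a + j * L))) + δ) := fun hle => by
        obtain ⟨i, i1, i2, r, hr⟩ := H w u s y hm.toItin X (a + j * L)
          (fun i i1 i2 => hw i (by omega) (by push_cast; omega)) hle
        exact absurd hr (not_le.2 (hn i (by omega) (by push_cast; omega) r))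
      rw [show a + ((j + 1 : ℕ) : ℤ) * L = a + j * L + L by push_cast; ring]
      push_cast
      linarith
  have h1 := key Q le_rfl
  have h2 := hm.sub_le_of_const h hB (X := X) (a := a) (b := a + Q * L)
    (by have : (0 : ℤ) ≤ Q * L := by positivity
        omega) (fun i h1 h2 => hw i h1.le (by push_cast; exact h2.le))
  rw [hm.f_eq hf, hm.f_eq hf] at h1
  have h3 := (abs_le.1 (hm.f_sub_le hf hB a (a + Q * L))).1
  push_cast at h1 h2
  linarith

namespace MinItin
variable {w : ℤ → Bool} {u : ℝ → ℝ × ℝ} {s : ℤ → ℝ} {y : ℤ → ℝ × ℝ}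

/-- The path moved back such that the site `i` is passed at time `0` in the gate itself. -/
lemma recentre (hm : M.MinItin k S K ρ J w u s y) (h : M.Config k ℓ S K β ρ) (i : ℤ) :
    M.ULip (fun t => u (t + s i) + lat ((-(i * J)) • k)) ∧
    (∀ t, u (t + s i) + lat ((-(i * J)) • k) ∈ S) ∧ u (0 + s i) + lat ((-(i * J)) • k) = y i := by
  refine ⟨hm.uLip.comp_add _ _, fun t => h.add_mem _ _ (hm.mem _), ?_⟩
  rw [zero_add, hm.eq, add_assoc, ← lat_add, ← add_smul, add_neg_cancel, zero_smul, lat_zero,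
    add_zero]

/-- If the chain passes the gate `i` at a time different from `s i` then it is a geodesic near
the time `s i`. -/
lemma exists_isoOn (hm : M.MinItin k S K ρ J w u s y) (i : ℤ) {t : ℝ} (ht0 : t ≠ 0)
    (h1 : s (i - 1) ≤ s i + t) (h2 : s i + t ≤ s (i + 1)) (hs1 : s (i - 1) < s i)
    (hs2 : s i < s (i + 1))
    (hg : u (t + s i) + lat ((-(i * J)) • k) ∈ M.gate S K ρ (w i)) :
    ∃ ε > 0, M.IsoOn u (s i - ε) (s i + ε) := by
  set z := u (t + s i) + lat ((-(i * J)) • k) with hz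
  have hz' : u (s i + t) = z + lat ((i * J) • k) := by
    rw [hz, add_assoc, ← lat_add, ← add_smul, neg_add_cancel, zero_smul, lat_zero, add_zero, add_comm]
  have e1 : M.dist (u (s (i - 1))) (u (s i + t)) = M.dist (y (i - 1)) (z + lat ((J : ℤ) • k)) := by
    rw [hm.eq, hz', ← M.dist_add_lat_succ k J (i - 1), sub_add_cancel]
  have e2 : M.dist (u (s i + t)) (u (s (i + 1))) = M.dist z (y (i + 1) + lat ((J : ℤ) • k)) := by
    rw [hm.eq, hz', M.dist_add_lat_succ]
  have key := hm.min (i - 1) (i + 1) (by omega) (fun j => if j = i then z else y j)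
    (fun j => if j = i - 1 then 0 else if j = i then M.dist (u (s (i - 1))) (u (s i + t)) else
      M.dist (u (s (i - 1))) (u (s i + t)) + M.dist (u (s i + t)) (u (s (i + 1))))
    (fun j => by
      split_ifs with hj
      · rw [hj]; exact hg
      · exact hm.gate j) (if_neg (by omega)) (if_neg (by omega)) (fun j j1 j2 => by
      obtain rfl | rfl : j = i - 1 ∨ j = i := by omega
      · simp only [sub_add_cancel, if_true, if_neg (by omega : ¬ i - 1 = i),
          if_neg (by omega : ¬ i = i - 1), sub_zero]
        exact e1.ge
      · simp only [if_true, if_neg (by omega : ¬ j + 1 = j - 1),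
          if_neg (by omega : ¬ j + 1 = j), if_neg (by omega : ¬ j = j - 1), add_sub_cancel_left]
        exact e2.ge)
  simp only [if_true, if_neg (by omega : ¬ i + 1 = i - 1), if_neg (by omega : ¬ i + 1 = i)] at key
  have d1 := hm.uLip _ _ h1
  have d2 := hm.uLip _ _ h2
  rcases lt_or_gt_of_ne ht0 with hlt | hgt
  · have := hm.uLip.isoOn (a := s i + t) (b := s (i + 1)) (by linarith)
    exact ⟨Min.min (-t) (s (i + 1) - s i), lt_min (by linarith) (by linarith),
      this.mono (by linarith [min_le_left (-t) (s (i + 1) - s i)])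
        (by linarith [min_le_right (-t) (s (i + 1) - s i)])⟩
  · have := hm.uLip.isoOn (a := s (i - 1)) (b := s i + t) (by linarith)
    exact ⟨Min.min t (s i - s (i - 1)), lt_min (by linarith) (by linarith),
      this.mono (by linarith [min_le_right t (s i - s (i - 1))])
        (by linarith [min_le_left t (s i - s (i - 1))])⟩

/-- A chain which is almost minimizing near each site is a geodesic. -/
lemma locIso (hm : M.MinItin k S K ρ J w u s y) (h : M.Config k ℓ S K β ρ) (hf : M.Cal k ℓ f)
    (hB : ∀ X Y, ∀ x ∈ M.gate S K ρ X, ∀ y ∈ M.gate S K ρ Y, M.dist x y ≤ B) {T κ : ℝ}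
    (hT : 0 < T) (hJ : B + T < J * ℓ)
    (hE : ∀ X u, M.ULip u → (∀ t, u t ∈ S) → 2 * T ≤ M.dist (u (-T)) (u T) + κ →
      u 0 ∈ M.gate S K ρ X → ∃ t, |t| ≤ T ∧ ∃ y ∈ K X, M.dist y (u t) < ρ)
    (hw : ∀ i, ∃ a b, a < i ∧ i < b ∧ s b - s a ≤ M.dist (u (s a)) (u (s b)) + κ) :
    M.LocIso u := by
  have hsp : ∀ i, T < s (i + 1) - s i := fun i => by
    have := hm.le_sub hf hB (i := i) (j := i + 1) (by omega)
    push_cast at this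
    linarith
  have hsp' : ∀ i, T < s i - s (i - 1) := fun i => by
    have := hsp (i - 1); rwa [sub_add_cancel] at this
  have hsite : ∀ i, ∃ ε > 0, M.IsoOn u (s i - ε) (s i + ε) := by
    intro i
    obtain ⟨a, b, ha, hb, hab⟩ := hw i
    obtain ⟨r1, r2, r3⟩ := hm.recentre h i
    have hsa : s a ≤ s (i - 1) := hm.mono (by omega)
    have hsb : s (i + 1) ≤ s b := hm.mono (by omega)
    obtain ⟨t, ht, x, hx, hd⟩ := hE (w i) _ r1 r2 (by
      rw [M.dist_add_lat]
      have := hm.uLip.sub_le hab (s := -T + s i) (t := T + s i) (by linarith [hsp' i])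
        (by linarith [hsp i])
      linarith) (by rw [r3]; exact hm.gate i)
    have hc : Continuous fun t => M.dist x (u (t + s i) + lat ((-(i * J)) • k)) :=
      M.continuous_dist.comp (continuous_const.prodMk r1.continuous)
    have hnear : ∀ᶠ t' in 𝓝 t, M.dist x (u (t' + s i) + lat ((-(i * J)) • k)) < ρ ∧
        s (i - 1) < s i + t' ∧ s i + t' < s (i + 1) := by
      rw [abs_le] at ht
      refine (hc.continuousAt.eventually (gt_mem_nhds hd)).and
        (((continuous_const.add continuous_id).continuousAt.eventually (lt_mem_nhds ?_)).and
          ((continuous_const.add continuous_id).continuousAt.eventually (gt_mem_nhds ?_)))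
      · show s (i - 1) < s i + t
        linarith [hsp' i]
      · show s i + t < s (i + 1)
        linarith [hsp i]
    obtain ⟨t', ⟨h1, h2, h3⟩, h4⟩ : ∃ t', (M.dist x (u (t' + s i) + lat ((-(i * J)) • k)) < ρ ∧
        s (i - 1) < s i + t' ∧ s i + t' < s (i + 1)) ∧ t' ≠ 0 := by
      by_cases h0 : t = 0
      · subst h0
        have h5 : ∀ᶠ t' : ℝ in 𝓝[≠] 0, t' ≠ 0 := eventually_mem_nhdsWithin
        exact ((hnear.filter_mono nhdsWithin_le_nhds).and h5).exists
      · exact ⟨t, hnear.self_of_nhds, h0⟩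
    exact hm.exists_isoOn i h4 h2.le h3.le (by linarith [hsp' i]) (by linarith [hsp i])
      ⟨r2 t', x, hx, h1.le⟩
  intro t
  obtain ⟨i, h1, h2⟩ := exists_index hT (fun i => (hsp i).le) t
  rcases eq_or_lt_of_le h1 with h3 | h3
  · rw [← h3]; exact hsite i
  · have := hm.uLip.isoOn (a := s i) (b := s (i + 1)) (by rw [hm.step])
    exact ⟨Min.min (t - s i) (s (i + 1) - t), lt_min (by linarith) (by linarith),
      this.mono (by linarith [min_le_left (t - s i) (s (i + 1) - t)])
        (by linarith [min_le_right (t - s i) (s (i + 1) - t)])⟩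

end MinItin
end TorusMetric

/-! ### Separation of the geodesics of different words -/

namespace TorusMetric
variable {M : TorusMetric} {k : ℤ × ℤ} {ℓ : ℝ} {S : Set (ℝ × ℝ)} {K : Bool → Set (ℝ × ℝ)}
  {β : Bool → ℝ → ℝ × ℝ} {ρ : ℝ} {f : ℝ × ℝ → ℝ} {B : ℝ} {J : ℕ}

namespace MinItin
variable {w w' : ℤ → Bool} {u u' : ℝ → ℝ × ℝ} {s s' : ℤ → ℝ} {y y' : ℤ → ℝ × ℝ}

/-- A point close to the site `g` of a path is not passed by another path too early or too
late. -/
lemma mem_Icc_of_dist_le (hm : M.MinItin k S K ρ J w u s y) (hm' : M.MinItin k S K ρ J w' u' s' y')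
    (h : M.Config k ℓ S K β ρ) (hf : M.Cal k ℓ f)
    (hB : ∀ X Y, ∀ x ∈ M.gate S K ρ X, ∀ y ∈ M.gate S K ρ Y, M.dist x y ≤ B) {ε : ℝ} (hε : 0 ≤ ε)
    (hJ : 3 * B + ε < J * ℓ) {g a b : ℤ} (ha : a < g) (hb : g + 1 < b) {t : ℝ}
    (ht : M.dist (u (s g)) (u' t) ≤ ε) :
    s' a ≤ t ∧ t ≤ s' b ∧ |f (u' t) - f (u' (s' g))| ≤ B + ε := by
  have hB0 : 0 ≤ B := (M.dist_nonneg _ _).trans (hB _ _ _ (hm.gate 0) _ (hm.gate 0))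
  have hy : ∀ i, |f (y' i) - f (y g)| ≤ B := fun i =>
    (hf.abs_sub_le _ _).trans (hB _ _ _ (hm.gate g) _ (hm'.gate i))
  have h1 := abs_le.1 ((hf.abs_sub_le _ _).trans ht)
  have h2 := hm.f_eq hf g
  have hlast : |f (u' t) - f (u' (s' g))| ≤ B + ε := by
    have h3 := abs_le.1 (hy g)
    rw [hm'.f_eq hf, abs_le]
    constructor <;> linarith
  have hpos : 0 < J * ℓ - B := by linarith
  obtain ⟨i, hi, hi'⟩ := exists_index hpos (fun i => by
    have := hm'.le_sub hf hB (i := i) (j := i + 1) (by omega)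
    push_cast at this
    linarith) t
  have h3 := abs_le.1 (hy i)
  have h4 := abs_le.1 ((hf.abs_sub_le (u' (s' i)) (u' t)).trans (hm'.uLip _ _ hi))
  have h5 := hm'.succ_le h hB i
  have h6 := hm'.f_eq hf i
  have h7 : ((i - g - 2 : ℤ) : ℝ) * (J * ℓ) < 0 := by push_cast; linarith
  have h8 : ((g - i - 2 : ℤ) : ℝ) * (J * ℓ) < 0 := by push_cast; linarith
  have hJ0 : 0 ≤ J * ℓ := by linarith
  have h9 : i - g - 2 < 0 := by exact_mod_cast neg_of_mul_neg_left h7 hJ0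
  have h10 : g - i - 2 < 0 := by exact_mod_cast neg_of_mul_neg_left h8 hJ0
  exact ⟨(hm'.mono (by omega)).trans hi, hi'.le.trans (hm'.mono (by omega)), hlast⟩

lemma le_mul (hm : M.MinItin k S K ρ J w u s y) (h : M.Config k ℓ S K β ρ)
    (hB : ∀ X Y, ∀ x ∈ M.gate S K ρ X, ∀ y ∈ M.gate S K ρ Y, M.dist x y ≤ B) {i : ℤ}
    (hi : 0 ≤ i) : s i ≤ i * (J * ℓ + 2 * B) := by
  induction i, hi using Int.leInduction with
  | base => simp [hm.zero]
  | succ i hi ih =>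
    push_cast
    linarith [hm.succ_le h hB i]

/-- Two paths whose words differ on a long stretch get apart from each other. -/
lemma exists_lt_dist (hm : M.MinItin k S K ρ J w u s y) (hm' : M.MinItin k S K ρ J w' u' s' y')
    (h : M.Config k ℓ S K β ρ) (hf : M.Cal k ℓ f)
    (hB : ∀ X Y, ∀ x ∈ M.gate S K ρ X, ∀ y ∈ M.gate S K ρ Y, M.dist x y ≤ B) {ε ε₁ T δ : ℝ}
    (hε₁ : 0 ≤ ε₁) (hJ : 3 * B + ε₁ < J * ℓ) (hJT : B + T < J * ℓ)
    (haway : ∀ X Y, X ≠ Y → ∀ x ∈ M.gate S K ρ X, ∀ r, 2 * ε₁ < M.dist x (β Y r))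
    (hstay : ∀ X u, M.ULip u → 2 * T ≤ f (u T) - f (u (-T)) + δ → u 0 ∈ M.gate S K ρ X →
      (∃ r, M.dist (u 0) (β X r) ≤ δ) → ∀ t, |t| ≤ B + ε₁ + δ → ∃ r, M.dist (u t) (β X r) ≤ ε₁)
    (hεδ : ε ≤ δ) {a g b : ℤ} (hag : a < g) (hgb : g + 1 < b) (hg : w g ≠ w' g)
    (hab : s' b - s' a ≤ f (u' (s' b)) - f (u' (s' a)) + δ)
    (hy : ∃ r, M.dist (y' g) (β (w' g) r) ≤ ε) : ε₁ < M.dist (u (s g)) (u' (s g)) := by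
  by_contra! hn
  obtain ⟨h1, h2, h3⟩ := hm.mem_Icc_of_dist_le hm' h hf hB hε₁ hJ hag hgb hn
  obtain ⟨r1, r2, r3⟩ := hm'.recentre h g
  have hag' := hm'.le_sub hf hB (i := a) (j := g) hag.le
  have hgb' := hm'.le_sub hf hB (i := g) (j := b) (by omega)
  have hJ0 : 0 ≤ J * ℓ := by
    have hB0 : 0 ≤ B := (M.dist_nonneg _ _).trans (hB _ _ _ (hm.gate 0) _ (hm.gate 0))
    linarith
  have hag1 : (1 : ℝ) ≤ g - a := by
    have : (1 : ℤ) ≤ g - a := by omega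
    exact_mod_cast this
  have hgb1 : (1 : ℝ) ≤ b - g := by
    have : (1 : ℤ) ≤ b - g := by omega
    exact_mod_cast this
  have hag2 : B + T < (g - a) * (J * ℓ) := by nlinarith
  have hgb2 : B + T < (b - g) * (J * ℓ) := by nlinarith
  have htime : |s g - s' g| ≤ B + ε₁ + δ := by
    rw [abs_le] at h3 ⊢
    constructor
    · linarith [hf.le_of_subset hm'.uLip hab h1 (hm'.mono (show g ≤ b by omega))]
    · linarith [hf.le_of_subset hm'.uLip hab (hm'.mono hag.le) h2]
  obtain ⟨r, hr⟩ := hstay (w' g) _ r1 (by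
    rw [hf.per_int, hf.per_int]
    have := hf.le_of_subset hm'.uLip hab (s := -T + s' g) (t := T + s' g) (by linarith)
      (by linarith)
    linarith) (by rw [r3]; exact hm'.gate g) (by
      obtain ⟨r, hr⟩ := hy
      exact ⟨r, by rw [r3]; exact hr.trans hεδ⟩) (s g - s' g) htime
  rw [sub_add_cancel] at hr
  have h4 := haway (w g) (w' g) hg (y g) (hm.gate g) r
  have h5 := M.dist_triangle (y g) (u' (s g) + lat ((-(g * J)) • k)) (β (w' g) r)
  have h6 : M.dist (y g) (u' (s g) + lat ((-(g * J)) • k)) = M.dist (u (s g)) (u' (s g)) := by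
    rw [← M.dist_add_lat ((-(g * J)) • k) (u (s g)), hm.eq, add_assoc (y g), ← lat_add, ← add_smul,
      add_neg_cancel, zero_smul, lat_zero, add_zero]
  linarith

end MinItin

lemma ediv_eq_of_mem {N i q : ℤ} (hN : 0 < N) (h1 : q * N ≤ i) (h2 : i < q * N + N) : i / N = q :=
  le_antisymm (Int.lt_add_one_iff.1 (Int.ediv_lt_of_lt_mul hN (by rw [add_mul, one_mul]; exact h2)))
    (Int.le_ediv_of_mul_le hN h1)

/-- All words are realized by geodesics which start in a bounded set, and geodesics of different
words get apart from each other. -/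
theorem Config.exists_separated (h : M.Config k ℓ S K β ρ) (hf : M.Cal k ℓ f) :
    ∃ A : ℝ, 0 < A ∧ ∃ ε > 0, ∃ C, ∃ G : (ℤ → Bool) → ℝ → ℝ × ℝ, (∀ σ, M.LocIso (G σ)) ∧
      (∀ σ, ‖G σ 0‖ ≤ C) ∧ ∀ (n : ℕ) σ σ' (q : ℤ), 0 ≤ q → q < n → σ q ≠ σ' q →
        ∃ t, 0 ≤ t ∧ t ≤ n * A ∧ ε < M.dist (G σ t) (G σ' t) := by
  have hℓ := h.pos
  obtain ⟨C, hC⟩ := h.exists_norm_gate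
  obtain ⟨B, hB0, hB⟩ := h.exists_dist_gate
  obtain ⟨T₀, hT₀, κ, hκ, hE⟩ := h.exists_enter
  obtain ⟨ε₁, hε₁, haway⟩ := h.exists_away hf
  obtain ⟨T₁, hT₁, δ, hδ, hstay⟩ := h.exists_stay hf (B + ε₁ / 2 + 1) (half_pos hε₁)
  set δ' := min δ 1 with hδ'
  have hδ'0 : 0 < δ' := lt_min hδ one_pos
  set ε := min κ δ' / 5 with hε
  have hε0 : 0 < ε := div_pos (lt_min hκ hδ'0) (by norm_num)
  have hεκ : 5 * ε ≤ κ := by rw [hε]; linarith [min_le_left κ δ']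
  have hεδ : 5 * ε ≤ δ' := by rw [hε]; linarith [min_le_right κ δ']
  obtain ⟨D, J₀, hD, hD'⟩ := h.exists_transition hf hε0
  obtain ⟨J₁, hJ₁⟩ := exists_nat_gt ((3 * B + ε₁ + T₀ + T₁ + ε) / ℓ)
  set J := max (max J₀ J₁) 2 with hJ
  have hJℓ : 3 * B + ε₁ + T₀ + T₁ + ε < J * ℓ := by
    rw [div_lt_iff₀ hℓ] at hJ₁
    have : (J₁ : ℝ) ≤ J := by
      exact_mod_cast (le_max_right J₀ J₁).trans (le_max_left _ 2)
    nlinarith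
  have hJJ₀ : J₀ ≤ J := (le_max_left J₀ J₁).trans (le_max_left _ 2)
  obtain ⟨m, hm⟩ := h.exists_good_site hf hB (le_max_right _ 2 : 2 ≤ J) hε0
  set N : ℤ := 5 * (m + 1) with hN
  have hN0 : 0 < N := by omega
  choose u s y hmin using fun σ : ℤ → Bool =>
    h.exists_minItin hf hB (J := J) (by linarith) (fun i => σ (i / N))
  have hword : ∀ (σ : ℤ → Bool) (q i : ℤ), q * N ≤ i → i < q * N + N → σ (i / N) = σ q :=
    fun σ q i h1 h2 => by rw [ediv_eq_of_mem hN0 h1 h2]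
  have hgood : ∀ σ (q p : ℤ), 0 ≤ p → p < 5 → ∃ i, q * N + p * (m + 1) ≤ i ∧
      i < q * N + (p + 1) * (m + 1) ∧ q * N ≤ i ∧ i < q * N + N ∧
      ∃ r, M.dist (y σ i) (β (σ q) r) ≤ ε := by
    intro σ q p hp hp'
    have e1 : 0 ≤ p * (m + 1 : ℤ) := by positivity
    have e2 : (p + 1) * (m + 1 : ℤ) ≤ N := mul_le_mul_of_nonneg_right (by omega) (by positivity)
    have e3 : (p + 1) * (m + 1 : ℤ) = p * (m + 1) + m + 1 := by ring
    obtain ⟨i, h1, h2, hr⟩ := hm _ _ _ _ (hmin σ) (σ q) (q * N + p * (m + 1))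
      (fun i h1 h2 => hword σ q i (by omega) (by omega))
    exact ⟨i, h1, by omega, by omega, by omega, hr⟩
  have hloc : ∀ σ, M.LocIso (u σ) := by
    intro σ
    refine (hmin σ).locIso h hf hB hT₀ (κ := κ) (by linarith) hE fun i => ?_
    set q := i / N with hq
    have hq1 : q * N ≤ i := Int.ediv_mul_le i hN0.ne'
    have hq2 : i < q * N + N := by
      have := Int.lt_ediv_add_one_mul_self i hN0
      rwa [add_mul, one_mul] at this
    have e1 : (q - 1) * N = q * N - N := by ring
    have e2 : (q + 1) * N = q * N + N := by ring
    obtain ⟨q', p, hp, hp', c1, c2⟩ : ∃ q' p : ℤ, 1 ≤ p ∧ p < 4 ∧ q' * N + (p + 1) * (m + 1) ≤ i ∧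
        i < q' * N + N + p * (m + 1) := by
      by_cases hi : i < q * N + 2 * (m + 1)
      · exact ⟨q - 1, 3, by norm_num, by norm_num, by omega, by omega⟩
      · exact ⟨q, 1, by norm_num, by norm_num, by omega, by omega⟩
    have e3 : (q' + 1) * N = q' * N + N := by ring
    obtain ⟨a, a1, a2, a3, a4, ar⟩ := hgood σ q' p (by omega) (by omega)
    obtain ⟨b, b1, b2, b3, b4, br⟩ := hgood σ (q' + 1) p (by omega) (by omega)
    have e4 : (p + 1) * (m + 1 : ℤ) = p * (m + 1) + m + 1 := by ring
    have e5 : 1 * (m + 1 : ℤ) ≤ p * (m + 1) := mul_le_mul_of_nonneg_right hp (by positivity)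
    have e6 : (p + 1) * (m + 1 : ℤ) ≤ 4 * (m + 1) :=
      mul_le_mul_of_nonneg_right (by omega) (by positivity)
    exact ⟨a, b, by omega, by omega, ((hmin σ).sub_le_dist h hf hB (by linarith) hD (hD' J hJJ₀)
      (X := σ q') (Y := σ (q' + 1)) (e := q' * N + N - 1) (by omega) (by omega)
      (fun j j1 j2 => hword σ q' j (by omega) (by omega))
      (fun j j1 j2 => hword σ (q' + 1) j (by omega) (by omega)) ar br).1.trans (by linarith)⟩
  refine ⟨N * (J * ℓ + 2 * B), by
      have : (0 : ℝ) < N := by exact_mod_cast hN0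
      positivity, ε₁ / 2, half_pos hε₁, C, u, hloc, fun σ => ?_,
    fun n σ σ' q hq0 hqn hne => ?_⟩
  · have := (hmin σ).eq 0
    rw [(hmin σ).zero, zero_mul, zero_smul, lat_zero, add_zero] at this
    rw [this]
    exact hC _ _ ((hmin σ).gate 0)
  · obtain ⟨a, a1, a2, a3, a4, ar⟩ := hgood σ' q 0 le_rfl (by norm_num)
    obtain ⟨g, g1, g2, g3, g4, gr⟩ := hgood σ' q 2 (by norm_num) (by norm_num)
    obtain ⟨b, b1, b2, b3, b4, br⟩ := hgood σ' q 4 (by norm_num) (by norm_num)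
    have hab := ((hmin σ').sub_le_dist h hf hB (by linarith) hD (hD' J hJJ₀) (X := σ' q) (Y := σ' q)
      (a := a) (e := a + 1) (b := b) (by omega) (by omega)
      (fun i i1 i2 => hword σ' q i (by omega) (by omega))
      (fun i i1 i2 => hword σ' q i (by omega) (by omega)) ar br).2 rfl
    have wg := hword σ q g g3 g4
    have wg' := hword σ' q g g3 g4
    refine ⟨s σ g, ?_, ?_, (hmin σ).exists_lt_dist (hmin σ') h hf hB (half_pos hε₁).le (by linarith)
      (T := T₁) (δ := δ') (ε := ε) (by linarith) (fun X Y hXY x hx r => by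
        rw [mul_div_cancel₀ _ two_ne_zero]; exact haway X Y hXY x hx r)
      (fun X v hv h1 h2 h3 t ht => hstay X v hv (h1.trans (by gcongr; exact min_le_left _ _)) h2
        (h3.imp fun r hr => hr.trans (min_le_left _ _)) t
        (ht.trans (by gcongr; exact min_le_right _ _))) (by linarith)
      (a := a) (g := g) (b := b) (by omega) (by omega)
      (by rw [wg, wg']; exact hne) (by linarith) (by rw [wg']; exact gr)⟩
    · rw [← (hmin σ).zero]
      exact (hmin σ).mono (by have := mul_nonneg hq0 hN0.le; omega)
    · have hg0 : 0 ≤ g := (mul_nonneg hq0 hN0.le).trans g3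
      have hgn : g ≤ n * N := by
        have : (q + 1) * N ≤ n * N := mul_le_mul_of_nonneg_right (by omega) hN0.le
        rw [add_mul, one_mul] at this
        omega
      have hgn' : (g : ℝ) ≤ n * N := by exact_mod_cast hgn
      refine ((hmin σ).le_mul h hB hg0).trans ?_
      rw [← mul_assoc]
      exact mul_le_mul_of_nonneg_right hgn' (by positivity)

end TorusMetric

/-! ### Exponentially many separated geodesics -/

lemma norm_le_norm2 (p : ℝ × ℝ) : ‖p‖ ≤ norm2 p := by
  rw [Prod.norm_def, norm2]
  refine max_le (Real.abs_le_sqrt ?_) (Real.abs_le_sqrt ?_)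
  · linarith [sq_nonneg p.2]
  · linarith [sq_nonneg p.1]

lemma one_le_norm_lat {k : ℤ × ℤ} (hk : k ≠ 0) : 1 ≤ ‖lat k‖ := by
  have h1 : ∀ n : ℤ, n ≠ 0 → (1 : ℝ) ≤ ‖(n : ℝ)‖ := fun n hn => by
    rw [Real.norm_eq_abs]
    exact_mod_cast Int.one_le_abs hn
  rw [Prod.norm_def]
  by_cases h : k.1 = 0
  · exact (h1 k.2 fun h' => hk (Prod.ext h h')).trans (le_max_right _ _)
  · exact (h1 k.1 h).trans (le_max_left _ _)

lemma le_phaseDist {ε : ℝ} (hε : ε ≤ 1 / 4) {p q : (ℝ × ℝ) × (ℝ × ℝ)} (h : ‖p.1 - q.1‖ = ε) :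
    ε ≤ phaseDist p q := by
  refine le_csInf ⟨_, 0, rfl⟩ ?_
  rintro r ⟨k, rfl⟩
  have h1 : 0 ≤ norm2 (p.2 - q.2) := Real.sqrt_nonneg _
  have h2 := norm_le_norm2 (p.1 - (q.1 + lat k))
  by_cases hk : k = 0
  · rw [hk, lat_zero, add_zero] at h2 ⊢
    linarith
  · have h3 := one_le_norm_lat hk
    have h4 := norm_sub_norm_le (lat k) (p.1 - q.1)
    rw [norm_sub_rev (lat k), sub_sub] at h4
    linarith

lemma exists_lt_phaseDist {γ γ' : ℝ → ℝ × ℝ} (hγ : Continuous γ) (hγ' : Continuous γ') {ε t : ℝ}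
    (hε0 : 0 < ε) (hε : ε ≤ 1 / 4) (h0 : ‖γ 0 - γ' 0‖ ≤ ε) (ht : 0 ≤ t) (h : ε ≤ ‖γ t - γ' t‖) :
    ∃ r ∈ Icc 0 t, ε / 2 < phaseDist (γ r, deriv γ r) (γ' r, deriv γ' r) := by
  obtain ⟨r, hr, hr'⟩ := intermediate_value_Icc ht (f := fun t => ‖γ t - γ' t‖)
    (hγ.sub hγ').norm.continuousOn ⟨h0, h⟩
  exact ⟨r, hr, (half_lt_self hε0).trans_le (le_phaseDist hε hr')⟩

lemma log_le_elog {r : ℝ} (hr : 0 < r) {x : ℝ≥0∞} (h : ENNReal.ofReal r ≤ x) :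
    ((Real.log r : ℝ) : EReal) ≤ elog x := by
  have h0 : x ≠ 0 := ((ENNReal.ofReal_pos.2 hr).trans_le h).ne'
  rw [elog, if_neg h0]
  split_ifs with ht
  · exact le_top
  · exact_mod_cast Real.log_le_log hr ((ENNReal.ofReal_le_iff_le_toReal ht).1 h)

lemma norm_sub_le_of_floor_eq {ε : ℝ} (hε : 0 < ε) {x y : ℝ × ℝ} (h1 : ⌊x.1 / ε⌋ = ⌊y.1 / ε⌋)
    (h2 : ⌊x.2 / ε⌋ = ⌊y.2 / ε⌋) : ‖x - y‖ ≤ ε := by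
  have key : ∀ a b : ℝ, ⌊a / ε⌋ = ⌊b / ε⌋ → |a - b| ≤ ε := fun a b hab => by
    have := Int.abs_sub_lt_one_of_floor_eq_floor hab
    rw [← sub_div, abs_div, abs_of_pos hε, div_lt_one hε] at this
    exact this.le
  exact max_le (key _ _ h1) (key _ _ h2)

lemma floor_mem_Icc {ε C a : ℝ} (hε : 0 < ε) (ha : |a| ≤ C) :
    ⌊a / ε⌋ ∈ Finset.Icc ⌊-C / ε⌋ ⌊C / ε⌋ := by
  rw [abs_le] at ha
  exact Finset.mem_Icc.2 ⟨Int.floor_le_floor (by gcongr; exact ha.1),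
    Int.floor_le_floor (by gcongr; exact ha.2)⟩

theorem topEnt_pos_of_separated {M : TorusMetric} {A ε C : ℝ} (hA : 0 < A) (hε : 0 < ε)
    {G : (ℤ → Bool) → ℝ → ℝ × ℝ} (hG : ∀ σ, M.LocIso (G σ)) (hC : ∀ σ, ‖G σ 0‖ ≤ C)
    (hsep : ∀ (n : ℕ) σ σ' (q : ℤ), 0 ≤ q → q < n → σ q ≠ σ' q →
      ∃ t, 0 ≤ t ∧ t ≤ n * A ∧ ε < M.dist (G σ t) (G σ' t)) : 0 < topEnt M := by
  set δ := min (ε / M.up) (1 / 4) with hδ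
  have hδ0 : 0 < δ := lt_min (div_pos hε M.up_pos) (by norm_num)
  have hsep' : ∀ (n : ℕ) σ σ' (q : ℤ), 0 ≤ q → q < n → σ q ≠ σ' q →
      ∃ t, 0 ≤ t ∧ t ≤ n * A ∧ δ ≤ ‖G σ t - G σ' t‖ := fun n σ σ' q h1 h2 h3 => by
    obtain ⟨t, t1, t2, t3⟩ := hsep n σ σ' q h1 h2 h3
    refine ⟨t, t1, t2, (min_le_left _ _).trans ?_⟩
    rw [div_le_iff₀ M.up_pos, norm_sub_rev, mul_comm]
    exact t3.le.trans (M.dist_le_up _ _)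
  set P : Finset (ℤ × ℤ) := Finset.Icc ⌊-C / δ⌋ ⌊C / δ⌋ ×ˢ Finset.Icc ⌊-C / δ⌋ ⌊C / δ⌋ with hP
  set cl : (ℝ × ℝ) → ℤ × ℤ := fun x => (⌊x.1 / δ⌋, ⌊x.2 / δ⌋) with hcl
  have hclP : ∀ σ, cl (G σ 0) ∈ P := fun σ => by
    have := hC σ
    exact Finset.mem_product.2 ⟨floor_mem_Icc hδ0 ((norm_fst_le _).trans this),
      floor_mem_Icc hδ0 ((norm_snd_le _).trans this)⟩
  have hPpos : (0 : ℝ) < P.card := by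
    exact_mod_cast Finset.card_pos.2 ⟨_, hclP fun _ => true⟩
  have hcount : ∀ n : ℕ, ENNReal.ofReal (2 ^ n / P.card) ≤ sepCount M (δ / 2) (n * A) := by
    intro n
    classical
    set ex : (Fin n → Bool) → ℤ → Bool := fun x i =>
      if h : i.toNat < n then x ⟨i.toNat, h⟩ else true with hex
    have hne : ∀ x x', x ≠ x' → ∃ q : ℤ, 0 ≤ q ∧ q < n ∧ ex x q ≠ ex x' q := fun x x' h => by
      obtain ⟨i, hi⟩ := Function.ne_iff.1 h
      refine ⟨i, by positivity, by exact_mod_cast i.2, ?_⟩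
      simpa [hex] using hi
    obtain ⟨c, -, hc⟩ := Finset.exists_le_card_fiber_of_nsmul_le_card_of_maps_to
      (s := (Finset.univ : Finset (Fin n → Bool))) (t := P) (f := fun x => cl (G (ex x) 0))
      (b := (2 : ℝ) ^ n / P.card) (fun x _ => hclP _) ⟨_, hclP fun _ => true⟩ (by
        rw [nsmul_eq_mul, mul_div_cancel₀ _ hPpos.ne']
        simp)
    set F := ({x ∈ (Finset.univ : Finset (Fin n → Bool)) | cl (G (ex x) 0) = c}) with hF
    have hapart : ∀ x ∈ F, ∀ x' ∈ F, x ≠ x' → ∃ t, 0 ≤ t ∧ t ≤ n * A ∧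
        δ ≤ ‖G (ex x) t - G (ex x') t‖ := fun x _ x' _ h => by
      obtain ⟨q, q1, q2, q3⟩ := hne x x' h
      exact hsep' n _ _ q q1 q2 q3
    have hinj : InjOn (fun x => G (ex x)) F := by
      intro x hx x' hx' he
      by_contra h
      obtain ⟨t, -, -, ht⟩ := hapart x hx x' hx' h
      simp only at he
      rw [he, sub_self, norm_zero] at ht
      exact absurd ht (not_le.2 hδ0)
    have hS : IsSeparated M (δ / 2) (n * A) (F.image fun x => G (ex x)) := by
      constructor
      · intro c hc
        obtain ⟨x, -, rfl⟩ := Finset.mem_image.1 hc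
        exact (hG _).isGeodesic
      · intro c₁ h₁ c₂ h₂ h
        obtain ⟨x, hx, rfl⟩ := Finset.mem_image.1 h₁
        obtain ⟨x', hx', rfl⟩ := Finset.mem_image.1 h₂
        obtain ⟨t, t1, t2, t3⟩ := hapart x hx x' hx' (fun he => h (by rw [he]))
        have hcc : cl (G (ex x) 0) = cl (G (ex x') 0) := by
          rw [(Finset.mem_filter.1 hx).2, (Finset.mem_filter.1 hx').2]
        obtain ⟨r, hr, hr'⟩ := exists_lt_phaseDist (hG (ex x)).continuous (hG (ex x')).continuous hδ0
          (min_le_right _ _) (norm_sub_le_of_floor_eq hδ0 (Prod.ext_iff.1 hcc).1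
            (Prod.ext_iff.1 hcc).2) t1 t3
        exact ⟨r, ⟨hr.1, hr.2.trans t2⟩, hr'⟩
    refine le_trans ?_ (le_iSup₂ (f := fun (F : Finset (ℝ → ℝ × ℝ))
      (_ : IsSeparated M (δ / 2) (n * A) F) => (F.card : ℝ≥0∞)) _ hS)
    rw [Finset.card_image_of_injOn hinj, ← ENNReal.ofReal_natCast]
    exact ENNReal.ofReal_le_ofReal hc
  have hlog2 : 0 < Real.log 2 := Real.log_pos one_lt_two
  have hpos : 0 < Real.log 2 / (2 * A) := by positivity
  refine lt_of_lt_of_le (EReal.coe_pos.2 hpos) (le_trans ?_ (le_iSup₂ (δ / 2) (half_pos hδ0)))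
  refine le_limsup_of_frequently_le (frequently_atTop.2 fun a => ?_)
  obtain ⟨n, hn⟩ := exists_nat_gt (max (max (a / A) (2 * Real.log P.card / Real.log 2)) 0)
  have hn0 : (0 : ℝ) < n := (le_max_right _ _).trans_lt hn
  have hn1 : a < n * A := by
    rw [← div_lt_iff₀ hA]; exact ((le_max_left _ _).trans (le_max_left _ _)).trans_lt hn
  have hn2 : 2 * Real.log P.card < n * Real.log 2 := by
    rw [← div_lt_iff₀ hlog2]; exact ((le_max_right _ _).trans (le_max_left _ _)).trans_lt hn
  refine ⟨n * A, hn1.le, ?_⟩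
  have h2 := log_le_elog (by positivity) (hcount n)
  refine le_trans ?_ (mul_le_mul_of_nonneg_left h2 (EReal.coe_nonneg.2 (by positivity)))
  rw [← EReal.coe_mul, EReal.coe_le_coe_iff, Real.log_div (by positivity) hPpos.ne', Real.log_pow,
    inv_mul_eq_div, div_le_div_iff₀ (by positivity) (by positivity)]
  nlinarith [mul_pos hn0 hA]

/-! ### The Fundamental Lemma -/

namespace TorusMetric
variable {M : TorusMetric}

theorem Config.topEnt_pos {k : ℤ × ℤ} {ℓ : ℝ} {S : Set (ℝ × ℝ)} {K : Bool → Set (ℝ × ℝ)}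
    {β : Bool → ℝ → ℝ × ℝ} {ρ : ℝ} (h : M.Config k ℓ S K β ρ) : 0 < topEnt M := by
  obtain ⟨f, hf⟩ := (h.ax true).exists_cal h.pos
  obtain ⟨A, hA, ε, hε, C, G, hG, hC, hsep⟩ := h.exists_separated hf
  exact topEnt_pos_of_separated hA hε hG hC hsep

/-- A minimal axis, with its orientation reversed if necessary, is an axis of positive period. -/
lemma exists_ax {α : ℝ → ℝ × ℝ} {τ : ℤ × ℤ} (hα : IsAxisOf M α τ) (hmin : IsMinimal M α) :
    ∃ ℓ γ, 0 < ℓ ∧ M.Ax τ ℓ γ ∧ range γ = range α := by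
  obtain ⟨hg, hτ, ℓ, hℓ⟩ := hα
  have hline : M.IsLine α := fun s t hst => by rw [hmin s t hst, length_of_unit_speed hg.2.1]
  rcases lt_trichotomy ℓ 0 with h | rfl | h
  · refine ⟨-ℓ, fun t => α (-t), neg_pos.2 h, ⟨fun s t hst => ?_, fun t => ?_⟩,
      neg_surjective.range_comp α⟩
    · rw [M.dist_comm, hline _ _ (neg_le_neg hst)]; ring
    · rw [← hℓ]; congr 1; ring
  · have h1 := hℓ 0
    rw [add_zero] at h1
    have h2 := one_le_norm_lat hτ
    rw [left_eq_add.1 h1, norm_zero] at h2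
    linarith
  · exact ⟨ℓ, α, h, ⟨hline, hℓ⟩, rfl⟩

end TorusMetric

lemma exists_mem_of_transInter_nonempty {α c : ℝ → ℝ × ℝ} {η : ℤ × ℤ} {D : Set ℝ}
    (h : (transInter (transl η α) c univ D).Nonempty) : ∃ s ∈ D, ∃ x ∈ range α, c s = x + lat η := by
  obtain ⟨x, t, -, s, hs, h1, h2, -⟩ := h
  exact ⟨s, hs, α t, mem_range_self t, h2.trans h1.symm⟩

/-- **Fundamental Lemma.** Let `g` be a Riemannian metric on `T²`, `α : ℝ → ℝ²` a minimal
axis of the translation element `τ`, and `c₁ : [0,a] → ℝ²`, `c₂ : [0,b] → ℝ²` geodesic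
segments (restrictions of geodesics) with endpoints on `α(ℝ)` and interiors disjoint from
`α(ℝ)`.  If there is a translation element `η` with `η α(ℝ) ∩ α(ℝ) = ∅` such that `η α(ℝ)`
meets `c₁([0,a])` transversally and `η⁻¹ α(ℝ)` meets `c₂([0,b])` transversally, then the
geodesic flow of `g` has positive topological entropy. -/
theorem stmt7 (M : TorusMetric) (α : ℝ → ℝ × ℝ) (τ : ℤ × ℤ)
    (hα : IsAxisOf M α τ) (hmin : IsMinimal M α)
    (c₁ c₂ : ℝ → ℝ × ℝ) (a b : ℝ)
    (h₁ : M.IsGeodesic c₁) (h₂ : M.IsGeodesic c₂)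
    (hend₁ : c₁ 0 ∈ Set.range α ∧ c₁ a ∈ Set.range α)
    (hend₂ : c₂ 0 ∈ Set.range α ∧ c₂ b ∈ Set.range α)
    (hint₁ : ∀ t ∈ Set.Ioo 0 a, c₁ t ∉ Set.range α)
    (hint₂ : ∀ t ∈ Set.Ioo 0 b, c₂ t ∉ Set.range α)
    (η : ℤ × ℤ) (hη : η ≠ 0)
    (hdisj : Set.range (transl η α) ∩ Set.range α = ∅)
    (hcross₁ : (transInter (transl η α) c₁ Set.univ (Set.Icc 0 a)).Nonempty)
    (hcross₂ : (transInter (transl (-η) α) c₂ Set.univ (Set.Icc 0 b)).Nonempty) :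
    0 < topEnt M := by
  obtain ⟨ℓ, γ, hℓ, hγ, hr⟩ := TorusMetric.exists_ax hα hmin
  rw [← hr] at hend₁ hend₂
  obtain ⟨s₁, hs₁, _, ⟨t₁, rfl⟩, e₁⟩ := exists_mem_of_transInter_nonempty hcross₁
  obtain ⟨s₂, hs₂, _, ⟨t₂, rfl⟩, e₂⟩ := exists_mem_of_transInter_nonempty hcross₂
  obtain ⟨v₁, hv₁⟩ := hr.symm.subset (mem_range_self t₁)
  obtain ⟨v₂, hv₂⟩ := hr.symm.subset (mem_range_self t₂)
  rw [← hv₁] at e₁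
  rw [← hv₂] at e₂
  have hne : crossDet (lat τ) (lat η) ≠ 0 := fun h0 => by
    obtain ⟨s, t, hst⟩ := (hγ.perCurve hℓ).exists_meet_translate h0
    obtain ⟨t', ht'⟩ := hr.subset (mem_range_self t)
    have hm : γ s ∈ range (transl η α) ∩ range α :=
      ⟨⟨t', by rw [transl, ht', hst]⟩, hr.subset (mem_range_self s)⟩
    rw [hdisj] at hm
    exact hm
  rcases lt_or_gt_of_ne hne with h | h
  · have h' : 0 < crossDet (lat τ) (lat (-η)) := by
      rw [lat_neg, ← neg_one_smul ℝ (lat η), crossDet_smul_right]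
      linarith
    obtain ⟨S, K, β, ρ, H⟩ := TorusMetric.exists_config hγ hℓ h₂.locIso h₁.locIso hend₂.1 hend₂.2
      hend₁.1 hend₁.2 h' ⟨s₂, hs₂, v₂, e₂⟩ ⟨s₁, hs₁, v₁, by rw [neg_neg]; exact e₁⟩
    exact H.topEnt_pos
  · obtain ⟨S, K, β, ρ, H⟩ := TorusMetric.exists_config hγ hℓ h₁.locIso h₂.locIso hend₁.1 hend₁.2
      hend₂.1 hend₂.2 h ⟨s₁, hs₁, v₁, e₁⟩ ⟨s₂, hs₂, v₂, e₂⟩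
    exact H.topEnt_pos
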